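/- (Marklof's limit distribution theorem.) Let d ≥ 3 be an integer, let μ₀ be an SL_{d−1}(ℝ)-invariant Borel probability measure on X₀ = SL_{d−1}(ℝ)/SL_{d−1}(ℤ), let 𝒟 ⊆ {x ∈ ℝ^d : x_i > 0 for all i} be a bounded set whose topological boundary has Lebesgue measure zero, and let R ≥ 0. Then, as the real parameter T → ∞, T^{−d}·#{a ∈ ℤ^d : gcd(a_1,…,a_d) = 1, a_i ≥ 2 for all i, a/T ∈ 𝒟, and F(a) ≤ R·(a_1⋯a_d)^{1/(d−1)}} converges to (vol(𝒟)/ζ(d))·μ₀(E_R), where ζ(d) = Σ_{n=1}^∞ n^{−d}, vol is Lebesgue measure, and E_R = {⟦g⟧ ∈ X₀ : Q(Δ_{d−1}, g·ℤ^{d−1}) ≤ R}. -/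

import Mathlib

noncomputable section

open MeasureTheory Matrix Pointwise

/-- `SL_n(ℝ)` -/
abbrev SLR (n : ℕ) := Matrix.SpecialLinearGroup (Fin n) ℝ

instance (n : ℕ) : TopologicalSpace (SLR n) :=
  TopologicalSpace.induced (fun g => (g : Matrix (Fin n) (Fin n) ℝ)) inferInstance

/-- `SL_n(ℤ)` viewed as a subgroup of `SL_n(ℝ)`. -/
def SLZsub (n : ℕ) : Subgroup (SLR n) :=
  (Matrix.SpecialLinearGroup.map (n := Fin n) (Int.castRingHom ℝ)).range

/-- The space of unimodular lattices `X = SL_n(ℝ)/SL_n(ℤ)`. -/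
abbrev XQuot (n : ℕ) := SLR n ⧸ SLZsub n

instance (n : ℕ) : MeasurableSpace (XQuot n) := borel _

/-- The lattice `M·ℤ^n` associated to a matrix `M`. -/
def matLattice {n : ℕ} (M : Matrix (Fin n) (Fin n) ℝ) : Set (Fin n → ℝ) :=
  {x | ∃ v : Fin n → ℤ, x = M.mulVec fun i => (v i : ℝ)}

/-- The covering radius `Q(K, L) = inf{t > 0 : tK + L = ℝ^n}`. -/
def covRad (n : ℕ) (K L : Set (Fin n → ℝ)) : ℝ :=
  sInf {t : ℝ | 0 < t ∧ ∀ x : Fin n → ℝ, ∃ k ∈ K, ∃ l ∈ L, x = t • k + l}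

/-- The standard simplex `Δ_n = {x : x_i ≥ 0, ∑ x_i ≤ 1}`. -/
def simplexStd (n : ℕ) : Set (Fin n → ℝ) :=
  {x | (∀ i, 0 ≤ x i) ∧ ∑ i, x i ≤ 1}

/-- The unimodular lattice `g·ℤ^n` of `g ∈ SL_n(ℝ)`. -/
def latticeOf {n : ℕ} (g : SLR n) : Set (Fin n → ℝ) :=
  matLattice (g : Matrix (Fin n) (Fin n) ℝ)

/-- The set of natural numbers not representable as a nonnegative integer
combination of the coordinates of `a`. -/
def nonRepresentable (d : ℕ) (a : Fin d → ℤ) : Set ℕ :=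
  {m : ℕ | ¬ ∃ k : Fin d → ℕ, (m : ℤ) = ∑ i, (k i : ℤ) * a i}

/-- The Frobenius number `F(a)`: the largest natural number not representable
as a nonnegative integer combination of the coordinates of `a`. -/
def frobNum (d : ℕ) (a : Fin d → ℤ) : ℕ := sSup (nonRepresentable d a)

/-- `ζ(d) = ∑_{n ≥ 1} n^{-d}`. -/
def zetaVal (d : ℕ) : ℝ := ∑' k : ℕ, 1 / ((k : ℝ) + 1) ^ d

/-! ### Integer matrices -/

section IntegerMatrices

variable {ι : Type*} [Fintype ι] [DecidableEq ι]

/-- `v` and `w` lie in the same orbit of `SL(ℤ)` acting on row vectors. -/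
def RowReach (v w : ι → ℤ) : Prop :=
  ∃ γ : Matrix.SpecialLinearGroup ι ℤ, v ᵥ* (γ : Matrix ι ι ℤ) = w

lemma RowReach.trans {u v w : ι → ℤ} (h : RowReach u v) (h' : RowReach v w) : RowReach u w := by
  obtain ⟨γ, rfl⟩ := h
  obtain ⟨δ, rfl⟩ := h'
  exact ⟨γ * δ, by simp [Matrix.vecMul_vecMul]⟩

lemma RowReach.refl (v : ι → ℤ) : RowReach v v := ⟨1, by simp⟩

lemma rowReach_update (v : ι → ℤ) {i j : ι} (hij : i ≠ j) (c : ℤ) :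
    RowReach v (Function.update v j (v j + v i * c)) := by
  refine ⟨⟨Matrix.transvection i j c, Matrix.det_transvection_of_ne i j hij c⟩, ?_⟩
  have h1 : v ᵥ* Matrix.transvection i j c = v + Pi.single j (v i * c) := by
    rw [Matrix.transvection, Matrix.vecMul_add, Matrix.vecMul_one]
    congr 1
    ext k
    rcases eq_or_ne k j with rfl | hk
    · simp [Matrix.vecMul, dotProduct, Matrix.single_apply]
    · simp [Matrix.vecMul, dotProduct, hk, hk.symm]
  rw [h1]
  ext k
  by_cases hk : k = j
  · subst hk; simp
  · simp [hk]

lemma exists_rowReach_single [Nonempty ι] (v : ι → ℤ) :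
    ∃ (k : ι) (h : ℤ), RowReach v (Pi.single k h) := by
  induction hn : ∑ i, (v i).natAbs using Nat.strong_induction_on generalizing v with
  | _ n ih =>
  by_cases hv : ∃ i j, i ≠ j ∧ v i ≠ 0 ∧ v j ≠ 0
  · obtain ⟨i, j, hij, hi, hj⟩ := hv
    wlog hle : (v i).natAbs ≤ (v j).natAbs generalizing i j
    · exact this j i hij.symm hj hi (by omega)
    obtain ⟨c, hc⟩ : ∃ c : ℤ, (v j + v i * c).natAbs < (v j).natAbs := by
      rcases lt_or_gt_of_ne hi with h1 | h1 <;> rcases lt_or_gt_of_ne hj with h2 | h2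
      · exact ⟨-1, by omega⟩
      · exact ⟨1, by omega⟩
      · exact ⟨1, by omega⟩
      · exact ⟨-1, by omega⟩
    have hlt : ∑ k, (Function.update v j (v j + v i * c) k).natAbs < n := by
      rw [← hn]
      apply Finset.sum_lt_sum
      · intro k _
        by_cases hk : k = j
        · subst hk; simpa using hc.le
        · simp [hk]
      · exact ⟨j, Finset.mem_univ _, by simpa using hc⟩
    obtain ⟨k, h, hr⟩ := ih _ hlt _ rfl
    exact ⟨k, h, (rowReach_update v hij c).trans hr⟩
  · push Not at hv
    by_cases h0 : ∃ i, v i ≠ 0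
    · obtain ⟨i, hi⟩ := h0
      refine ⟨i, v i, ?_⟩
      have : Pi.single i (v i) = v := by
        ext j
        by_cases hj : j = i
        · subst hj; simp
        · simp [hj, hv i j (Ne.symm hj) hi]
      rw [this]
      exact RowReach.refl v
    · push Not at h0
      obtain ⟨i⟩ := ‹Nonempty ι›
      refine ⟨i, 0, ?_⟩
      have : v = Pi.single i 0 := by ext j; simp [h0]
      rw [← this]
      exact RowReach.refl v

lemma rowReach_single_move {k k' : ι} (hk : k ≠ k') (h : ℤ) :
    RowReach (Pi.single k h : ι → ℤ) (Pi.single k' h) := by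
  have h1 := rowReach_update (Pi.single k h) hk 1
  refine h1.trans ?_
  have h2 := rowReach_update (Function.update (Pi.single k h) k'
    ((Pi.single k h : ι → ℤ) k' + (Pi.single k h : ι → ℤ) k * 1)) hk.symm (-1)
  convert h2 using 1
  ext j
  by_cases hj : j = k
  · subst hj; simp [hk, hk.symm]
  · by_cases hj' : j = k'
    · subst hj'; simp [hk.symm]
    · simp [hj, hj']

lemma rowReach_single_neg {k k' : ι} (hk : k ≠ k') (h : ℤ) :
    RowReach (Pi.single k h : ι → ℤ) (Pi.single k (-h)) := by
  have e1 : RowReach (Pi.single k h : ι → ℤ) (Pi.single k' (-h)) := by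
    have h1 := rowReach_update (Pi.single k h) hk (-1)
    refine h1.trans ?_
    have h2 := rowReach_update (Function.update (Pi.single k h) k'
      ((Pi.single k h : ι → ℤ) k' + (Pi.single k h : ι → ℤ) k * (-1))) hk.symm 1
    convert h2 using 1
    ext j
    by_cases hj : j = k
    · subst hj; simp [hk, hk.symm]
    · by_cases hj' : j = k'
      · subst hj'; simp [hk.symm]
      · simp [hj, hj']
  exact e1.trans (rowReach_single_move hk.symm _)

/-- Every integer row vector can be moved by `SL(ℤ)` to a nonnegative multiple of a given
coordinate vector. -/
lemma exists_rowReach_single_nonneg [Nontrivial ι] (v : ι → ℤ) (k : ι) :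
    ∃ h : ℤ, 0 ≤ h ∧ RowReach v (Pi.single k h) := by
  obtain ⟨k₁, h, hr⟩ := exists_rowReach_single v
  have hr' : RowReach v (Pi.single k h) := by
    by_cases hk : k₁ = k
    · subst hk; exact hr
    · exact hr.trans (rowReach_single_move hk h)
  rcases le_total 0 h with hh | hh
  · exact ⟨h, hh, hr'⟩
  · obtain ⟨k', hk'⟩ := exists_ne k
    exact ⟨-h, by omega, hr'.trans (rowReach_single_neg hk'.symm h)⟩

/-- A primitive integer row vector can be moved by `SL(ℤ)` to a coordinate vector. -/
lemma exists_vecMul_eq_single [Nontrivial ι] (v : ι → ℤ) (hv : Finset.univ.gcd v = 1) (k : ι) :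
    ∃ γ : Matrix.SpecialLinearGroup ι ℤ, v ᵥ* (γ : Matrix ι ι ℤ) = Pi.single k 1 := by
  obtain ⟨h, hh, γ, hγ⟩ := exists_rowReach_single_nonneg v k
  have hdvd : ∀ i, h ∣ v i := by
    intro i
    have : v = (Pi.single k h) ᵥ* ((γ⁻¹ : Matrix.SpecialLinearGroup ι ℤ) : Matrix ι ι ℤ) := by
      have h2 : (γ : Matrix ι ι ℤ) * ((γ⁻¹ : Matrix.SpecialLinearGroup ι ℤ) : Matrix ι ι ℤ) = 1 := by
        rw [← Matrix.SpecialLinearGroup.coe_mul, mul_inv_cancel, Matrix.SpecialLinearGroup.coe_one]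
      rw [← hγ, Matrix.vecMul_vecMul, h2, Matrix.vecMul_one]
    rw [this]
    simp
  have h1 : h ∣ 1 := by
    rw [← hv]
    exact Finset.dvd_gcd fun i _ => hdvd i
  have : h = 1 := by
    have := Int.le_of_dvd one_pos h1
    rcases (by omega : h = 0 ∨ h = 1) with h0 | h0
    · subst h0; simp at h1
    · exact h0
  exact ⟨γ, by rw [hγ, this]⟩

end IntegerMatrices

section HermiteNormalForm

/-- A block lower triangular matrix with first row `(h, 0)`. -/
def lowerBlock {n : ℕ} (h : ℤ) (c : Fin n → ℤ) (H : Matrix (Fin n) (Fin n) ℤ) :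
    Matrix (Fin (n + 1)) (Fin (n + 1)) ℤ :=
  Matrix.of (Fin.cons (Fin.cons h 0) fun i => Fin.cons (c i) (H i))

lemma det_lowerBlock {n : ℕ} (h : ℤ) (c : Fin n → ℤ) (H : Matrix (Fin n) (Fin n) ℤ) :
    (lowerBlock h c H).det = h * H.det := by
  rw [Matrix.det_succ_row_zero, Fin.sum_univ_succ]
  have h1 : (lowerBlock h c H).submatrix Fin.succ (Fin.succAbove 0) = H := by
    ext i j; simp [lowerBlock]
  rw [h1]
  simp [lowerBlock]

lemma lowerBlock_mul {n : ℕ} (h : ℤ) (c c' : Fin n → ℤ) (H H' : Matrix (Fin n) (Fin n) ℤ) :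
    lowerBlock h c H * lowerBlock 1 c' H' = lowerBlock h (c + H *ᵥ c') (H * H') := by
  ext i j
  refine Fin.cases ?_ (fun i => ?_) i <;> refine Fin.cases ?_ (fun j => ?_) j <;>
    simp [lowerBlock, Matrix.mul_apply, Fin.sum_univ_succ, Matrix.mulVec, dotProduct]

/-- A countable family of representatives of the nonsingular integer matrices modulo right
multiplication by `SL(ℤ)`, with representatives of the corresponding finite quotients. -/
structure HermiteFamily (n : ℕ) where
  /-- the index type -/
  Idx : Type
  /-- the representing matrices -/
  mat : Idx → Matrix (Fin n) (Fin n) ℤ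
  /-- representatives of the quotient of `ℤ^n` by the column lattice -/
  rep : Idx → Finset (Fin n → ℤ)
  det_pos : ∀ i, 0 < (mat i).det
  card_rep : ∀ i, ((rep i).card : ℤ) ≤ (mat i).det
  mem_rep : ∀ i v, ∃ k, v - mat i *ᵥ k ∈ rep i
  factor : ∀ H : Matrix (Fin n) (Fin n) ℤ, 0 < H.det →
    ∃ (i : Idx) (γ : Matrix.SpecialLinearGroup (Fin n) ℤ),
      H = mat i * (γ : Matrix (Fin n) (Fin n) ℤ)
  summable : ∀ s : ℕ, n + 1 ≤ s → Summable fun i => (((mat i).det : ℝ) ^ s)⁻¹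

lemma exists_mul_eq_lowerBlock {n : ℕ} (H : Matrix (Fin (n + 1)) (Fin (n + 1)) ℤ)
    (hH : 0 < H.det) :
    ∃ (γ : Matrix.SpecialLinearGroup (Fin (n + 1)) ℤ) (h : ℤ) (c : Fin n → ℤ)
      (H' : Matrix (Fin n) (Fin n) ℤ), 0 < h ∧ 0 < H'.det ∧
      H * (γ : Matrix (Fin (n + 1)) (Fin (n + 1)) ℤ) = lowerBlock h c H' := by
  obtain ⟨h, hh, γ, hγ⟩ : ∃ h : ℤ, 0 ≤ h ∧ RowReach (H 0) (Pi.single 0 h) := by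
    rcases n with _ | n
    · refine ⟨H 0 0, ?_, ?_⟩
      · rw [Matrix.det_fin_one] at hH; exact hH.le
      · have : H 0 = Pi.single 0 (H 0 0) := by
          ext j; fin_cases j; simp
        rw [← this]; exact RowReach.refl _
    · exact exists_rowReach_single_nonneg _ _
  set A := H * (γ : Matrix (Fin (n + 1)) (Fin (n + 1)) ℤ) with hA
  have hrow : A 0 = Pi.single 0 h := by
    rw [← hγ]; ext j; simp [hA, Matrix.mul_apply, Matrix.vecMul, dotProduct]
  have hAeq : A = lowerBlock h (fun i => A i.succ 0) (A.submatrix Fin.succ Fin.succ) := by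
    ext i j
    refine Fin.cases ?_ (fun i => ?_) i
    · rw [hrow]; refine Fin.cases ?_ (fun j => ?_) j <;> simp [lowerBlock]
    · refine Fin.cases ?_ (fun j => ?_) j <;> simp [lowerBlock]
  have hdet : 0 < h * (A.submatrix Fin.succ Fin.succ).det := by
    rw [← det_lowerBlock h (fun i => A i.succ 0), ← hAeq, hA, Matrix.det_mul]
    simpa using hH
  have hpos : 0 < h := by
    rcases hh.eq_or_lt with h0 | h0
    · rw [← h0] at hdet; simp at hdet
    · exact h0
  exact ⟨γ, h, _, _, hpos, pos_of_mul_pos_right hdet hh, hAeq⟩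

lemma nonempty_hermiteFamily (n : ℕ) : Nonempty (HermiteFamily n) := by
  induction n with
  | zero =>
    exact ⟨{ Idx := Unit, mat := fun _ => 1, rep := fun _ => {0}
             det_pos := by simp
             card_rep := by simp
             mem_rep := fun _ v => ⟨0, by simp [Subsingleton.elim v 0]⟩
             factor := fun H _ => ⟨(), 1, Subsingleton.elim _ _⟩
             summable := fun s _ => Summable.of_finite }⟩
  | succ n ih =>
    obtain ⟨P⟩ := ih
    refine ⟨{ Idx := Σ i : P.Idx, (P.rep i) × ℕ
              mat := fun x => lowerBlock ((x.2.2 : ℤ) + 1) x.2.1 (P.mat x.1)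
              rep := fun x => ((Finset.range (x.2.2 + 1)) ×ˢ P.rep x.1).image
                fun y => Fin.cons (y.1 : ℤ) y.2
              det_pos := ?_, card_rep := ?_, mem_rep := ?_, factor := ?_, summable := ?_ }⟩
    · intro x
      rw [det_lowerBlock]
      have := P.det_pos x.1
      positivity
    · intro x
      rw [det_lowerBlock]
      have h1 : (((Finset.range (x.2.2 + 1)) ×ˢ P.rep x.1).image
          fun y => (Fin.cons (y.1 : ℤ) y.2 : Fin (n + 1) → ℤ)).card
          ≤ (x.2.2 + 1) * (P.rep x.1).card := by
        refine Finset.card_image_le.trans ?_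
        simp
      have h2 := P.card_rep x.1
      have h3 : (((Finset.range (x.2.2 + 1)) ×ˢ P.rep x.1).image
          fun y => (Fin.cons (y.1 : ℤ) y.2 : Fin (n + 1) → ℤ)).card
          ≤ ((x.2.2 : ℤ) + 1) * (P.rep x.1).card := by exact_mod_cast h1
      exact h3.trans (mul_le_mul_of_nonneg_left h2 (by positivity))
    · rintro ⟨i, c, h⟩ v
      obtain ⟨k, hk⟩ := P.mem_rep i (fun j => v j.succ - c.1 j * (v 0 / ((h : ℤ) + 1)))
      refine ⟨Fin.cons (v 0 / ((h : ℤ) + 1)) k, ?_⟩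
      rw [Finset.mem_image]
      have hpos : (0 : ℤ) < (h : ℤ) + 1 := by positivity
      refine ⟨((v 0 % ((h : ℤ) + 1)).toNat, _), Finset.mem_product.2 ⟨?_, hk⟩, ?_⟩
      · have := Int.emod_lt_of_pos (v 0) hpos
        have := Int.emod_nonneg (v 0) hpos.ne'
        simp only [Finset.mem_range]
        omega
      · ext j
        refine Fin.cases ?_ (fun j => ?_) j
        · have := Int.emod_nonneg (v 0) hpos.ne'
          simp [lowerBlock, Matrix.mulVec, dotProduct, Fin.sum_univ_succ, this]
          rw [Int.emod_def]
        · simp [lowerBlock, Matrix.mulVec, dotProduct, Fin.sum_univ_succ]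
          ring
    · intro H hH
      obtain ⟨γ, h, c, H', hh, hH', hB⟩ := exists_mul_eq_lowerBlock H hH
      obtain ⟨i, γ', hγ'⟩ := P.factor H' hH'
      obtain ⟨k, hk⟩ := P.mem_rep i c
      obtain ⟨m, rfl⟩ : ∃ m : ℕ, h = m + 1 := ⟨(h - 1).toNat, by omega⟩
      let δ : Matrix.SpecialLinearGroup (Fin (n + 1)) ℤ :=
        ⟨lowerBlock 1 k γ'.1, by rw [det_lowerBlock, γ'.2, one_mul]⟩
      refine ⟨⟨i, ⟨_, hk⟩, m⟩, δ * γ⁻¹, ?_⟩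
      have h1 : lowerBlock ((m : ℤ) + 1) (c - P.mat i *ᵥ k) (P.mat i) * δ.1
          = H * (γ : Matrix (Fin (n + 1)) (Fin (n + 1)) ℤ) := by
        rw [hB, hγ', lowerBlock_mul]; simp
      have h2 : (γ : Matrix (Fin (n + 1)) (Fin (n + 1)) ℤ) *
          ((γ⁻¹ : Matrix.SpecialLinearGroup (Fin (n + 1)) ℤ) :
            Matrix (Fin (n + 1)) (Fin (n + 1)) ℤ) = 1 := by
        rw [← Matrix.SpecialLinearGroup.coe_mul, mul_inv_cancel,
          Matrix.SpecialLinearGroup.coe_one]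
      rw [Matrix.SpecialLinearGroup.coe_mul, ← Matrix.mul_assoc]
      erw [h1]
      rw [Matrix.mul_assoc, h2, Matrix.mul_one]
    · intro s hs
      have hpos : ∀ i, (0 : ℝ) < ((P.mat i).det : ℝ) := fun i => by exact_mod_cast P.det_pos i
      have hnat : Summable fun m : ℕ => (((m : ℝ) + 1) ^ s)⁻¹ := by
        have := (summable_nat_add_iff 1).2 (Real.summable_nat_pow_inv.2 (by omega : 1 < s))
        simpa using this
      rw [summable_sigma_of_nonneg (fun x => by
        rw [det_lowerBlock, Int.cast_mul]; have := hpos x.1; positivity)]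
      have heq : ∀ i (y : (P.rep i) × ℕ),
          (((lowerBlock ((y.2 : ℤ) + 1) y.1 (P.mat i)).det : ℝ) ^ s)⁻¹
          = ((((P.mat i).det : ℝ)) ^ s)⁻¹ * (((y.2 : ℝ) + 1) ^ s)⁻¹ := by
        intro i y
        rw [det_lowerBlock]; push_cast; rw [mul_pow, mul_inv, mul_comm]
      simp only [heq]
      have hs1 : ∀ i, Summable fun y : (P.rep i) × ℕ => (((y.2 : ℝ) + 1) ^ s)⁻¹ := by
        intro i
        rw [summable_prod_of_nonneg (fun y => by positivity)]
        exact ⟨fun _ => hnat, Summable.of_finite⟩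
      refine ⟨fun i => (hs1 i).mul_left _, ?_⟩
      simp only [tsum_mul_left]
      have hs2 : ∀ i, ∑' y : (P.rep i) × ℕ, (((y.2 : ℝ) + 1) ^ s)⁻¹
          = (P.rep i).card * ∑' m : ℕ, (((m : ℝ) + 1) ^ s)⁻¹ := by
        intro i
        rw [(hs1 i).tsum_prod]
        simp
      simp only [hs2]
      have hC : 0 ≤ ∑' m : ℕ, (((m : ℝ) + 1) ^ s)⁻¹ := tsum_nonneg fun m => by positivity
      refine Summable.of_nonneg_of_le (fun i => ?_) (fun i => ?_)
        ((P.summable (s - 1) (by omega)).mul_right (∑' m : ℕ, (((m : ℝ) + 1) ^ s)⁻¹))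
      · have := hpos i; positivity
      · rw [← mul_assoc]
        refine mul_le_mul_of_nonneg_right ?_ hC
        obtain ⟨t, rfl⟩ : ∃ t, s = t + 1 := ⟨s - 1, by omega⟩
        have h1 := hpos i
        have h2 : ((P.rep i).card : ℝ) ≤ (P.mat i).det := by exact_mod_cast P.card_rep i
        rw [Nat.add_sub_cancel, pow_succ, mul_inv, mul_assoc]
        refine mul_le_of_le_one_right (by positivity) ?_
        rw [inv_mul_le_iff₀ h1]; simpa using h2

end HermiteNormalForm

section Minors

variable {R : Type*} [CommRing R] {e : ℕ}

/-- The signed maximal minors of the `(e + 1) × e` matrix with upper block `B` and last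
row `r`. -/
def minors (B : Matrix (Fin e) (Fin e) R) (r : Fin e → R) : Fin (e + 1) → R :=
  Fin.snoc (α := fun _ => R) (-(r ᵥ* B.adjugate)) B.det

@[simp] lemma minors_last (B : Matrix (Fin e) (Fin e) R) (r : Fin e → R) :
    minors B r (Fin.last e) = B.det := by simp [minors]

@[simp] lemma minors_castSucc (B : Matrix (Fin e) (Fin e) R) (r : Fin e → R) (i : Fin e) :
    minors B r i.castSucc = -(r ᵥ* B.adjugate) i := by simp [minors]

lemma minors_mul (B γ : Matrix (Fin e) (Fin e) R) (r : Fin e → R) :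
    minors (B * γ) (r ᵥ* γ) = γ.det • minors B r := by
  ext i
  refine Fin.lastCases ?_ (fun i => ?_) i
  · simp [Matrix.det_mul, mul_comm]
  · simp only [minors_castSucc, Pi.smul_apply, smul_eq_mul, Matrix.adjugate_mul_distrib,
      Matrix.vecMul_vecMul]
    rw [← Matrix.mul_assoc, Matrix.mul_adjugate]
    simp [Matrix.vecMul_smul]

lemma minors_smul [NeZero e] (c : R) (B : Matrix (Fin e) (Fin e) R) (r : Fin e → R) :
    minors (c • B) (c • r) = c ^ e • minors B r := by
  ext i
  refine Fin.lastCases ?_ (fun i => ?_) i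
  · simp
  · obtain ⟨k, rfl⟩ : ∃ k, e = k + 1 := ⟨e - 1, by have := NeZero.ne e; omega⟩
    simp only [minors_castSucc, Pi.smul_apply, smul_eq_mul, Matrix.adjugate_smul,
      Matrix.vecMul_smul, Matrix.smul_vecMul, Fintype.card_fin, Nat.add_sub_cancel, pow_succ]
    ring

lemma minors_orthogonal (B : Matrix (Fin e) (Fin e) R) (r : Fin e → R) (j : Fin e) :
    ∑ i, minors B r (Fin.castSucc i) * B i j + minors B r (Fin.last e) * r j = 0 := by
  have h : (r ᵥ* B.adjugate) ᵥ* B = B.det • r := by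
    rw [Matrix.vecMul_vecMul, Matrix.adjugate_mul, Matrix.vecMul_smul, Matrix.vecMul_one]
  have h' := congrFun h j
  simp only [Matrix.vecMul, dotProduct, Pi.smul_apply, smul_eq_mul] at h'
  simp only [minors_castSucc, minors_last, neg_mul, Finset.sum_neg_distrib]
  rw [← h']
  simp [Matrix.vecMul, dotProduct]

lemma minors_map {S : Type*} [CommRing S] (f : R →+* S) (B : Matrix (Fin e) (Fin e) R)
    (r : Fin e → R) : minors (B.map f) (f ∘ r) = f ∘ minors B r := by
  ext i
  refine Fin.lastCases ?_ (fun i => ?_) i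
  · simp [RingHom.map_det]
  · simp only [minors_castSucc, Function.comp_apply, map_neg]
    rw [← RingHom.mapMatrix_apply, ← RingHom.map_adjugate, RingHom.mapMatrix_apply,
      RingHom.map_vecMul]

end Minors

section KernelBasis

variable {e : ℕ}

/-- The columns of `(B; r)` form a basis of the integer vectors orthogonal to `a`. -/
structure IsKernelBasis (a : Fin (e + 1) → ℤ) (B : Matrix (Fin e) (Fin e) ℤ) (r : Fin e → ℤ) :
    Prop where
  det_eq : B.det = a (Fin.last e)
  orth : ∀ j, ∑ i, a (Fin.castSucc i) * B i j + a (Fin.last e) * r j = 0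
  span : ∀ x : Fin (e + 1) → ℤ, ∑ i, a i * x i = 0 →
    ∃ y, (∀ i : Fin e, x i.castSucc = (B *ᵥ y) i) ∧ x (Fin.last e) = r ⬝ᵥ y

lemma exists_isKernelBasis [NeZero e] (a : Fin (e + 1) → ℤ) (ha : Finset.univ.gcd a = 1) :
    ∃ B r, IsKernelBasis a B r := by
  have : Nontrivial (Fin (e + 1)) := Fin.nontrivial_iff_two_le.2 (by have := NeZero.pos e; omega)
  obtain ⟨γ, hγ⟩ := exists_vecMul_eq_single a ha (Fin.last e)
  have ha' : a = Pi.single (Fin.last e) 1 ᵥ* γ.1.adjugate := by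
    rw [← hγ, Matrix.vecMul_vecMul, Matrix.mul_adjugate, γ.2]; simp
  have ha2 : ∀ i, a i = γ.1.adjugate (Fin.last e) i := by
    intro i; rw [ha']; simp
  refine ⟨γ.1.submatrix Fin.castSucc Fin.castSucc, fun j => γ.1 (Fin.last e) j.castSucc,
    ?_, ?_, ?_⟩
  · rw [ha2, Matrix.adjugate_fin_succ_eq_det_submatrix, Fin.succAbove_last, ← two_mul]
    simp [pow_mul]
  · intro j
    have := congrFun hγ j.castSucc
    simpa [Matrix.vecMul, dotProduct, Fin.sum_univ_castSucc, Fin.castSucc_ne_last] using this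
  · intro x hx
    set y := γ.1.adjugate *ᵥ x with hy
    have hxy : x = γ.1 *ᵥ y := by
      rw [hy, Matrix.mulVec_mulVec, Matrix.mul_adjugate, γ.2]; simp
    have hlast : y (Fin.last e) = 0 := by
      rw [hy, Matrix.mulVec, dotProduct, ← hx]
      exact Finset.sum_congr rfl fun i _ => by rw [← ha2]
    refine ⟨fun j => y j.castSucc, fun i => ?_, ?_⟩
    · rw [hxy]
      simp [Matrix.mulVec, dotProduct, Fin.sum_univ_castSucc, hlast]
    · rw [hxy]
      simp [Matrix.mulVec, dotProduct, Fin.sum_univ_castSucc, hlast]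

/-- A chosen upper block of a basis of the kernel of `a`. -/
def kerB (a : Fin (e + 1) → ℤ) : Matrix (Fin e) (Fin e) ℤ :=
  open Classical in if h : ∃ B r, IsKernelBasis a B r then h.choose else 1

/-- The last row of the chosen basis of the kernel of `a`. -/
def kerR (a : Fin (e + 1) → ℤ) : Fin e → ℤ :=
  open Classical in if h : ∃ B r, IsKernelBasis a B r then h.choose_spec.choose else 0

lemma isKernelBasis_ker [NeZero e] {a : Fin (e + 1) → ℤ} (ha : Finset.univ.gcd a = 1) :
    IsKernelBasis a (kerB a) (kerR a) := by
  have h := exists_isKernelBasis a ha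
  rw [kerB, kerR, dif_pos h, dif_pos h]
  exact h.choose_spec.choose_spec

lemma IsKernelBasis.minors_eq {a : Fin (e + 1) → ℤ} {B : Matrix (Fin e) (Fin e) ℤ} {r : Fin e → ℤ}
    (h : IsKernelBasis a B r) (ha : a (Fin.last e) ≠ 0) : minors B r = a := by
  ext i
  refine Fin.lastCases ?_ (fun i => ?_) i
  · simp [h.det_eq]
  · have h1 : (fun i : Fin e => a i.castSucc) ᵥ* B = -(a (Fin.last e) • r) := by
      ext j
      have := h.orth j
      simp only [Matrix.vecMul, dotProduct, Pi.neg_apply, Pi.smul_apply, smul_eq_mul]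
      linarith
    have h2 : ((fun i : Fin e => a i.castSucc) ᵥ* B) ᵥ* B.adjugate
        = a (Fin.last e) • fun i : Fin e => a i.castSucc := by
      rw [Matrix.vecMul_vecMul, Matrix.mul_adjugate, h.det_eq, Matrix.vecMul_smul,
        Matrix.vecMul_one]
    rw [h1, Matrix.neg_vecMul, Matrix.smul_vecMul] at h2
    have h3 := congrFun h2 i
    simp only [Pi.neg_apply, Pi.smul_apply, smul_eq_mul] at h3
    rw [minors_castSucc]
    have h4 : a (Fin.last e) * (-(r ᵥ* B.adjugate) i) = a (Fin.last e) * a i.castSucc := by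
      linarith
    exact mul_left_cancel₀ ha h4

lemma IsKernelBasis.exists_mul {a : Fin (e + 1) → ℤ} {B C : Matrix (Fin e) (Fin e) ℤ}
    {r s : Fin e → ℤ} (h : IsKernelBasis a B r) (ha : a (Fin.last e) ≠ 0) {g : ℤ} (hg : g ≠ 0)
    (hC : minors C s = g • a) :
    ∃ H : Matrix (Fin e) (Fin e) ℤ, C = B * H ∧ s = r ᵥ* H ∧ H.det = g := by
  have key : ∀ j, ∃ y, (∀ i : Fin e, C i j = (B *ᵥ y) i) ∧ s j = r ⬝ᵥ y := by
    intro j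
    have h0 := minors_orthogonal C s j
    rw [hC] at h0
    obtain ⟨y, hy1, hy2⟩ := h.span (Fin.snoc (α := fun _ => ℤ) (fun i => C i j) (s j)) (by
      rw [Fin.sum_univ_castSucc]
      simp only [Fin.snoc_castSucc, Fin.snoc_last]
      simp only [Pi.smul_apply, smul_eq_mul, mul_assoc, ← Finset.mul_sum, ← mul_add] at h0
      exact (mul_eq_zero.1 h0).resolve_left hg)
    exact ⟨y, fun i => by simpa using hy1 i, by simpa using hy2⟩
  choose y hy1 hy2 using key
  have hCB : C = B * Matrix.of (fun i j => y j i) := by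
    ext i j; rw [hy1]; simp [Matrix.mul_apply, Matrix.mulVec, dotProduct]
  refine ⟨Matrix.of fun i j => y j i, hCB, ?_, ?_⟩
  · ext j; rw [hy2]; simp [Matrix.vecMul, dotProduct]
  · have h1 := congrFun hC (Fin.last e)
    rw [minors_last, hCB, Matrix.det_mul, h.det_eq, Pi.smul_apply, smul_eq_mul, mul_comm] at h1
    exact mul_right_cancel₀ ha h1

end KernelBasis

section LatticeSums

open ENNReal

variable {e : ℕ}

/-- Primitive integer vectors with positive coordinates. -/
def PosPrim (n : ℕ) : Type := {a : Fin n → ℤ // Finset.univ.gcd a = 1 ∧ ∀ i, 0 < a i}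

/-- Parametrisation of integer matrices whose minors are coprime and positive. -/
lemma tsum_gcd_minors_eq_one [NeZero e]
    (Ψ : Matrix (Fin e) (Fin e) ℤ × (Fin e → ℤ) → ℝ≥0∞)
    (hΨ : ∀ M, Ψ M ≠ 0 → ∀ i, 0 < minors M.1 M.2 i) :
    ∑' M : {M : Matrix (Fin e) (Fin e) ℤ × (Fin e → ℤ) // Finset.univ.gcd (minors M.1 M.2) = 1},
      Ψ M.1
    = ∑' (a : PosPrim (e + 1)) (γ : Matrix.SpecialLinearGroup (Fin e) ℤ),
      Ψ (kerB a.1 * γ.1, kerR a.1 ᵥ* γ.1) := by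
  have hmin : ∀ (a : PosPrim (e + 1)) (γ : Matrix.SpecialLinearGroup (Fin e) ℤ),
      minors (kerB a.1 * γ.1) (kerR a.1 ᵥ* γ.1) = a.1 := by
    intro a γ
    rw [minors_mul, γ.2, one_smul, (isKernelBasis_ker a.2.1).minors_eq (a.2.2 _).ne']
  rw [← ENNReal.tsum_prod]
  let f : PosPrim (e + 1) × Matrix.SpecialLinearGroup (Fin e) ℤ →
      {M : Matrix (Fin e) (Fin e) ℤ × (Fin e → ℤ) // Finset.univ.gcd (minors M.1 M.2) = 1} :=
    fun p => ⟨(kerB p.1.1 * p.2.1, kerR p.1.1 ᵥ* p.2.1), by rw [hmin]; exact p.1.2.1⟩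
  have hf : Function.Injective f := by
    rintro ⟨a, γ⟩ ⟨b, δ⟩ hab
    have h1 := congrArg (fun M => M.1) hab
    simp only [f, Prod.mk.injEq] at h1
    have hab' : a = b := by
      apply Subtype.ext
      rw [← hmin a γ, ← hmin b δ, h1.1, h1.2]
    subst hab'
    have h2 : γ = δ := by
      apply Subtype.ext
      have h3 := congrArg (fun X => (kerB a.1).adjugate * X) h1.1
      simp only [← Matrix.mul_assoc, Matrix.adjugate_mul,
        (isKernelBasis_ker a.2.1).det_eq, Matrix.smul_mul, Matrix.one_mul] at h3
      exact smul_right_injective _ (a.2.2 (Fin.last e)).ne' h3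
    rw [h2]
  rw [← hf.tsum_eq]
  intro M hM
  have hpos := hΨ M.1 hM
  set a : PosPrim (e + 1) := ⟨minors M.1.1 M.1.2, M.2, hpos⟩ with ha
  obtain ⟨H, h1, h2, h3⟩ := (isKernelBasis_ker a.2.1).exists_mul (a.2.2 _).ne'
    (g := 1) one_ne_zero (C := M.1.1) (s := M.1.2) (by rw [one_smul])
  exact ⟨(a, ⟨H, h3⟩), Subtype.ext (Prod.ext h1.symm h2.symm)⟩

/-- Bound for the contribution of integer matrices whose minors have a large common factor. -/
lemma tsum_gcd_minors_gt_le [NeZero e] (P : HermiteFamily e) (m : ℕ)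
    (Ψ : Matrix (Fin e) (Fin e) ℤ × (Fin e → ℤ) → ℝ≥0∞)
    (hΨ : ∀ M, Ψ M ≠ 0 → ∀ i, 0 < minors M.1 M.2 i) :
    ∑' M : {M : Matrix (Fin e) (Fin e) ℤ × (Fin e → ℤ) //
        (m : ℤ) < Finset.univ.gcd (minors M.1 M.2)}, Ψ M.1
    ≤ ∑' (a : PosPrim (e + 1)) (i : {i : P.Idx // (m : ℤ) < (P.mat i).det})
        (γ : Matrix.SpecialLinearGroup (Fin e) ℤ),
      Ψ (kerB a.1 * (P.mat i.1 * γ.1), kerR a.1 ᵥ* (P.mat i.1 * γ.1)) := by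
  simp only [← ENNReal.tsum_prod]
  rw [← tsum_subtype_eq_of_support_subset (f := fun M : {M : Matrix (Fin e) (Fin e) ℤ ×
    (Fin e → ℤ) // (m : ℤ) < Finset.univ.gcd (minors M.1 M.2)} => Ψ M.1)
    (s := {M | Ψ M.1 ≠ 0}) (fun M hM => hM)]
  have key : ∀ M : {M : {M : Matrix (Fin e) (Fin e) ℤ × (Fin e → ℤ) //
      (m : ℤ) < Finset.univ.gcd (minors M.1 M.2)} // Ψ M.1 ≠ 0},
      ∃ x : PosPrim (e + 1) × {i : P.Idx // (m : ℤ) < (P.mat i).det} ×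
        Matrix.SpecialLinearGroup (Fin e) ℤ,
        (kerB x.1.1 * (P.mat x.2.1.1 * x.2.2.1), kerR x.1.1 ᵥ* (P.mat x.2.1.1 * x.2.2.1))
          = M.1.1 := by
    rintro ⟨⟨M, hm⟩, hM⟩
    have hpos := hΨ M hM
    dsimp only at hm hM hpos ⊢
    obtain ⟨a, ha, hgcd⟩ := Finset.extract_gcd (minors M.1 M.2) (Finset.univ_nonempty)
    set g := Finset.univ.gcd (minors M.1 M.2) with hg
    have hg0 : 0 < g := lt_of_le_of_lt (by positivity) hm
    have ha' : minors M.1 M.2 = g • a := by ext i; simp [ha i (Finset.mem_univ i)]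
    have hapos : ∀ i, 0 < a i := by
      intro i
      have := hpos i
      rw [ha i (Finset.mem_univ i)] at this
      exact pos_of_mul_pos_right this hg0.le
    obtain ⟨H, h1, h2, h3⟩ := (isKernelBasis_ker hgcd).exists_mul (hapos _).ne' hg0.ne' ha'
    obtain ⟨i, γ, hi⟩ := P.factor H (by rw [h3]; exact hg0)
    have hdet : (P.mat i).det = g := by
      rw [← h3, hi, Matrix.det_mul, γ.2, mul_one]
    exact ⟨(⟨a, hgcd, hapos⟩, ⟨i, by rw [hdet]; exact hm⟩, γ),
      Prod.ext (by rw [h1, hi]) (by rw [h2, hi])⟩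
  choose F hF using key
  have hinj : Function.Injective F := by
    intro M N h
    apply Subtype.ext; apply Subtype.ext
    rw [← hF M, ← hF N, h]
  refine le_trans (le_of_eq ?_) (ENNReal.tsum_comp_le_tsum_of_injective hinj _)
  refine tsum_congr fun M => ?_
  rw [hF M]

end LatticeSums

section SLTopology

open CompactlySupported Filter Topology

variable {e : ℕ}

instance (n : ℕ) : IsTopologicalGroup (SLR n) := Matrix.SpecialLinearGroup.topologicalGroup

lemma isClosedEmbedding_coe_SLR (n : ℕ) :
    IsClosedEmbedding (fun g : SLR n => (g : Matrix (Fin n) (Fin n) ℝ)) :=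
  Matrix.SpecialLinearGroup.isClosedEmbedding_val

instance (n : ℕ) : T2Space (SLR n) := (isClosedEmbedding_coe_SLR n).isEmbedding.t2Space

instance (n : ℕ) : LocallyCompactSpace (SLR n) :=
  have : LocallyCompactSpace (Matrix (Fin n) (Fin n) ℝ) :=
    inferInstanceAs (LocallyCompactSpace (Fin n → Fin n → ℝ))
  (isClosedEmbedding_coe_SLR n).locallyCompactSpace

instance (n : ℕ) : SecondCountableTopology (SLR n) :=
  have : SecondCountableTopology (Matrix (Fin n) (Fin n) ℝ) :=
    inferInstanceAs (SecondCountableTopology (Fin n → Fin n → ℝ))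
  (isClosedEmbedding_coe_SLR n).isEmbedding.secondCountableTopology

instance (n : ℕ) : MeasurableSpace (SLR n) := borel _
instance (n : ℕ) : BorelSpace (SLR n) := ⟨rfl⟩
instance (n : ℕ) : BorelSpace (XQuot n) := ⟨rfl⟩

lemma continuous_coe_SLR (n : ℕ) : Continuous (fun g : SLR n => (g : Matrix (Fin n) (Fin n) ℝ)) :=
  (isClosedEmbedding_coe_SLR n).continuous

lemma continuous_SLR_iff {X : Type*} [TopologicalSpace X] {f : X → SLR e} :
    Continuous f ↔ Continuous fun x => (f x : Matrix (Fin e) (Fin e) ℝ) :=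
  (isClosedEmbedding_coe_SLR e).isEmbedding.isInducing.continuous_iff

/-- A positive left invariant linear functional on `C_c(SL_n(ℝ))` is a multiple of the Haar
integral. -/
lemma exists_eq_mul_integral_haar (J : C_c(SLR e, ℝ) → ℝ)
    (hadd : ∀ φ ψ, J (φ + ψ) = J φ + J ψ) (hsmul : ∀ (c : ℝ) φ, J (c • φ) = c * J φ)
    (hnonneg : ∀ φ, (∀ g, 0 ≤ φ g) → 0 ≤ J φ)
    (hinv : ∀ (h : SLR e) (φ ψ : C_c(SLR e, ℝ)), (∀ g, ψ g = φ (h * g)) → J ψ = J φ) :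
    ∃ c : ℝ, 0 ≤ c ∧ ∀ φ : C_c(SLR e, ℝ), J φ = c * ∫ g, φ g ∂(Measure.haar : Measure (SLR e)) := by
  let L : C_c(SLR e, ℝ) →ₗ[ℝ] ℝ :=
    { toFun := J, map_add' := hadd, map_smul' := fun c φ => by simp [hsmul] }
  let Λ : C_c(SLR e, ℝ) →ₚ[ℝ] ℝ := PositiveLinearMap.mk₀ L fun φ hφ => hnonneg φ hφ
  let μ := RealRMK.rieszMeasure Λ
  have hμ : ∀ φ : C_c(SLR e, ℝ), ∫ g, φ g ∂μ = J φ := fun φ => RealRMK.integral_rieszMeasure Λ φ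
  have hreg : μ.Regular := RealRMK.regular_rieszMeasure Λ
  have hmul : μ.IsMulLeftInvariant := by
    constructor
    intro h
    have hreg' : (Measure.map (fun g => h * g) μ).Regular :=
      Measure.Regular.map (Homeomorph.mulLeft h)
    refine Measure.ext_of_integral_eq_on_compactlySupported fun φ => ?_
    rw [integral_map (by fun_prop) (by
      exact (map_continuous φ).aestronglyMeasurable), hμ]
    let ψ : C_c(SLR e, ℝ) := ⟨⟨fun g => φ (h * g), by fun_prop⟩,
      φ.hasCompactSupport.comp_homeomorph (Homeomorph.mulLeft h)⟩
    rw [← hinv h φ ψ fun _ => rfl, ← hμ]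
    rfl
  refine ⟨(Measure.haarScalarFactor μ Measure.haar : ℝ), by positivity, fun φ => ?_⟩
  rw [← hμ, Measure.integral_isMulLeftInvariant_eq_smul_of_hasCompactSupport μ Measure.haar
    (map_continuous φ) φ.hasCompactSupport, integral_smul_nnreal_measure]
  rfl

end SLTopology

section Poincare

open CompactlySupported Filter Topology

variable {e : ℕ}

/-- The inclusion `SL_n(ℤ) → SL_n(ℝ)`. -/
abbrev castSL (γ : Matrix.SpecialLinearGroup (Fin e) ℤ) : SLR e :=
  Matrix.SpecialLinearGroup.map (n := Fin e) (Int.castRingHom ℝ) γ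

lemma castSL_apply (γ : Matrix.SpecialLinearGroup (Fin e) ℤ) (i j : Fin e) :
    (castSL γ).1 i j = (γ.1 i j : ℝ) := rfl

/-- Only finitely many integer matrices lie in a compact set. -/
lemma finite_castSL_mem {K : Set (SLR e)} (hK : IsCompact K) :
    {γ : Matrix.SpecialLinearGroup (Fin e) ℤ | castSL γ ∈ K}.Finite := by
  have hb : ∀ i j, ∃ C : ℕ, ∀ g ∈ K, |(g : SLR e).1 i j| ≤ C := by
    intro i j
    obtain ⟨C, hC⟩ := hK.exists_bound_of_continuousOn
      (f := fun g : SLR e => g.1 i j)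
      ((continuous_coe_SLR e).matrix_elem i j).continuousOn
    obtain ⟨N, hN⟩ := exists_nat_ge C
    exact ⟨N, fun g hg => (hC g hg).trans hN⟩
  choose C hC using hb
  have hfin : (Set.univ.pi fun i => Set.univ.pi fun j =>
      Set.Icc (-(C i j : ℤ)) (C i j)).Finite :=
    Set.Finite.pi fun i => Set.Finite.pi fun j => Set.finite_Icc _ _
  refine Set.Finite.of_finite_image (f := fun γ i j => γ.1 i j) (hfin.subset ?_) ?_
  · rintro _ ⟨γ, hγ, rfl⟩
    simp only [Set.mem_pi, Set.mem_univ, true_imp_iff, Set.mem_Icc]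
    intro i j
    have := abs_le.1 (hC i j _ hγ)
    rw [castSL_apply] at this
    exact ⟨by exact_mod_cast this.1, by exact_mod_cast this.2⟩
  · intro γ _ δ _ h
    ext i j
    exact congrFun (congrFun h i) j

/-- The sum of `φ` over an orbit of `SL_n(ℤ)` acting on the right. -/
def orbitSum (φ : C_c(SLR e, ℝ)) (g : SLR e) : ℝ :=
  ∑ᶠ γ : Matrix.SpecialLinearGroup (Fin e) ℤ, φ (g * castSL γ)

lemma locallyFinite_support_orbit (φ : C_c(SLR e, ℝ)) :
    LocallyFinite fun γ : Matrix.SpecialLinearGroup (Fin e) ℤ =>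
      Function.support fun g : SLR e => φ (g * castSL γ) := by
  intro g
  obtain ⟨K, hK, hg⟩ := exists_compact_mem_nhds g
  refine ⟨K, hg, (finite_castSL_mem ((hK.inv).mul φ.hasCompactSupport)).subset ?_⟩
  rintro γ ⟨h, h1, h2⟩
  exact ⟨h⁻¹, Set.inv_mem_inv.2 h2, h * castSL γ, subset_tsupport _ h1, by simp⟩

lemma finite_support_orbit (φ : C_c(SLR e, ℝ)) (g : SLR e) :
    (Function.support fun γ : Matrix.SpecialLinearGroup (Fin e) ℤ => φ (g * castSL γ)).Finite :=
  (locallyFinite_support_orbit φ).point_finite g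

lemma continuous_orbitSum (φ : C_c(SLR e, ℝ)) : Continuous (orbitSum φ) :=
  continuous_finsum (fun γ => by fun_prop) (locallyFinite_support_orbit φ)

lemma summable_orbit (φ : C_c(SLR e, ℝ)) (g : SLR e) :
    Summable fun γ : Matrix.SpecialLinearGroup (Fin e) ℤ => φ (g * castSL γ) :=
  summable_of_hasFiniteSupport (finite_support_orbit φ g)

lemma orbitSum_eq_tsum (φ : C_c(SLR e, ℝ)) (g : SLR e) :
    orbitSum φ g = ∑' γ : Matrix.SpecialLinearGroup (Fin e) ℤ, φ (g * castSL γ) :=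
  (tsum_eq_finsum (finite_support_orbit φ g)).symm

lemma orbitSum_mul_castSL (φ : C_c(SLR e, ℝ)) (g : SLR e)
    (γ : Matrix.SpecialLinearGroup (Fin e) ℤ) : orbitSum φ (g * castSL γ) = orbitSum φ g := by
  rw [orbitSum_eq_tsum, orbitSum_eq_tsum,
    ← (Equiv.mulLeft γ).tsum_eq fun δ => φ (g * castSL δ)]
  simp [mul_assoc]

lemma orbitSum_nonneg {φ : C_c(SLR e, ℝ)} (hφ : ∀ g, 0 ≤ φ g) (g : SLR e) :
    0 ≤ orbitSum φ g := finsum_nonneg fun _ => hφ _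

lemma orbitSum_add (φ ψ : C_c(SLR e, ℝ)) (g : SLR e) :
    orbitSum (φ + ψ) g = orbitSum φ g + orbitSum ψ g := by
  simp only [orbitSum_eq_tsum]
  exact (summable_orbit φ g).tsum_add (summable_orbit ψ g)

lemma orbitSum_smul (c : ℝ) (φ : C_c(SLR e, ℝ)) (g : SLR e) :
    orbitSum (c • φ) g = c * orbitSum φ g := by
  simp only [orbitSum_eq_tsum]
  exact tsum_mul_left

/-- The function on `SL_n(ℝ)/SL_n(ℤ)` induced by `orbitSum φ`. -/
def quotSum (φ : C_c(SLR e, ℝ)) : XQuot e → ℝ :=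
  Quotient.lift (orbitSum φ) fun a b hab => by
    obtain ⟨γ, hγ⟩ := QuotientGroup.leftRel_apply.1 hab
    have hb : b = a * castSL γ := by rw [castSL, hγ]; simp
    rw [hb, orbitSum_mul_castSL]

@[simp] lemma quotSum_mk (φ : C_c(SLR e, ℝ)) (g : SLR e) :
    quotSum φ (QuotientGroup.mk g) = orbitSum φ g := rfl

lemma continuous_quotSum (φ : C_c(SLR e, ℝ)) : Continuous (quotSum φ) :=
  (continuous_orbitSum φ).quotient_lift _

lemma quotSum_bounded (φ : C_c(SLR e, ℝ)) : ∃ C : ℝ, 0 ≤ C ∧ ∀ x, |quotSum φ x| ≤ C := by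
  obtain ⟨C, hC⟩ := φ.hasCompactSupport.exists_bound_of_continuousOn
    (continuous_orbitSum φ).continuousOn
  refine ⟨max C 0, le_max_right _ _, fun x => ?_⟩
  obtain ⟨g, rfl⟩ := QuotientGroup.mk_surjective x
  rw [quotSum_mk]
  by_cases h : ∃ γ : Matrix.SpecialLinearGroup (Fin e) ℤ, φ (g * castSL γ) ≠ 0
  · obtain ⟨γ, hγ⟩ := h
    rw [← orbitSum_mul_castSL φ g γ]
    exact (hC _ (subset_tsupport _ hγ)).trans (le_max_left _ _)
  · push Not at h
    have : orbitSum φ g = 0 := by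
      rw [orbitSum]; simp [h]
    rw [this]; simp

lemma integrable_quotSum (φ : C_c(SLR e, ℝ)) (μ : Measure (XQuot e)) [IsFiniteMeasure μ] :
    Integrable (quotSum φ) μ := by
  obtain ⟨C, _, hC⟩ := quotSum_bounded φ
  exact Integrable.of_bound (continuous_quotSum φ).aestronglyMeasurable C
    (Filter.Eventually.of_forall hC)

lemma quotSum_smul_apply (h : SLR e) {φ ψ : C_c(SLR e, ℝ)} (hψ : ∀ g, ψ g = φ (h * g))
    (x : XQuot e) : quotSum ψ x = quotSum φ (h • x) := by
  obtain ⟨g, rfl⟩ := QuotientGroup.mk_surjective x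
  change orbitSum ψ g = orbitSum φ (h * g)
  simp [orbitSum, hψ, mul_assoc]

/-- Integrating orbit sums against an invariant probability measure gives a multiple of the Haar
integral. -/
lemma exists_integral_quotSum_eq (μ : Measure (XQuot e)) [IsProbabilityMeasure μ]
    (hinv : ∀ g : SLR e, Measure.map (fun x => g • x) μ = μ) :
    ∃ c : ℝ, 0 ≤ c ∧ ∀ φ : C_c(SLR e, ℝ),
      ∫ x, quotSum φ x ∂μ = c * ∫ g, φ g ∂(Measure.haar : Measure (SLR e)) := by
  refine exists_eq_mul_integral_haar (fun φ => ∫ x, quotSum φ x ∂μ) ?_ ?_ ?_ ?_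
  · intro φ ψ
    rw [← integral_add (integrable_quotSum φ μ) (integrable_quotSum ψ μ)]
    refine integral_congr_ae (Filter.Eventually.of_forall fun x => ?_)
    obtain ⟨g, rfl⟩ := QuotientGroup.mk_surjective x
    exact orbitSum_add φ ψ g
  · intro c φ
    rw [← integral_const_mul]
    refine integral_congr_ae (Filter.Eventually.of_forall fun x => ?_)
    obtain ⟨g, rfl⟩ := QuotientGroup.mk_surjective x
    exact orbitSum_smul c φ g
  · intro φ hφ
    refine integral_nonneg fun x => ?_
    obtain ⟨g, rfl⟩ := QuotientGroup.mk_surjective x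
    exact orbitSum_nonneg hφ g
  · intro h φ ψ hψ
    conv_rhs => rw [← hinv h]
    rw [integral_map (by
      exact (continuous_const_smul h).aemeasurable) (continuous_quotSum φ).aestronglyMeasurable]
    simp only [quotSum_smul_apply h hψ]

end Poincare

section Cutoff

open CompactlySupported Filter Topology

variable {e : ℕ}

/-- The product of a continuous function and a compactly supported continuous function. -/
def mulCc (θ : SLR e → ℝ) (hθ : Continuous θ) (φ : C_c(SLR e, ℝ)) : C_c(SLR e, ℝ) :=
  ⟨⟨fun g => θ g * φ g, hθ.mul (map_continuous φ)⟩, φ.hasCompactSupport.mul_left⟩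

@[simp] lemma mulCc_apply (θ : SLR e → ℝ) (hθ : Continuous θ) (φ : C_c(SLR e, ℝ)) (g : SLR e) :
    mulCc θ hθ φ g = θ g * φ g := rfl

lemma orbitSum_mulCc (θ : SLR e → ℝ) (hθ : Continuous θ)
    (hinv : ∀ g (γ : Matrix.SpecialLinearGroup (Fin e) ℤ), θ (g * castSL γ) = θ g)
    (φ : C_c(SLR e, ℝ)) (g : SLR e) : orbitSum (mulCc θ hθ φ) g = θ g * orbitSum φ g := by
  simp only [orbitSum_eq_tsum, mulCc_apply, hinv, tsum_mul_left]

/-- The compact set of matrices with entries bounded by `n`. -/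
def boundedSL (e n : ℕ) : Set (SLR e) := {g | ∀ i j, |g.1 i j| ≤ n}

lemma isCompact_boundedSL (n : ℕ) : IsCompact (boundedSL e n) := by
  have h : IsCompact (Set.univ.pi fun _ => Set.univ.pi fun _ => Set.Icc (-(n : ℝ)) n :
      Set (Fin e → Fin e → ℝ)) := isCompact_univ_pi fun _ => isCompact_univ_pi fun _ => isCompact_Icc
  have := (isClosedEmbedding_coe_SLR e).isCompact_preimage (K := (Set.univ.pi fun _ =>
    Set.univ.pi fun _ => Set.Icc (-(n : ℝ)) n : Set (Fin e → Fin e → ℝ))) h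
  convert this using 1
  ext g
  exact ⟨fun h i _ j _ => abs_le.1 (h i j), fun h i j => abs_le.2 (h i trivial j trivial)⟩

lemma exists_cutoff (n : ℕ) : ∃ φ : C_c(SLR e, ℝ), (∀ g, 0 ≤ φ g) ∧ (∀ g, orbitSum φ g ≤ 1) ∧
    ∀ g ∈ boundedSL e n, 0 < φ g ∧
      ∀ γ : Matrix.SpecialLinearGroup (Fin e) ℤ, orbitSum φ (g * castSL γ) = 1 := by
  obtain ⟨f, hf1, -, hfc, hf⟩ := exists_continuous_one_zero_of_isCompact
    (isCompact_boundedSL (e := e) n) isClosed_empty (Set.disjoint_empty _)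
  let ψ : C_c(SLR e, ℝ) := ⟨f, hfc⟩
  have hψ0 : ∀ g, 0 ≤ ψ g := fun g => (hf g).1
  have hc : Continuous fun g => (max (orbitSum ψ g) 1)⁻¹ :=
    ((continuous_orbitSum ψ).max continuous_const).inv₀ fun g =>
      (lt_of_lt_of_le one_pos (le_max_right _ _)).ne'
  have hpos : ∀ g, 0 < max (orbitSum ψ g) 1 := fun g => lt_of_lt_of_le one_pos (le_max_right _ _)
  have hsum := orbitSum_mulCc _ hc (fun g γ => by rw [orbitSum_mul_castSL]) ψ
  refine ⟨mulCc _ hc ψ, fun g => mul_nonneg (inv_nonneg.2 (hpos g).le) (hψ0 g), fun g => ?_,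
    fun g hg => ⟨mul_pos (inv_pos.2 (hpos g)) ?_, fun γ => ?_⟩⟩
  · rw [hsum, inv_mul_le_iff₀ (hpos g), mul_one]
    exact le_max_left _ _
  · change 0 < f g
    rw [hf1 hg]; simp
  · rw [orbitSum_mul_castSL, hsum]
    have h1 : 1 ≤ orbitSum ψ g := by
      rw [orbitSum_eq_tsum]
      refine le_trans (le_of_eq ?_) ((summable_orbit ψ g).le_tsum 1 fun γ _ => hψ0 _)
      change 1 = f (g * castSL 1)
      rw [castSL, map_one, mul_one, hf1 hg]; rfl
    rw [max_eq_left h1, inv_mul_cancel₀ (by linarith)]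

/-- Compactly supported functions on `SL_n(ℝ)` whose orbit sums approximate `1`. -/
def cutoff (e n : ℕ) : C_c(SLR e, ℝ) := (exists_cutoff n).choose

lemma cutoff_nonneg (n : ℕ) (g : SLR e) : 0 ≤ cutoff e n g := (exists_cutoff n).choose_spec.1 g

lemma orbitSum_cutoff_le (n : ℕ) (g : SLR e) : orbitSum (cutoff e n) g ≤ 1 :=
  (exists_cutoff n).choose_spec.2.1 g

lemma cutoff_pos {n : ℕ} {g : SLR e} (hg : g ∈ boundedSL e n) : 0 < cutoff e n g :=
  ((exists_cutoff n).choose_spec.2.2 g hg).1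

lemma orbitSum_cutoff_eq_one {n : ℕ} {g : SLR e} (hg : g ∈ boundedSL e n)
    (γ : Matrix.SpecialLinearGroup (Fin e) ℤ) : orbitSum (cutoff e n) (g * castSL γ) = 1 :=
  ((exists_cutoff n).choose_spec.2.2 g hg).2 γ

lemma boundedSL_mono {m n : ℕ} (h : m ≤ n) : boundedSL e m ⊆ boundedSL e n :=
  fun _ hg i j => (hg i j).trans (by exact_mod_cast h)

lemma exists_mem_boundedSL (g : SLR e) : ∃ n, g ∈ boundedSL e n := by
  have h : ∀ i j, ∃ n : ℕ, |g.1 i j| ≤ n := fun i j => exists_nat_ge _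
  choose N hN using h
  refine ⟨∑ i, ∑ j, N i j, fun i j => (hN i j).trans ?_⟩
  have h1 : N i j ≤ ∑ j, N i j :=
    Finset.single_le_sum (f := fun j => N i j) (fun _ _ => Nat.zero_le _) (Finset.mem_univ j)
  have h2 : ∑ j, N i j ≤ ∑ i, ∑ j, N i j :=
    Finset.single_le_sum (f := fun i => ∑ j, N i j) (fun _ _ => Nat.zero_le _) (Finset.mem_univ i)
  exact_mod_cast h1.trans h2

lemma tendsto_quotSum_cutoff (x : XQuot e) :
    Tendsto (fun n => quotSum (cutoff e n) x) atTop (𝓝 1) := by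
  obtain ⟨g, rfl⟩ := QuotientGroup.mk_surjective x
  obtain ⟨N, hN⟩ := exists_mem_boundedSL g
  refine tendsto_const_nhds.congr' ?_
  filter_upwards [eventually_ge_atTop N] with n hn
  have := orbitSum_cutoff_eq_one (boundedSL_mono hn hN) 1
  rw [castSL, map_one, mul_one] at this
  simp [this]

lemma quotSum_cutoff_nonneg (n : ℕ) (x : XQuot e) : 0 ≤ quotSum (cutoff e n) x := by
  obtain ⟨g, rfl⟩ := QuotientGroup.mk_surjective x
  exact orbitSum_nonneg (cutoff_nonneg n) g

lemma quotSum_cutoff_le (n : ℕ) (x : XQuot e) : quotSum (cutoff e n) x ≤ 1 := by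
  obtain ⟨g, rfl⟩ := QuotientGroup.mk_surjective x
  exact orbitSum_cutoff_le n g

lemma tendsto_integral_quotSum_cutoff (μ : Measure (XQuot e)) [IsProbabilityMeasure μ] :
    Tendsto (fun n => ∫ x, quotSum (cutoff e n) x ∂μ) atTop (𝓝 1) := by
  have := tendsto_integral_of_dominated_convergence (μ := μ) (fun _ => (1 : ℝ))
    (F := fun n x => quotSum (cutoff e n) x) (f := fun _ => 1)
    (fun n => (continuous_quotSum _).aestronglyMeasurable) (integrable_const _)
    (fun n => Eventually.of_forall fun x => by
      rw [Real.norm_of_nonneg (quotSum_cutoff_nonneg n x)]; exact quotSum_cutoff_le n x)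
    (Eventually.of_forall fun x => tendsto_quotSum_cutoff x)
  simpa using this

/-- The Haar integral is a multiple of the integral of orbit sums. -/
lemma exists_integral_haar_eq (μ : Measure (XQuot e)) [IsProbabilityMeasure μ]
    (hinv : ∀ g : SLR e, Measure.map (fun x => g • x) μ = μ) :
    ∃ c : ℝ, 0 < c ∧ ∀ φ : C_c(SLR e, ℝ),
      ∫ g, φ g ∂(Measure.haar : Measure (SLR e)) = c * ∫ x, quotSum φ x ∂μ := by
  obtain ⟨c, hc, h⟩ := exists_integral_quotSum_eq μ hinv
  have hc0 : c ≠ 0 := by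
    rintro rfl
    have := tendsto_integral_quotSum_cutoff μ
    simp only [h, zero_mul] at this
    exact zero_ne_one (tendsto_nhds_unique tendsto_const_nhds this)
  refine ⟨c⁻¹, inv_pos.2 (lt_of_le_of_ne hc hc0.symm), fun φ => ?_⟩
  rw [h, inv_mul_cancel_left₀ hc0]

end Cutoff

section Normalization

variable {e : ℕ} [NeZero e]

lemma det_rpow_smul {A : Matrix (Fin e) (Fin e) ℝ} (h : 0 < A.det) :
    (A.det ^ (-(1 / (e : ℝ))) • A).det = 1 := by
  have he : (e : ℝ) ≠ 0 := by exact_mod_cast NeZero.ne e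
  rw [Matrix.det_smul, Fintype.card_fin, ← Real.rpow_natCast, ← Real.rpow_mul h.le]
  rw [show -(1 / (e : ℝ)) * e = -1 by field_simp, Real.rpow_neg_one, inv_mul_cancel₀ h.ne']

/-- The normalization to determinant one of a matrix with positive determinant. -/
def toSL (A : Matrix (Fin e) (Fin e) ℝ) : SLR e :=
  open Classical in
    if h : 0 < A.det then (⟨A.det ^ (-(1 / (e : ℝ))) • A, det_rpow_smul h⟩ : SLR e) else 1

lemma coe_toSL {A : Matrix (Fin e) (Fin e) ℝ} (h : 0 < A.det) :
    (toSL A : Matrix (Fin e) (Fin e) ℝ) = A.det ^ (-(1 / (e : ℝ))) • A := by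
  exact congrArg Subtype.val (dif_pos h)

lemma toSL_mul {A B : Matrix (Fin e) (Fin e) ℝ} (hA : 0 < A.det) (hB : 0 < B.det) :
    toSL (A * B) = toSL A * toSL B := by
  apply Subtype.ext
  rw [coe_toSL (by rw [Matrix.det_mul]; positivity), Matrix.SpecialLinearGroup.coe_mul,
    coe_toSL hA, coe_toSL hB, Matrix.det_mul, Real.mul_rpow hA.le hB.le, Matrix.smul_mul,
    Matrix.mul_smul, smul_smul]

lemma toSL_coe (g : SLR e) : toSL (g : Matrix (Fin e) (Fin e) ℝ) = g := by
  apply Subtype.ext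
  rw [coe_toSL (by rw [g.2]; exact one_pos), g.2]; simp

lemma toSL_smul {c : ℝ} (hc : 0 < c) {A : Matrix (Fin e) (Fin e) ℝ} (hA : 0 < A.det) :
    toSL (c • A) = toSL A := by
  have he : (e : ℝ) ≠ 0 := by exact_mod_cast NeZero.ne e
  apply Subtype.ext
  rw [coe_toSL (by rw [Matrix.det_smul]; positivity), coe_toSL hA, Matrix.det_smul,
    Fintype.card_fin, Real.mul_rpow (by positivity) hA.le, ← Real.rpow_natCast,
    ← Real.rpow_mul hc.le, show (e : ℝ) * -(1 / (e : ℝ)) = -1 by field_simp, Real.rpow_neg_one,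
    smul_smul]
  congr 1
  field_simp

lemma continuousOn_toSL : ContinuousOn (toSL (e := e)) {A | 0 < A.det} := by
  rw [continuousOn_iff_continuous_domRestrict, continuous_SLR_iff]
  have : (fun x : {A : Matrix (Fin e) (Fin e) ℝ | 0 < A.det} =>
      (Set.domRestrict {A : Matrix (Fin e) (Fin e) ℝ | 0 < A.det} toSL x : Matrix (Fin e) (Fin e) ℝ))
      = fun x => x.1.det ^ (-(1 / (e : ℝ))) • x.1 := by
    ext1 x; exact coe_toSL x.2
  refine Eq.mpr (congrArg _ this) ?_
  have hdet : Continuous fun x : {A : Matrix (Fin e) (Fin e) ℝ | 0 < A.det} => x.1.det :=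
    Continuous.matrix_det continuous_subtype_val
  exact (hdet.rpow_const fun x => Or.inl (ne_of_gt x.2)).smul continuous_subtype_val

end Normalization

section TestFunctions

open CompactlySupported

variable {e : ℕ}

/-- Entrywise cast of an integer matrix to a real matrix. -/
abbrev castMat (B : Matrix (Fin e) (Fin e) ℤ) : Matrix (Fin e) (Fin e) ℝ :=
  B.map (Int.castRingHom ℝ)

lemma castMat_mul (B C : Matrix (Fin e) (Fin e) ℤ) :
    castMat (B * C) = castMat B * castMat C := Matrix.map_mul

lemma det_castMat (B : Matrix (Fin e) (Fin e) ℤ) : (castMat B).det = (B.det : ℝ) :=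
  ((Int.castRingHom ℝ).map_det B).symm

lemma det_castMat_SL (γ : Matrix.SpecialLinearGroup (Fin e) ℤ) : 0 < (castMat γ.1).det := by
  rw [det_castMat, γ.2]; norm_num

variable [NeZero e]

/-- The normalized lattice basis attached to an `(e + 1) × e` matrix. -/
def shape (B : Matrix (Fin e) (Fin e) ℝ) (r : Fin e → ℝ) : SLR e :=
  toSL (Matrix.diagonal (fun i : Fin e => minors B r i.castSucc) * B)

/-- The test function on `(e + 1) × e` matrices built from a function on `SL_e(ℝ)` and a
function of the vector of minors. -/
def testFn (φ : SLR e → ℝ) (w : (Fin (e + 1) → ℝ) → ℝ) (B : Matrix (Fin e) (Fin e) ℝ)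
    (r : Fin e → ℝ) : ℝ :=
  w (minors B r) * φ (shape B r)

/-- The normalized basis of the lattice attached to the integer vector `a`. -/
def latticePoint (a : Fin (e + 1) → ℤ) : SLR e :=
  toSL (Matrix.diagonal (fun i : Fin e => (a i.castSucc : ℝ)) * castMat (kerB a))

lemma testFn_kerB_mul (φ : SLR e → ℝ) (w : (Fin (e + 1) → ℝ) → ℝ) {T : ℝ} (hT : 0 < T)
    (a : PosPrim (e + 1)) (H : Matrix (Fin e) (Fin e) ℤ) (hH : 0 < H.det) :
    testFn φ w (T ^ (-(1 / (e : ℝ))) • castMat (kerB a.1 * H))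
      (T ^ (-(1 / (e : ℝ))) • (fun j => ((kerR a.1 ᵥ* H) j : ℝ)))
    = w (fun i => (H.det : ℝ) * a.1 i / T) * φ (latticePoint a.1 * toSL (castMat H)) := by
  have he : (e : ℝ) ≠ 0 := by exact_mod_cast NeZero.ne e
  set c : ℝ := T ^ (-(1 / (e : ℝ))) with hc
  have hcpos : 0 < c := by positivity
  have hce : c ^ e = T⁻¹ := by
    rw [hc, ← Real.rpow_natCast, ← Real.rpow_mul hT.le,
      show -(1 / (e : ℝ)) * e = -1 by field_simp, Real.rpow_neg_one]
  have hker := isKernelBasis_ker a.2.1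
  have hHR : (0 : ℝ) < H.det := by exact_mod_cast hH
  have ha : ∀ i, (0 : ℝ) < a.1 i := fun i => by exact_mod_cast a.2.2 i
  have hmin : minors (c • castMat (kerB a.1 * H)) (c • (fun j => ((kerR a.1 ᵥ* H) j : ℝ)))
      = fun i => (H.det : ℝ) * a.1 i / T := by
    rw [minors_smul]
    have h1 := minors_map (Int.castRingHom ℝ) (kerB a.1 * H) (kerR a.1 ᵥ* H)
    have h2 : (fun j => ((kerR a.1 ᵥ* H) j : ℝ)) = Int.castRingHom ℝ ∘ (kerR a.1 ᵥ* H) := rfl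
    rw [h2, h1, minors_mul, hker.minors_eq (a.2.2 _).ne', hce]
    ext i
    simp
    ring
  have hdiag : 0 < (Matrix.diagonal (fun i : Fin e => (a.1 i.castSucc : ℝ)) *
      castMat (kerB a.1)).det := by
    rw [Matrix.det_mul, Matrix.det_diagonal, det_castMat, hker.det_eq]
    exact mul_pos (Finset.prod_pos fun i _ => ha _) (ha _)
  have hHdet : 0 < (castMat H).det := by rw [det_castMat]; exact hHR
  rw [testFn, shape, hmin, castMat_mul]
  congr 2
  rw [latticePoint, ← toSL_mul hdiag hHdet, ← toSL_smul (c := (H.det : ℝ) / T * c)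
    (by positivity) (A := Matrix.diagonal (fun i : Fin e => (a.1 i.castSucc : ℝ)) *
      castMat (kerB a.1) * castMat H) (by rw [Matrix.det_mul]; positivity)]
  congr 1
  rw [Matrix.mul_smul, mul_comm _ c, ← smul_smul]
  congr 1
  rw [← Matrix.mul_assoc, ← Matrix.smul_mul, ← Matrix.smul_mul, ← Matrix.diagonal_smul]
  congr 3
  ext i
  simp
  ring

lemma toSL_castMat (γ : Matrix.SpecialLinearGroup (Fin e) ℤ) : toSL (castMat γ.1) = castSL γ :=
  toSL_coe (castSL γ)

lemma minors_smul_castMat {c : ℝ} (M : Matrix (Fin e) (Fin e) ℤ × (Fin e → ℤ)) (i : Fin (e + 1)) :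
    minors (c • castMat M.1) (c • fun j => (M.2 j : ℝ)) i = c ^ e * minors M.1 M.2 i := by
  rw [minors_smul]
  have h1 := minors_map (Int.castRingHom ℝ) M.1 M.2
  have h2 : (fun j => (M.2 j : ℝ)) = Int.castRingHom ℝ ∘ M.2 := rfl
  rw [h2, h1]
  simp

open ENNReal

lemma testFn_ne_zero_pos {φ : SLR e → ℝ} {w : (Fin (e + 1) → ℝ) → ℝ}
    (hw : ∀ x, w x ≠ 0 → ∀ i, 0 < x i) {T : ℝ} (hT : 0 < T)
    (M : Matrix (Fin e) (Fin e) ℤ × (Fin e → ℤ))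
    (hM : ENNReal.ofReal (testFn φ w (T ^ (-(1 / (e : ℝ))) • castMat M.1)
      (T ^ (-(1 / (e : ℝ))) • fun j => (M.2 j : ℝ))) ≠ 0) (i : Fin (e + 1)) :
    0 < minors M.1 M.2 i := by
  have h1 : testFn φ w (T ^ (-(1 / (e : ℝ))) • castMat M.1)
      (T ^ (-(1 / (e : ℝ))) • fun j => (M.2 j : ℝ)) ≠ 0 := fun h => hM (by rw [h]; simp)
  have h2 := hw _ (left_ne_zero_of_mul h1) i
  rw [minors_smul_castMat] at h2
  have : (0 : ℝ) < minors M.1 M.2 i := pos_of_mul_pos_right h2 (by positivity)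
  exact_mod_cast this

/-- The sum over integer matrices with coprime minors unfolds to a sum over primitive vectors. -/
lemma tsum_testFn_coprime {φ : C_c(SLR e, ℝ)} (hφ : ∀ g, 0 ≤ φ g)
    {w : (Fin (e + 1) → ℝ) → ℝ} (hw0 : ∀ x, 0 ≤ w x)
    (hw : ∀ x, w x ≠ 0 → ∀ i, 0 < x i) {T : ℝ} (hT : 0 < T) :
    ∑' M : {M : Matrix (Fin e) (Fin e) ℤ × (Fin e → ℤ) // Finset.univ.gcd (minors M.1 M.2) = 1},
      ENNReal.ofReal (testFn φ w (T ^ (-(1 / (e : ℝ))) • castMat M.1.1)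
        (T ^ (-(1 / (e : ℝ))) • fun j => (M.1.2 j : ℝ)))
    = ∑' a : PosPrim (e + 1),
      ENNReal.ofReal (w (fun i => a.1 i / T) * orbitSum φ (latticePoint a.1)) := by
  rw [tsum_gcd_minors_eq_one (fun M => ENNReal.ofReal (testFn φ w
    (T ^ (-(1 / (e : ℝ))) • castMat M.1) (T ^ (-(1 / (e : ℝ))) • fun j => (M.2 j : ℝ))))
    (testFn_ne_zero_pos hw hT)]
  refine tsum_congr fun a => ?_
  have h1 : ∀ γ : Matrix.SpecialLinearGroup (Fin e) ℤ,
      testFn φ w (T ^ (-(1 / (e : ℝ))) • castMat (kerB a.1 * γ.1))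
        (T ^ (-(1 / (e : ℝ))) • (fun j => ((kerR a.1 ᵥ* γ.1) j : ℝ)))
      = w (fun i => a.1 i / T) * φ (latticePoint a.1 * castSL γ) := by
    intro γ
    rw [testFn_kerB_mul φ w hT a γ.1 (by rw [γ.2]; exact one_pos), toSL_castMat, γ.2]
    simp
  simp only [h1]
  rw [orbitSum_eq_tsum, ← tsum_mul_left, ENNReal.ofReal_tsum_of_nonneg
    (fun γ => mul_nonneg (hw0 _) (hφ _)) ((summable_orbit φ _).mul_left _)]

lemma tsum_posPrim_le {n : ℕ} {f : PosPrim n → ℝ≥0∞} {C : ℝ≥0∞} {y : ℝ}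
    (hf : ∀ a, f a ≤ C) (h0 : ∀ a, f a ≠ 0 → ∀ j, (a.1 j : ℝ) ≤ y) (hy : 0 ≤ y) :
    ∑' a, f a ≤ C * ENNReal.ofReal (y ^ n) := by
  classical
  set S : Finset (Fin n → ℤ) := Fintype.piFinset fun _ => Finset.Ioc 0 ⌊y⌋ with hS
  have h1 : ∀ a : PosPrim n, f a ≤ Set.indicator (S : Set (Fin n → ℤ)) (fun _ => C) a.1 := by
    intro a
    by_cases ha : f a = 0
    · rw [ha]; exact zero_le
    · rw [Set.indicator_of_mem]
      · exact hf a
      · simp only [hS, Finset.mem_coe, Fintype.mem_piFinset, Finset.mem_Ioc]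
        exact fun j => ⟨a.2.2 j, Int.le_floor.2 (h0 a ha j)⟩
  calc ∑' a, f a ≤ ∑' a : PosPrim n, Set.indicator (S : Set (Fin n → ℤ)) (fun _ => C) a.1 :=
        ENNReal.tsum_le_tsum h1
    _ ≤ ∑' v, Set.indicator (S : Set (Fin n → ℤ)) (fun _ => C) v :=
        ENNReal.tsum_comp_le_tsum_of_injective Subtype.val_injective _
    _ = S.card * C := by
        rw [← tsum_subtype, Finset.tsum_subtype' S (fun _ => C)]
        simp
    _ ≤ C * ENNReal.ofReal (y ^ n) := by
        rw [mul_comm]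
        refine mul_le_mul_right ?_ C
        rw [hS, Fintype.card_piFinset_const, Int.card_Ioc, ← ENNReal.ofReal_natCast]
        refine ENNReal.ofReal_le_ofReal ?_
        push_cast
        refine pow_le_pow_left₀ (by positivity) ?_ _
        have h2 : 0 ≤ ⌊y⌋ := Int.floor_nonneg.2 hy
        have h3 : ((⌊y⌋ - 0).toNat : ℝ) = (⌊y⌋ : ℝ) := by
          rw [sub_zero]; exact_mod_cast Int.toNat_of_nonneg h2
        rw [h3]
        exact Int.floor_le y

/-- The contribution of integer matrices whose minors have a common factor larger than `m`. -/
lemma tsum_testFn_gcd_gt_le (P : HermiteFamily e) (m : ℕ) {φ : C_c(SLR e, ℝ)}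
    (hφ : ∀ g, 0 ≤ φ g) {Cφ : ℝ} (hCφ : ∀ g, orbitSum φ g ≤ Cφ)
    {w : (Fin (e + 1) → ℝ) → ℝ} (hw0 : ∀ x, 0 ≤ w x) {Cw y : ℝ} (hCw : ∀ x, w x ≤ Cw)
    (hw : ∀ x, w x ≠ 0 → ∀ i, 0 < x i ∧ x i ≤ y) (hy : 0 ≤ y) {T : ℝ} (hT : 0 < T) :
    ∑' M : {M : Matrix (Fin e) (Fin e) ℤ × (Fin e → ℤ) //
        (m : ℤ) < Finset.univ.gcd (minors M.1 M.2)},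
      ENNReal.ofReal (testFn φ w (T ^ (-(1 / (e : ℝ))) • castMat M.1.1)
        (T ^ (-(1 / (e : ℝ))) • fun j => (M.1.2 j : ℝ)))
    ≤ ENNReal.ofReal (Cw * Cφ * (y * T) ^ (e + 1) *
      ∑' i : {i : P.Idx // (m : ℤ) < (P.mat i).det}, (((P.mat i.1).det : ℝ) ^ (e + 1))⁻¹) := by
  have hCφ0 : 0 ≤ Cφ := (orbitSum_nonneg hφ 1).trans (hCφ 1)
  have hCw0 : 0 ≤ Cw := (hw0 0).trans (hCw 0)
  refine (tsum_gcd_minors_gt_le P m (fun M => ENNReal.ofReal (testFn φ w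
    (T ^ (-(1 / (e : ℝ))) • castMat M.1) (T ^ (-(1 / (e : ℝ))) • fun j => (M.2 j : ℝ))))
    (testFn_ne_zero_pos (fun x hx i => (hw x hx i).1) hT)).trans ?_
  rw [ENNReal.tsum_comm]
  have hsum : Summable fun i : {i : P.Idx // (m : ℤ) < (P.mat i).det} =>
      (((P.mat i.1).det : ℝ) ^ (e + 1))⁻¹ := (P.summable (e + 1) le_rfl).subtype _
  have hdpos : ∀ i, (0 : ℝ) < ((P.mat i).det : ℝ) := fun i => by exact_mod_cast P.det_pos i
  rw [← tsum_mul_left, ENNReal.ofReal_tsum_of_nonneg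
    (fun i => mul_nonneg (by positivity) (inv_nonneg.2 (pow_nonneg (hdpos _).le _)))
    (hsum.mul_left _)]
  refine ENNReal.tsum_le_tsum fun i => ?_
  have hd := hdpos i.1
  have h1 : ∀ (a : PosPrim (e + 1)) (γ : Matrix.SpecialLinearGroup (Fin e) ℤ),
      testFn φ w (T ^ (-(1 / (e : ℝ))) • castMat (kerB a.1 * (P.mat i.1 * γ.1)))
        (T ^ (-(1 / (e : ℝ))) • (fun j => ((kerR a.1 ᵥ* (P.mat i.1 * γ.1)) j : ℝ)))
      = w (fun j => ((P.mat i.1).det : ℝ) * a.1 j / T) *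
        φ (latticePoint a.1 * toSL (castMat (P.mat i.1)) * castSL γ) := by
    intro a γ
    have hdet : (P.mat i.1 * γ.1).det = (P.mat i.1).det := by rw [Matrix.det_mul, γ.2, mul_one]
    rw [testFn_kerB_mul φ w hT a _ (by rw [hdet]; exact P.det_pos _), hdet, castMat_mul,
      toSL_mul (by rw [det_castMat]; exact hd) (det_castMat_SL γ), toSL_castMat, mul_assoc]
  simp only [h1]
  have h2 : ∀ a : PosPrim (e + 1), ∑' γ : Matrix.SpecialLinearGroup (Fin e) ℤ,
      ENNReal.ofReal (w (fun j => ((P.mat i.1).det : ℝ) * a.1 j / T) *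
        φ (latticePoint a.1 * toSL (castMat (P.mat i.1)) * castSL γ))
      = ENNReal.ofReal (w (fun j => ((P.mat i.1).det : ℝ) * a.1 j / T) *
        orbitSum φ (latticePoint a.1 * toSL (castMat (P.mat i.1)))) := by
    intro a
    rw [orbitSum_eq_tsum, ← tsum_mul_left, ENNReal.ofReal_tsum_of_nonneg
      (fun γ => mul_nonneg (hw0 _) (hφ _)) ((summable_orbit φ _).mul_left _)]
  simp only [h2]
  refine (tsum_posPrim_le (C := ENNReal.ofReal (Cw * Cφ)) (y := y * T / (P.mat i.1).det)
    (fun a => ENNReal.ofReal_le_ofReal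
      (mul_le_mul (hCw _) (hCφ _) (orbitSum_nonneg hφ _) hCw0)) ?_ (by positivity)).trans
    (le_of_eq ?_)
  · intro a ha j
    have h3 : w (fun j => ((P.mat i.1).det : ℝ) * a.1 j / T) ≠ 0 := by
      intro h; rw [h] at ha; simp at ha
    have h4 := (hw _ h3 j).2
    rw [div_le_iff₀ hT] at h4
    rw [le_div_iff₀ hd]
    linarith
  · rw [← ENNReal.ofReal_mul (by positivity), div_pow]
    congr 1
    ring

end TestFunctions

section RiemannSums

open Filter Topology

lemma map_floor_volume (ι : Type*) [Fintype ι] :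
    Measure.map (fun (x : ι → ℝ) i => ⌊x i⌋) volume = Measure.count := by
  rw [Measure.ext_iff_singleton]
  intro k
  have hm : Measurable (fun (x : ι → ℝ) i => ⌊x i⌋) := by fun_prop
  rw [Measure.map_apply hm (measurableSet_singleton _), Measure.count_singleton]
  have : (fun (x : ι → ℝ) i => ⌊x i⌋) ⁻¹' {k} =
      Set.pi Set.univ fun i => Set.Ico (k i : ℝ) (k i + 1) := by
    ext x
    simp [funext_iff, Int.floor_eq_iff]
  rw [this, Real.volume_pi_Ico]
  simp

lemma integral_floor {ι : Type*} [Fintype ι] (f : (ι → ℤ) → ℝ) :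
    ∫ x : ι → ℝ, f (fun i => ⌊x i⌋) = ∑' k, f k := by
  have hm : Measurable (fun (x : ι → ℝ) i => ⌊x i⌋) := by fun_prop
  rw [← integral_map (f := f) hm.aemeasurable (measurable_of_countable f).aestronglyMeasurable,
    map_floor_volume]
  by_cases hf : Integrable f Measure.count
  · rw [integral_countable hf]
    simp [Measure.real]
  · rw [integral_undef hf, tsum_eq_zero_of_not_summable]
    intro h
    exact hf (integrable_count_iff.2 h.norm)

lemma finite_intCast_smul_mem {ι : Type*} [Finite ι] {Φ : (ι → ℝ) → ℝ} {y : ℝ}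
    (hy : ∀ x, Φ x ≠ 0 → ∀ i, |x i| ≤ y) {N : ℝ} (hN : 0 < N) :
    {M : ι → ℤ | Φ (N⁻¹ • fun i => (M i : ℝ)) ≠ 0}.Finite := by
  refine Set.Finite.subset (Set.Finite.pi' fun _ : ι => Set.finite_Icc (-⌈y * N⌉) ⌈y * N⌉) ?_
  intro M hM i
  have h := hy _ hM i
  simp only [Pi.smul_apply, smul_eq_mul, abs_mul, abs_inv, abs_of_pos hN] at h
  rw [inv_mul_le_iff₀ hN, mul_comm] at h
  have h2 : ((|M i| : ℤ) : ℝ) ≤ (⌈y * N⌉ : ℝ) := by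
    rw [Int.cast_abs]; exact h.trans (Int.le_ceil _)
  exact abs_le.1 (by exact_mod_cast h2)

lemma tendsto_riemannSum {ι : Type*} [Fintype ι] {Φ : (ι → ℝ) → ℝ} {C y : ℝ}
    (hC : ∀ x, |Φ x| ≤ C) (hy : ∀ x, Φ x ≠ 0 → ∀ i, |x i| ≤ y)
    (hcont : ∀ᵐ x, ContinuousAt Φ x) {m : ℕ} (hm : 0 < m) (c : ι → ℤ) :
    Tendsto (fun N : ℝ => (∑' k : ι → ℤ, Φ (N⁻¹ • fun i => ((m * k i + c i : ℤ) : ℝ))) /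
      N ^ Fintype.card ι) atTop (𝓝 ((∫ x, Φ x) / m ^ Fintype.card ι)) := by
  have hm' : (0 : ℝ) < m := by exact_mod_cast hm
  have hm1 : (1 : ℝ) ≤ m := by exact_mod_cast hm
  have hC0 : 0 ≤ C := (abs_nonneg _).trans (hC 0)
  obtain ⟨b, hb⟩ : ∃ b : ℝ, ∀ i, |(c i : ℝ)| ≤ b :=
    ⟨∑ i, |(c i : ℝ)|, fun i =>
      Finset.single_le_sum (f := fun i => |(c i : ℝ)|) (fun _ _ => abs_nonneg _) (Finset.mem_univ i)⟩
  set G : ℝ → (ι → ℝ) → (ι → ℝ) := fun N x =>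
    N⁻¹ • fun i => ((m * ⌊N / m * x i⌋ + c i : ℤ) : ℝ) with hG
  have hdiff : ∀ N : ℝ, 0 < N → ∀ x i, |G N x i - x i| ≤ (m + b) / N := by
    intro N hN x i
    have h1 : G N x i - x i = (m * (⌊N / m * x i⌋ - N / m * x i) + c i) / N := by
      simp only [hG, Pi.smul_apply, smul_eq_mul]
      push_cast
      field_simp
      ring
    rw [h1, abs_div, abs_of_pos hN]
    gcongr
    refine (abs_add_le _ _).trans (add_le_add ?_ (hb i))
    rw [abs_mul, abs_of_pos hm']
    have h2 := Int.floor_le (N / m * x i)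
    have h3 := Int.lt_floor_add_one (N / m * x i)
    have : |(⌊N / m * x i⌋ : ℝ) - N / m * x i| ≤ 1 := by rw [abs_le]; constructor <;> linarith
    nlinarith
  have key : ∀ᶠ N : ℝ in atTop, (∫ x, Φ (G N x)) / m ^ Fintype.card ι =
      (∑' k : ι → ℤ, Φ (N⁻¹ • fun i => ((m * k i + c i : ℤ) : ℝ))) / N ^ Fintype.card ι := by
    filter_upwards [eventually_gt_atTop 0] with N hN
    rw [← integral_floor (fun k : ι → ℤ => Φ (N⁻¹ • fun i => ((m * k i + c i : ℤ) : ℝ)))]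
    have h := Measure.integral_comp_smul (volume : Measure (ι → ℝ))
      (fun x => Φ (N⁻¹ • fun i => ((m * ⌊x i⌋ + c i : ℤ) : ℝ))) (N / m)
    simp only [Pi.smul_apply, smul_eq_mul, Module.finrank_fintype_fun_eq_card] at h
    simp only [hG]
    rw [h, abs_of_pos (by positivity), div_pow]
    generalize (∫ x : ι → ℝ, Φ (N⁻¹ • fun i => ((m * ⌊x i⌋ + c i : ℤ) : ℝ))) = I
    field_simp
  refine Tendsto.congr' key (Tendsto.div_const ?_ _)
  refine tendsto_integral_filter_of_dominated_convergence
    (Set.indicator (Set.pi Set.univ fun _ => Set.Icc (-(y + (m + b))) (y + (m + b))) fun _ => C)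
    ?_ ?_ ?_ ?_
  · refine Eventually.of_forall fun N => ?_
    have : (fun x => Φ (G N x)) = (fun k : ι → ℤ => Φ (N⁻¹ • fun i => ((m * k i + c i : ℤ) : ℝ))) ∘
        fun x i => ⌊N / m * x i⌋ := rfl
    rw [this]
    have hmeas : Measurable fun (x : ι → ℝ) i => ⌊N / m * x i⌋ := by fun_prop
    exact ((measurable_of_countable _).comp hmeas).aestronglyMeasurable
  · filter_upwards [eventually_ge_atTop 1] with N hN
    refine Eventually.of_forall fun x => ?_
    by_cases hx : Φ (G N x) = 0
    · rw [hx, norm_zero]; exact Set.indicator_nonneg (fun _ _ => hC0) _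
    · rw [Set.indicator_of_mem]
      · exact hC _
      · intro i _
        have h1 := hy _ hx i
        have h2 := hdiff N (by linarith) x i
        have hb0 : 0 ≤ b := (abs_nonneg _).trans (hb i)
        have h3 : (m + b) / N ≤ m + b := div_le_self (by positivity) hN
        rw [Set.mem_Icc]
        rw [abs_le] at h1 h2
        constructor <;> linarith
  · refine (integrable_indicator_iff ?_).2 ?_
    · exact MeasurableSet.univ_pi fun _ => measurableSet_Icc
    · refine integrableOn_const ?_
      exact (isCompact_univ_pi fun _ => isCompact_Icc).measure_lt_top.ne
  · filter_upwards [hcont] with x hx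
    refine hx.tendsto.comp ?_
    rw [tendsto_pi_nhds]
    intro i
    have h0 : Tendsto (fun N : ℝ => (m + b) / N) atTop (𝓝 0) := tendsto_const_nhds.div_atTop tendsto_id
    rw [tendsto_iff_dist_tendsto_zero]
    refine squeeze_zero' (Eventually.of_forall fun _ => dist_nonneg) ?_ h0
    filter_upwards [eventually_gt_atTop 0] with N hN
    exact hdiff N hN x i

lemma exists_density_of_periodic {ι : Type*} [Fintype ι] {χ : (ι → ℤ) → ℝ} {m : ℕ} (hm : 0 < m)
    (hχ : ∀ k c : ι → ℤ, χ (fun i => m * k i + c i) = χ c) (h0 : ∀ c, 0 ≤ χ c) (h1 : ∀ c, χ c ≤ 1) :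
    ∃ δ : ℝ, 0 ≤ δ ∧ δ ≤ 1 ∧ ∀ (Φ : (ι → ℝ) → ℝ) (C y : ℝ), (∀ x, |Φ x| ≤ C) →
      (∀ x, Φ x ≠ 0 → ∀ i, |x i| ≤ y) → (∀ᵐ x, ContinuousAt Φ x) →
      Tendsto (fun N : ℝ => (∑' M : ι → ℤ, χ M * Φ (N⁻¹ • fun i => (M i : ℝ))) /
        N ^ Fintype.card ι) atTop (𝓝 (δ * ∫ x, Φ x)) := by
  classical
  have : NeZero m := ⟨hm.ne'⟩
  have hm' : (0 : ℝ) < m := by exact_mod_cast hm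
  refine ⟨(∑ c : ι → Fin m, χ (fun i => (c i : ℕ))) / m ^ Fintype.card ι,
    div_nonneg (Finset.sum_nonneg fun _ _ => h0 _) (by positivity), ?_, ?_⟩
  · rw [div_le_one (by positivity)]
    refine (Finset.sum_le_sum fun _ _ => h1 _).trans ?_
    simp
  · intro Φ C y hC hy hcont
    set E : (ι → ℤ) ≃ (ι → Fin m) × (ι → ℤ) :=
      ((Equiv.piCongrRight fun _ => Int.divModEquiv m).trans
        (Equiv.arrowProdEquivProdArrow ι (fun _ => ℤ) fun _ => Fin m)).trans (Equiv.prodComm _ _)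
      with hE
    have hEs : ∀ c k, E.symm (c, k) = fun i => m * k i + ((c i : ℕ) : ℤ) := by
      intro c k
      rw [Equiv.symm_apply_eq]
      refine Prod.ext (funext fun i => ?_) (funext fun i => ?_) <;>
        simp only [hE, Equiv.trans_apply, Equiv.prodComm_apply, Equiv.arrowProdEquivProdArrow,
          Equiv.coe_fn_mk, Equiv.piCongrRight_apply, Pi.map_apply, Prod.swap]
      · have := (Int.divModEquiv m).apply_symm_apply (k i, c i)
        rw [Int.divModEquiv_symm_apply] at this
        simp only at this
        rw [mul_comm, this]
      · have := (Int.divModEquiv m).apply_symm_apply (k i, c i)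
        rw [Int.divModEquiv_symm_apply] at this
        simp only at this
        rw [mul_comm, this]
    have hsum : ∀ᶠ N : ℝ in atTop, ∑ c : ι → Fin m, χ (fun i => (c i : ℕ)) *
        ((∑' k : ι → ℤ, Φ (N⁻¹ • fun i => ((m * k i + ((c i : ℕ) : ℤ) : ℤ) : ℝ))) /
          N ^ Fintype.card ι) =
        (∑' M : ι → ℤ, χ M * Φ (N⁻¹ • fun i => (M i : ℝ))) / N ^ Fintype.card ι := by
      filter_upwards [eventually_gt_atTop 0] with N hN
      have hs : Summable fun M : ι → ℤ => χ M * Φ (N⁻¹ • fun i => (M i : ℝ)) := by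
        refine summable_of_hasFiniteSupport ((finite_intCast_smul_mem hy hN).subset fun M hM => ?_)
        exact right_ne_zero_of_mul hM
      rw [← E.symm.tsum_eq (fun M => χ M * Φ (N⁻¹ • fun i => (M i : ℝ))),
        Summable.tsum_prod (f := fun p => χ (E.symm p) * Φ (N⁻¹ • fun i => (E.symm p i : ℝ)))
          (E.symm.summable_iff.2 hs), tsum_fintype, Finset.sum_div]
      refine Finset.sum_congr rfl fun c _ => ?_
      simp only [hEs, hχ]
      rw [tsum_mul_left, mul_div_assoc]
    refine Tendsto.congr' hsum ?_
    rw [show (∑ c : ι → Fin m, χ (fun i => (c i : ℕ))) / (m : ℝ) ^ Fintype.card ι * ∫ x, Φ x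
      = ∑ c : ι → Fin m, χ (fun i => (c i : ℕ)) * ((∫ x, Φ x) / m ^ Fintype.card ι) by
      rw [← Finset.sum_mul]; ring]
    exact tendsto_finsetSum _ fun c _ => (tendsto_riemannSum hC hy hcont hm _).const_mul _

end RiemannSums

section FlatTestFunctions

open Filter Topology CompactlySupported

variable {e : ℕ}

/-- The coordinates of an `(e + 1) × e` matrix, split as a square block and a last row. -/
abbrev BlockIdx (e : ℕ) := (Fin e × Fin e) ⊕ Fin e

/-- The square block of a vector of coordinates. -/
def blockMat {R : Type*} (x : BlockIdx e → R) : Matrix (Fin e) (Fin e) R :=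
  Matrix.of fun i j => x (Sum.inl (i, j))

/-- The last row of a vector of coordinates. -/
def blockRow {R : Type*} (x : BlockIdx e → R) : Fin e → R := fun j => x (Sum.inr j)

/-- Splitting a vector of coordinates into a square block and a last row. -/
def blockEquiv (e : ℕ) (R : Type*) :
    (BlockIdx e → R) ≃ Matrix (Fin e) (Fin e) R × (Fin e → R) where
  toFun x := (blockMat x, blockRow x)
  invFun p := Sum.elim (fun q => p.1 q.1 q.2) p.2
  left_inv x := by
    ext (q | j) <;> rfl
  right_inv p := rfl

lemma card_blockIdx (e : ℕ) : Fintype.card (BlockIdx e) = e * (e + 1) := by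
  simp; ring

lemma continuous_minors_block :
    Continuous fun x : BlockIdx e → ℝ => minors (blockMat x) (blockRow x) := by
  have hB : Continuous fun x : BlockIdx e → ℝ => blockMat x :=
    continuous_matrix fun i j => continuous_apply _
  have hr : Continuous fun x : BlockIdx e → ℝ => blockRow x :=
    continuous_pi fun j => continuous_apply _
  refine continuous_pi fun i => ?_
  refine Fin.lastCases ?_ (fun i => ?_) i
  · simpa using hB.matrix_det
  · simp only [minors_castSucc]
    exact ((continuous_apply i).comp (hr.matrix_vecMul hB.matrix_adjugate)).neg

lemma det_diagonal_minors_mul (B : Matrix (Fin e) (Fin e) ℝ) (r : Fin e → ℝ) :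
    (Matrix.diagonal (fun i : Fin e => minors B r i.castSucc) * B).det = ∏ i, minors B r i := by
  rw [Matrix.det_mul, Matrix.det_diagonal, Fin.prod_univ_castSucc, minors_last]

lemma exists_bound_entries (φ : C_c(SLR e, ℝ)) :
    ∃ C : ℝ, 0 ≤ C ∧ ∀ g, φ g ≠ 0 → ∀ i j, |(g : Matrix (Fin e) (Fin e) ℝ) i j| ≤ C := by
  have h : ∀ i j, ∃ C : ℝ, ∀ g ∈ tsupport φ, |(g : Matrix (Fin e) (Fin e) ℝ) i j| ≤ C := by
    intro i j
    obtain ⟨C, hC⟩ := φ.hasCompactSupport.isCompact.exists_bound_of_continuousOn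
      (f := fun g : SLR e => (g : Matrix (Fin e) (Fin e) ℝ) i j)
      (((continuous_coe_SLR e).matrix_elem i j).continuousOn)
    exact ⟨C, hC⟩
  choose C hC using h
  refine ⟨∑ i, ∑ j, |C i j|, by positivity, fun g hg i j => ?_⟩
  refine (hC i j g (subset_tsupport _ hg)).trans ((le_abs_self _).trans ?_)
  exact (Finset.single_le_sum (f := fun j => |C i j|) (fun _ _ => abs_nonneg _)
    (Finset.mem_univ j)).trans (Finset.single_le_sum (f := fun i => ∑ j, |C i j|)
    (fun _ _ => by positivity) (Finset.mem_univ i))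

variable [NeZero e]

/-- The function `testFn` on the space of coordinates. -/
def testFlat (φ : SLR e → ℝ) (w : (Fin (e + 1) → ℝ) → ℝ) (x : BlockIdx e → ℝ) : ℝ :=
  testFn φ w (blockMat x) (blockRow x)

lemma continuous_testFlat (φ : C_c(SLR e, ℝ)) {w : (Fin (e + 1) → ℝ) → ℝ} (hwc : Continuous w)
    {η : ℝ} (hη : 0 < η) (hw : ∀ x, w x ≠ 0 → ∀ i, η ≤ x i) : Continuous (testFlat φ w) := by
  rw [continuous_iff_continuousAt]
  intro x
  by_cases hx : ∀ i, 0 < minors (blockMat x) (blockRow x) i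
  · refine ContinuousAt.mul (hwc.comp continuous_minors_block).continuousAt ?_
    refine φ.continuous.continuousAt.comp ?_
    have hB : Continuous fun x : BlockIdx e → ℝ => blockMat x :=
      continuous_matrix fun i j => continuous_apply _
    have hD : Continuous fun x : BlockIdx e → ℝ =>
        Matrix.diagonal (fun i : Fin e => minors (blockMat x) (blockRow x) i.castSucc) *
          blockMat x := by
      refine Continuous.matrix_mul (Continuous.matrix_diagonal (continuous_pi fun i => ?_)) hB
      exact (continuous_apply i.castSucc).comp continuous_minors_block
    have hopen : IsOpen {A : Matrix (Fin e) (Fin e) ℝ | 0 < A.det} :=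
      isOpen_lt continuous_const (continuous_id.matrix_det)
    refine (continuousOn_toSL.continuousAt (hopen.mem_nhds ?_)).comp_of_eq hD.continuousAt rfl
    rw [Set.mem_ofPred_eq, det_diagonal_minors_mul]
    exact Finset.prod_pos fun i _ => hx i
  · push Not at hx
    obtain ⟨i, hi⟩ := hx
    have h0 : ∀ᶠ z in 𝓝 x, testFlat φ w z = 0 := by
      have := ((continuous_apply i).comp continuous_minors_block).continuousAt (x := x)
      filter_upwards [this.eventually_lt continuousAt_const (lt_of_le_of_lt hi hη)] with z hz
      by_contra h
      exact absurd (hw _ (left_ne_zero_of_mul h) i) (not_le.2 hz)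
    exact continuousAt_const.congr (h0.mono fun z hz => hz.symm)

lemma testFlat_nonneg {φ : SLR e → ℝ} (hφ : ∀ g, 0 ≤ φ g) {w : (Fin (e + 1) → ℝ) → ℝ}
    (hw0 : ∀ x, 0 ≤ w x) (x : BlockIdx e → ℝ) : 0 ≤ testFlat φ w x := mul_nonneg (hw0 _) (hφ _)

lemma exists_support_testFlat (φ : C_c(SLR e, ℝ)) {w : (Fin (e + 1) → ℝ) → ℝ} {η y : ℝ}
    (hη : 0 < η) (hw : ∀ x, w x ≠ 0 → ∀ i, η ≤ x i ∧ x i ≤ y) :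
    ∃ Y : ℝ, ∀ x, testFlat φ w x ≠ 0 → ∀ i, |x i| ≤ Y := by
  obtain ⟨C, hC0, hC⟩ := exists_bound_entries φ
  set Z : ℝ := (∏ _i : Fin (e + 1), y) ^ (1 / (e : ℝ)) with hZ
  have hent : ∀ x, testFlat φ w x ≠ 0 → 0 ≤ y ∧ ∀ i j, |blockMat x i j| ≤ |Z| * C / η := by
    intro x hx
    have h1 := hw _ (left_ne_zero_of_mul hx)
    have h2 := hC _ (right_ne_zero_of_mul hx)
    have hpos : ∀ i, 0 < minors (blockMat x) (blockRow x) i := fun i => hη.trans_le (h1 i).1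
    have hdet : 0 < (Matrix.diagonal (fun i : Fin e => minors (blockMat x) (blockRow x) i.castSucc)
        * blockMat x).det := by
      rw [det_diagonal_minors_mul]; exact Finset.prod_pos fun i _ => hpos i
    refine ⟨(hη.le.trans (h1 0).1).trans (h1 0).2, fun i j => ?_⟩
    have h3 := h2 i j
    rw [shape, coe_toSL hdet, Matrix.smul_apply, Matrix.diagonal_mul, smul_eq_mul,
      Real.rpow_neg hdet.le, abs_mul, abs_mul, abs_of_pos (inv_pos.2 (Real.rpow_pos_of_pos hdet _)),
      abs_of_pos (hpos _), inv_mul_le_iff₀ (Real.rpow_pos_of_pos hdet _)] at h3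
    have h4 : (Matrix.diagonal (fun i : Fin e => minors (blockMat x) (blockRow x) i.castSucc)
        * blockMat x).det ^ (1 / (e : ℝ)) ≤ |Z| := by
      refine le_trans ?_ (le_abs_self _)
      refine Real.rpow_le_rpow hdet.le ?_ (by positivity)
      rw [det_diagonal_minors_mul]
      exact Finset.prod_le_prod (fun i _ => (hpos i).le) fun i _ => (h1 i).2
    rw [le_div_iff₀ hη]
    calc |blockMat x i j| * η ≤ |blockMat x i j| * minors (blockMat x) (blockRow x) i.castSucc := by
          exact mul_le_mul_of_nonneg_left (h1 _).1 (abs_nonneg _)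
      _ ≤ _ := by rw [mul_comm]; exact h3
      _ ≤ |Z| * C := mul_le_mul_of_nonneg_right h4 hC0
  refine ⟨max (|Z| * C / η) (e * (|y| * (|Z| * C / η)) / η), fun x hx i => ?_⟩
  obtain ⟨hy0, h⟩ := hent x hx
  rcases i with ⟨i, j⟩ | j
  · exact (h i j).trans (le_max_left _ _)
  · refine le_trans ?_ (le_max_right _ _)
    have h1 := hw _ (left_ne_zero_of_mul hx)
    have h2 := minors_orthogonal (blockMat x) (blockRow x) j
    have h3 : minors (blockMat x) (blockRow x) (Fin.last e) * blockRow x j =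
        -∑ i, minors (blockMat x) (blockRow x) (Fin.castSucc i) * blockMat x i j := by linarith
    have h4 : minors (blockMat x) (blockRow x) (Fin.last e) * |blockRow x j| ≤
        e * (|y| * (|Z| * C / η)) := by
      rw [← abs_of_pos (hη.trans_le (h1 (Fin.last e)).1), ← abs_mul, h3, abs_neg]
      refine (Finset.abs_sum_le_sum_abs _ _).trans ?_
      refine (Finset.sum_le_card_nsmul _ _ (|y| * (|Z| * C / η)) fun i _ => ?_).trans ?_
      · rw [abs_mul]
        refine mul_le_mul ?_ (h i j) (abs_nonneg _) (abs_nonneg _)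
        rw [abs_of_pos (hη.trans_le (h1 _).1)]
        exact (h1 _).2.trans (le_abs_self _)
      · simp
    rw [le_div_iff₀ hη, mul_comm]
    exact (mul_le_mul_of_nonneg_right (h1 _).1 (abs_nonneg _)).trans h4

lemma exists_bound_testFlat (φ : C_c(SLR e, ℝ)) {w : (Fin (e + 1) → ℝ) → ℝ} {Cw : ℝ}
    (hCw : ∀ x, |w x| ≤ Cw) : ∃ C : ℝ, ∀ x, |testFlat φ w x| ≤ C := by
  obtain ⟨C, hC⟩ := φ.hasCompactSupport.exists_bound_of_continuousOn φ.continuous.continuousOn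
  have hC' : ∀ g, |φ g| ≤ |C| := fun g => by
    by_cases hg : φ g = 0
    · rw [hg, abs_zero]; exact abs_nonneg _
    · exact (hC g (subset_tsupport _ hg)).trans (le_abs_self _)
  refine ⟨Cw * |C|, fun x => ?_⟩
  rw [testFlat, testFn, abs_mul]
  exact mul_le_mul (hCw _) (hC' _) (abs_nonneg _) ((abs_nonneg _).trans (hCw 0))

end FlatTestFunctions

section Sieve

open Filter Topology CompactlySupported

variable {e : ℕ}

/-- The greatest common divisor of the minors of an integer `(e + 1) × e` matrix. -/
def minorGcd (M : BlockIdx e → ℤ) : ℤ := Finset.univ.gcd (minors (blockMat M) (blockRow M))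

lemma minorGcd_nonneg (M : BlockIdx e → ℤ) : 0 ≤ minorGcd M :=
  Int.nonneg_of_normalize_eq_self Finset.normalize_gcd

/-- No divisor of `m` other than one divides all the minors. -/
def SievedBy (m : ℕ) (M : BlockIdx e → ℤ) : Prop :=
  ∀ g : ℕ, g ∣ m → (∀ i, (g : ℤ) ∣ minors (blockMat M) (blockRow M) i) → g = 1

lemma sub_dvd_minors (m : ℕ) (k c : BlockIdx e → ℤ) (i : Fin (e + 1)) :
    (m : ℤ) ∣ minors (blockMat fun i => m * k i + c i) (blockRow fun i => m * k i + c i) i -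
      minors (blockMat c) (blockRow c) i := by
  rw [← ZMod.intCast_eq_intCast_iff_dvd_sub]
  have h := fun x : BlockIdx e → ℤ =>
    congrFun (minors_map (Int.castRingHom (ZMod m)) (blockMat x) (blockRow x)) i
  simp only [Function.comp_apply, eq_intCast] at h
  rw [← h, ← h]
  congr 1
  · ext i j; simp [blockMat]
  · ext j; simp [blockRow]

lemma sievedBy_add_mul (m : ℕ) (k c : BlockIdx e → ℤ) :
    SievedBy m (fun i => m * k i + c i) ↔ SievedBy m c := by
  refine forall_congr' fun g => forall_congr' fun hg => imp_congr (forall_congr' fun i => ?_) Iff.rfl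
  have h : (g : ℤ) ∣ _ := (Int.natCast_dvd_natCast.2 hg).trans (sub_dvd_minors m k c i)
  exact (dvd_iff_dvd_of_dvd_sub h)

lemma sievedBy_of_minorGcd_eq_one (m : ℕ) {M : BlockIdx e → ℤ} (h : minorGcd M = 1) :
    SievedBy m M := by
  intro g _ hg
  have : (g : ℤ) ∣ minorGcd M := Finset.dvd_gcd fun i _ => hg i
  rw [h] at this
  exact Nat.dvd_one.1 (by exact_mod_cast this)

lemma SievedBy.minorGcd_eq_one_or_lt {P : ℕ} {M : BlockIdx e → ℤ} (h : SievedBy P.factorial M)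
    (h0 : ∃ i, minors (blockMat M) (blockRow M) i ≠ 0) : minorGcd M = 1 ∨ (P : ℤ) < minorGcd M := by
  by_contra! hcon
  obtain ⟨h1, h2⟩ := hcon
  obtain ⟨g, hg⟩ := Int.eq_ofNat_of_zero_le (minorGcd_nonneg M)
  have hg0 : g ≠ 0 := by
    rintro rfl
    obtain ⟨i, hi⟩ := h0
    exact hi (Finset.gcd_eq_zero_iff.1 hg i (Finset.mem_univ i))
  rw [hg] at h1 h2
  refine h1 ?_
  have : g = 1 := by
    refine h g (Nat.dvd_factorial (Nat.pos_of_ne_zero hg0) (by exact_mod_cast h2)) fun i => ?_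
    rw [← hg]
    exact Finset.gcd_dvd (Finset.mem_univ i)
  rw [this]; rfl

lemma tsum_subtype_pair (p : ℤ → Prop) [DecidablePred p]
    (f : Matrix (Fin e) (Fin e) ℤ × (Fin e → ℤ) → ℝ) (hf : ∀ M, 0 ≤ f M) :
    (∑' M : {M : Matrix (Fin e) (Fin e) ℤ × (Fin e → ℤ) // p (Finset.univ.gcd (minors M.1 M.2))},
      ENNReal.ofReal (f M.1)).toReal =
    ∑' M : BlockIdx e → ℤ, (if p (minorGcd M) then 1 else 0) * f (blockMat M, blockRow M) := by
  rw [ENNReal.tsum_toReal_eq fun _ => ENNReal.ofReal_ne_top]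
  simp only [ENNReal.toReal_ofReal (hf _)]
  refine (tsum_subtype {M : Matrix (Fin e) (Fin e) ℤ × (Fin e → ℤ) |
    p (Finset.univ.gcd (minors M.1 M.2))} f).trans ?_
  rw [← (blockEquiv e ℤ).tsum_eq]
  refine tsum_congr fun M => ?_
  rw [Set.indicator_apply]
  by_cases h : p (minorGcd M)
  · rw [if_pos h, one_mul, if_pos (by exact h)]; rfl
  · rw [if_neg h, zero_mul, if_neg (by exact h)]

lemma tendsto_tsum_det_gt (P : HermiteFamily e) :
    Tendsto (fun m : ℕ => ∑' i : {i : P.Idx // (m : ℤ) < (P.mat i).det},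
      (((P.mat i.1).det : ℝ) ^ (e + 1))⁻¹) atTop (𝓝 0) := by
  have hpos : ∀ i, (0 : ℝ) ≤ (((P.mat i).det : ℝ) ^ (e + 1))⁻¹ := fun i => inv_nonneg.2
    (pow_nonneg (by exact_mod_cast (P.det_pos i).le) _)
  have h : ∀ m : ℕ, ∑' i : {i : P.Idx // (m : ℤ) < (P.mat i).det},
      (((P.mat i.1).det : ℝ) ^ (e + 1))⁻¹ = ∑' i, Set.indicator {i | (m : ℤ) < (P.mat i).det}
        (fun i => (((P.mat i).det : ℝ) ^ (e + 1))⁻¹) i := fun m =>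
    tsum_subtype {i | (m : ℤ) < (P.mat i).det} fun i => (((P.mat i).det : ℝ) ^ (e + 1))⁻¹
  simp only [h]
  rw [← tsum_zero (α := ℝ) (β := P.Idx)]
  refine tendsto_tsum_of_dominated_convergence (P.summable (e + 1) le_rfl) (fun i => ?_)
    (Eventually.of_forall fun m i => ?_)
  · refine tendsto_const_nhds.congr' ?_
    filter_upwards [eventually_ge_atTop (P.mat i).det.toNat] with m hm
    rw [Set.indicator_of_notMem]
    simp only [Set.mem_ofPred_eq, not_lt]
    exact Int.toNat_le.1 hm
  · rw [Real.norm_of_nonneg (Set.indicator_nonneg (fun i _ => hpos i) _)]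
    exact Set.indicator_le_self' (fun i _ => hpos i) i

variable [NeZero e]

/-- The weighted sum of the values of `orbitSum φ` over the lattices of positive primitive integer
vectors. -/
def primSum (φ : C_c(SLR e, ℝ)) (w : (Fin (e + 1) → ℝ) → ℝ) (T : ℝ) : ℝ :=
  ∑' a : PosPrim (e + 1), w (fun i => a.1 i / T) * orbitSum φ (latticePoint a.1)

lemma primSum_eq_tsum {φ : C_c(SLR e, ℝ)} (hφ : ∀ g, 0 ≤ φ g)
    {w : (Fin (e + 1) → ℝ) → ℝ} (hw0 : ∀ x, 0 ≤ w x) (hw : ∀ x, w x ≠ 0 → ∀ i, 0 < x i)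
    {T : ℝ} (hT : 0 < T) :
    primSum φ w T = ∑' M : BlockIdx e → ℤ, (if minorGcd M = 1 then 1 else 0) *
      testFlat φ w (T ^ (-(1 / (e : ℝ))) • fun i => (M i : ℝ)) := by
  have h := congrArg ENNReal.toReal (tsum_testFn_coprime hφ hw0 hw hT)
  rw [ENNReal.tsum_toReal_eq (fun _ : PosPrim (e + 1) => ENNReal.ofReal_ne_top)] at h
  rw [primSum]
  refine Eq.trans (tsum_congr fun a => ?_) (h.symm.trans ?_)
  · rw [ENNReal.toReal_ofReal (mul_nonneg (hw0 _) (orbitSum_nonneg hφ _))]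
  · exact tsum_subtype_pair (fun g => g = 1) (fun M => testFn φ w
      (T ^ (-(1 / (e : ℝ))) • castMat M.1) (T ^ (-(1 / (e : ℝ))) • fun j => (M.2 j : ℝ)))
      fun M => mul_nonneg (hw0 _) (hφ _)

lemma tsum_minorGcd_gt_le (P : HermiteFamily e) (m : ℕ) {φ : C_c(SLR e, ℝ)}
    (hφ : ∀ g, 0 ≤ φ g) {Cφ : ℝ} (hCφ : ∀ g, orbitSum φ g ≤ Cφ)
    {w : (Fin (e + 1) → ℝ) → ℝ} (hw0 : ∀ x, 0 ≤ w x) {Cw y : ℝ} (hCw : ∀ x, w x ≤ Cw)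
    (hw : ∀ x, w x ≠ 0 → ∀ i, 0 < x i ∧ x i ≤ y) (hy : 0 ≤ y) {T : ℝ} (hT : 0 < T) :
    ∑' M : BlockIdx e → ℤ, (if (m : ℤ) < minorGcd M then 1 else 0) *
      testFlat φ w (T ^ (-(1 / (e : ℝ))) • fun i => (M i : ℝ)) ≤
    Cw * Cφ * (y * T) ^ (e + 1) *
      ∑' i : {i : P.Idx // (m : ℤ) < (P.mat i).det}, (((P.mat i.1).det : ℝ) ^ (e + 1))⁻¹ := by
  have h := ENNReal.toReal_mono ENNReal.ofReal_ne_top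
    (tsum_testFn_gcd_gt_le P m hφ hCφ hw0 hCw hw hy hT)
  have hCw0 : 0 ≤ Cw := (hw0 0).trans (hCw 0)
  have hCφ0 : 0 ≤ Cφ := (orbitSum_nonneg hφ 1).trans (hCφ 1)
  rw [ENNReal.toReal_ofReal (mul_nonneg (by positivity) (tsum_nonneg fun i => inv_nonneg.2
    (pow_nonneg (by exact_mod_cast (P.det_pos i.1).le) _)))] at h
  refine le_trans (le_of_eq ?_) h
  exact (tsum_subtype_pair (fun g => (m : ℤ) < g) (fun M => testFn φ w
      (T ^ (-(1 / (e : ℝ))) • castMat M.1) (T ^ (-(1 / (e : ℝ))) • fun j => (M.2 j : ℝ)))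
      fun M => mul_nonneg (hw0 _) (hφ _)).symm

lemma finite_testFlat_ne_zero (φ : C_c(SLR e, ℝ)) {w : (Fin (e + 1) → ℝ) → ℝ} {η y : ℝ}
    (hη : 0 < η) (hw : ∀ x, w x ≠ 0 → ∀ i, η ≤ x i ∧ x i ≤ y) {c : ℝ} (hc : 0 < c) :
    {M : BlockIdx e → ℤ | testFlat φ w (c • fun i => (M i : ℝ)) ≠ 0}.Finite := by
  obtain ⟨Y, hY⟩ := exists_support_testFlat φ hη hw
  have := finite_intCast_smul_mem hY (inv_pos.2 hc)
  rwa [inv_inv] at this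

lemma minors_ne_zero_of_testFlat {φ : SLR e → ℝ} {w : (Fin (e + 1) → ℝ) → ℝ}
    (hw : ∀ x, w x ≠ 0 → ∀ i, 0 < x i) {c : ℝ} {M : BlockIdx e → ℤ}
    (h : testFlat φ w (c • fun i => (M i : ℝ)) ≠ 0) (i : Fin (e + 1)) :
    minors (blockMat M) (blockRow M) i ≠ 0 := by
  intro h0
  have h1 := hw _ (left_ne_zero_of_mul (a := w _) (b := φ _) h) i
  have h2 := minors_smul_castMat (c := c) (blockMat M, blockRow M) i
  simp only [h0, Int.cast_zero, mul_zero] at h2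
  exact h1.ne' h2

/-- The proportion of integer matrices whose minors are coprime exists. -/
theorem exists_density_primSum (e : ℕ) [NeZero e] : ∃ δ : ℝ, 0 ≤ δ ∧ ∀ (φ : C_c(SLR e, ℝ))
    (w : (Fin (e + 1) → ℝ) → ℝ) (η y Cw : ℝ), (∀ g, 0 ≤ φ g) → Continuous w → (∀ x, 0 ≤ w x) →
    (∀ x, w x ≤ Cw) → 0 < η → 0 ≤ y → (∀ x, w x ≠ 0 → ∀ i, η ≤ x i ∧ x i ≤ y) →
    Tendsto (fun T => primSum φ w T / T ^ (e + 1)) atTop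
      (𝓝 (δ * ∫ x, testFlat φ w x)) := by
  classical
  obtain ⟨P⟩ := nonempty_hermiteFamily e
  have hdens : ∀ q : ℕ, _ := fun q => exists_density_of_periodic (ι := BlockIdx e)
    (χ := fun M => if SievedBy q.factorial M then 1 else 0) (Nat.factorial_pos q)
    (fun k c => by simp only [sievedBy_add_mul]) (fun c => by split_ifs <;> norm_num)
    (fun c => by split_ifs <;> norm_num)
  choose δ hδ0 hδ1 hδ using hdens
  obtain ⟨δ', hδ', s, hs, hlim⟩ := isCompact_Icc.tendsto_subseq (x := δ)
    (fun q => (⟨hδ0 q, hδ1 q⟩ : δ q ∈ Set.Icc (0 : ℝ) 1))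
  refine ⟨δ', hδ'.1, ?_⟩
  intro φ w η y Cw hφ hwc hw0 hCw hη hy hw
  have he : (e : ℝ) ≠ 0 := by exact_mod_cast NeZero.ne e
  have hwpos : ∀ x, w x ≠ 0 → ∀ i, 0 < x i := fun x hx i => hη.trans_le (hw x hx i).1
  obtain ⟨Y, hY⟩ := exists_support_testFlat φ hη hw
  obtain ⟨C, hC⟩ := exists_bound_testFlat φ (w := w) (Cw := Cw)
    (fun x => by rw [abs_of_nonneg (hw0 x)]; exact hCw x)
  obtain ⟨Cφ, hCφ0, hCφ⟩ := quotSum_bounded φ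
  have hcont := continuous_testFlat φ hwc hη (fun x hx i => (hw x hx i).1)
  set I := ∫ x, testFlat φ w x with hI
  set τ : ℕ → ℝ := fun m => ∑' i : {i : P.Idx // (m : ℤ) < (P.mat i).det},
    (((P.mat i.1).det : ℝ) ^ (e + 1))⁻¹ with hτ
  set S : ℕ → ℝ → ℝ := fun q T => ∑' M : BlockIdx e → ℤ,
    (if SievedBy q.factorial M then 1 else 0) *
      testFlat φ w (T ^ (-(1 / (e : ℝ))) • fun i => (M i : ℝ)) with hS
  have hSlim : ∀ q, Tendsto (fun T => S q T / T ^ (e + 1)) atTop (𝓝 (δ q * I)) := by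
    intro q
    have h1 := (hδ q (testFlat φ w) C Y hC hY (Eventually.of_forall fun x => hcont.continuousAt)).comp
      (tendsto_rpow_atTop (y := 1 / (e : ℝ)) (by positivity))
    refine h1.congr' ?_
    filter_upwards [eventually_gt_atTop 0] with T hT
    have hpow : (T ^ (1 / (e : ℝ))) ^ (e * (e + 1)) = T ^ (e + 1) := by
      rw [pow_mul, ← Real.rpow_mul_natCast hT.le, one_div, inv_mul_cancel₀ he,
        Real.rpow_one]
    simp only [Function.comp_apply, hS, card_blockIdx, hpow, Real.rpow_neg hT.le]
  have hle : ∀ q T, 0 < T → primSum φ w T ≤ S q T ∧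
      S q T ≤ primSum φ w T + Cw * Cφ * (y * T) ^ (e + 1) * τ q := by
    intro q T hT
    have hc : 0 < T ^ (-(1 / (e : ℝ))) := Real.rpow_pos_of_pos hT _
    have hsum : ∀ χ : (BlockIdx e → ℤ) → ℝ, Summable fun M => χ M *
        testFlat φ w (T ^ (-(1 / (e : ℝ))) • fun i => (M i : ℝ)) := fun χ =>
      summable_of_hasFiniteSupport ((finite_testFlat_ne_zero φ hη hw hc).subset fun M hM =>
        right_ne_zero_of_mul hM)
    have hnn := testFlat_nonneg hφ hw0
    rw [primSum_eq_tsum hφ hw0 hwpos hT]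
    constructor
    · refine (hsum _).tsum_le_tsum (fun M => ?_) (hsum _)
      refine mul_le_mul_of_nonneg_right ?_ (hnn _)
      by_cases h : minorGcd M = 1
      · rw [if_pos h, if_pos (sievedBy_of_minorGcd_eq_one _ h)]
      · rw [if_neg h]; split_ifs <;> norm_num
    · refine le_trans ?_ (add_le_add_right (tsum_minorGcd_gt_le P q hφ
        (fun g => (le_abs_self _).trans (hCφ (QuotientGroup.mk g))) hw0 hCw
        (fun x hx i => ⟨hwpos x hx i, (hw x hx i).2⟩) hy hT) _)
      rw [← (hsum _).tsum_add (hsum _)]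
      refine (hsum _).tsum_le_tsum (fun M => ?_) ((hsum _).add (hsum _))
      rw [← add_mul]
      by_cases h0 : testFlat φ w (T ^ (-(1 / (e : ℝ))) • fun i => (M i : ℝ)) = 0
      · rw [h0, mul_zero, mul_zero]
      refine mul_le_mul_of_nonneg_right ?_ (hnn _)
      by_cases h : SievedBy q.factorial M
      · rw [if_pos h]
        rcases h.minorGcd_eq_one_or_lt ⟨0, minors_ne_zero_of_testFlat hwpos h0 0⟩ with h1 | h1
        · rw [if_pos h1]; split_ifs <;> norm_num
        · rw [if_pos h1]; split_ifs <;> norm_num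
      · rw [if_neg h]; split_ifs <;> norm_num
  have hτlim : Tendsto (fun k => Cw * Cφ * y ^ (e + 1) * τ (s k)) atTop (𝓝 0) := by
    simpa using ((tendsto_tsum_det_gt P).comp hs.tendsto_atTop).const_mul (Cw * Cφ * y ^ (e + 1))
  rw [Metric.tendsto_atTop']
  intro ε hε
  have hε3 : 0 < ε / 3 := by positivity
  obtain ⟨k, hk1, hk2⟩ := (((hlim.mul_const I).eventually (Metric.ball_mem_nhds _ hε3)).and
    (hτlim.eventually (Metric.ball_mem_nhds _ hε3))).exists
  have hev := ((hSlim (s k)).eventually (Metric.ball_mem_nhds _ hε3)).and (eventually_gt_atTop 0)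
  obtain ⟨T₀, hT₀⟩ := eventually_atTop.1 hev
  refine ⟨T₀, fun T hT => ?_⟩
  obtain ⟨h1, h2⟩ := hT₀ T hT.le
  obtain ⟨h3, h4⟩ := hle (s k) T h2
  have hTp : 0 < T ^ (e + 1) := by positivity
  have h5 : primSum φ w T / T ^ (e + 1) ≤ S (s k) T / T ^ (e + 1) := by gcongr
  have h6 : S (s k) T / T ^ (e + 1) ≤
      primSum φ w T / T ^ (e + 1) + Cw * Cφ * y ^ (e + 1) * τ (s k) := by
    rw [div_le_iff₀ hTp, add_mul, div_mul_cancel₀ _ hTp.ne']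
    refine h4.trans (le_of_eq ?_)
    rw [mul_pow]; ring
  simp only [Real.dist_eq, Function.comp_apply, sub_zero] at hk1 hk2 h1
  rw [Real.dist_eq]
  rw [abs_lt] at *
  constructor <;> linarith

end Sieve

section Invariance

open Filter Topology CompactlySupported

variable {e : ℕ}

/-- The square matrix with given entries. -/
def entryMat (b : Fin e × Fin e → ℝ) : Matrix (Fin e) (Fin e) ℝ := Matrix.of fun i j => b (i, j)

lemma continuous_entryMat : Continuous (entryMat (e := e)) :=
  continuous_matrix fun _ _ => continuous_apply _

lemma integral_comp_toLin' {ι : Type*} [Fintype ι] [DecidableEq ι] {M : Matrix ι ι ℝ}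
    (hM : M.det ≠ 0) {F : (ι → ℝ) → ℝ} (hF : Continuous F) :
    |M.det| * ∫ x, F (M *ᵥ x) = ∫ x, F x := by
  have hcont : Continuous (Matrix.toLin' M) := (Matrix.toLin' M).continuous_of_finiteDimensional
  have h := integral_map (μ := volume) hcont.measurable.aemeasurable (f := F)
    hF.aestronglyMeasurable
  rw [Real.map_matrix_volume_pi_eq_smul_volume_pi hM, integral_smul_measure,
    ENNReal.toReal_ofReal (abs_nonneg _), smul_eq_mul] at h
  simp only [Matrix.toLin'_apply] at h
  rw [← h, abs_inv, mul_inv_cancel_left₀ (abs_ne_zero.2 hM)]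

lemma integral_entryMat_mul {k : Matrix (Fin e) (Fin e) ℝ} (hk : k.det = 1)
    {G : Matrix (Fin e) (Fin e) ℝ → ℝ} (hG : Continuous G) :
    ∫ b, G (k * entryMat b) = ∫ b, G (entryMat b) := by
  have hdet : (kroneckerMap (fun x y : ℝ => x * y) k (1 : Matrix (Fin e) (Fin e) ℝ)).det = 1 := by
    rw [Matrix.det_kronecker, hk]; simp
  have h := integral_comp_toLin' (by rw [hdet]; exact one_ne_zero)
    (hG.comp continuous_entryMat)
  rw [hdet, abs_one, one_mul] at h
  rw [show ∫ b, G (entryMat b) = _ from h.symm]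
  refine integral_congr_ae (Eventually.of_forall fun b => ?_)
  simp only [Function.comp_apply]
  congr 1
  ext i j
  simp [Matrix.mul_apply, entryMat, Matrix.mulVec, dotProduct, Fintype.sum_prod_type,
    Matrix.one_apply]

lemma minors_neg_vecMul (B : Matrix (Fin e) (Fin e) ℝ) (u : Fin e → ℝ) :
    minors B (-(u ᵥ* B)) = B.det • (Fin.snoc (α := fun _ => ℝ) u 1 : Fin (e + 1) → ℝ) := by
  ext i
  refine Fin.lastCases ?_ (fun i => ?_) i
  · simp
  · simp [Matrix.neg_vecMul, Matrix.vecMul_vecMul, Matrix.mul_adjugate, Matrix.vecMul_smul]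

lemma integral_neg_vecMul {B : Matrix (Fin e) (Fin e) ℝ} (hB : B.det ≠ 0) {F : (Fin e → ℝ) → ℝ}
    (hF : Continuous F) : |B.det| * ∫ u, F (-(u ᵥ* B)) = ∫ r, F r := by
  have h := integral_comp_toLin' (M := -Bᵀ) (by
    rw [Matrix.det_neg, Matrix.det_transpose]; exact mul_ne_zero (by simp) hB) hF
  rw [Matrix.det_neg, Matrix.det_transpose, abs_mul, abs_pow, abs_neg, abs_one, one_pow,
    one_mul] at h
  rw [← h]
  simp only [Matrix.neg_mulVec, Matrix.mulVec_transpose]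

lemma integral_block {g : (BlockIdx e → ℝ) → ℝ} (hg : Integrable g) :
    ∫ x, g x = ∫ b : Fin e × Fin e → ℝ, ∫ r : Fin e → ℝ, g (Sum.elim b r) := by
  have hmp := volume_measurePreserving_sumPiEquivProdPi_symm (fun _ : BlockIdx e => ℝ)
  rw [← hmp.integral_comp']
  have hint := (hmp.integrable_comp_emb (MeasurableEquiv.measurableEmbedding _) (g := g)).2 hg
  refine (integral_prod _ hint).trans ?_
  rfl

lemma integral_block_symm {g : (BlockIdx e → ℝ) → ℝ} (hg : Integrable g) :
    ∫ b : Fin e × Fin e → ℝ, ∫ r : Fin e → ℝ, g (Sum.elim b r) =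
      ∫ r : Fin e → ℝ, ∫ b : Fin e × Fin e → ℝ, g (Sum.elim b r) := by
  have hmp := volume_measurePreserving_sumPiEquivProdPi_symm (fun _ : BlockIdx e => ℝ)
  have hint := (hmp.integrable_comp_emb (MeasurableEquiv.measurableEmbedding _) (g := g)).2 hg
  exact integral_integral_swap (f := fun b r => g (Sum.elim b r)) hint

lemma integrable_of_bounded_coords {ι : Type*} [Fintype ι] {g : (ι → ℝ) → ℝ} (hg : Continuous g)
    {Y : ℝ} (hY : ∀ x, g x ≠ 0 → ∀ i, |x i| ≤ Y) : Integrable g := by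
  refine hg.integrable_of_hasCompactSupport (HasCompactSupport.intro
    (K := Set.pi Set.univ fun _ => Set.Icc (-Y) Y) (isCompact_univ_pi fun _ => isCompact_Icc) ?_)
  intro x hx
  by_contra h
  exact hx fun i _ => abs_le.1 (hY x h i)

variable [NeZero e]

lemma mul_toSL (h : SLR e) {A : Matrix (Fin e) (Fin e) ℝ} (hA : 0 < A.det) :
    h * toSL A = toSL (h.1 * A) := by
  rw [toSL_mul (by rw [h.2]; exact one_pos) hA, toSL_coe]

/-- The integrand `testFlat` after the substitution `r = -(u ᵥ* B)`, with its Jacobian. -/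
def testSubst (φ : SLR e → ℝ) (w : (Fin (e + 1) → ℝ) → ℝ) (x : BlockIdx e → ℝ) : ℝ :=
  (blockMat x).det * testFn φ w (blockMat x) (-(blockRow x ᵥ* blockMat x))

lemma continuous_testSubst (φ : C_c(SLR e, ℝ)) {w : (Fin (e + 1) → ℝ) → ℝ} (hwc : Continuous w)
    {η : ℝ} (hη : 0 < η) (hw : ∀ x, w x ≠ 0 → ∀ i, η ≤ x i) : Continuous (testSubst φ w) := by
  have hB : Continuous fun x : BlockIdx e → ℝ => blockMat x :=
    continuous_matrix fun i j => continuous_apply _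
  have hr : Continuous fun x : BlockIdx e → ℝ => blockRow x :=
    continuous_pi fun j => continuous_apply _
  refine hB.matrix_det.mul ?_
  refine (continuous_testFlat φ hwc hη hw).comp (g := testFlat φ w) (f := fun x : BlockIdx e → ℝ =>
    (Sum.elim (fun q => x (Sum.inl q)) (-(blockRow x ᵥ* blockMat x)) : BlockIdx e → ℝ)) ?_
  refine continuous_pi fun i => ?_
  rcases i with q | j
  · exact continuous_apply _
  · exact (continuous_apply j).comp (hr.matrix_vecMul hB).neg

lemma testSubst_ne_zero {φ : SLR e → ℝ} {w : (Fin (e + 1) → ℝ) → ℝ} {η y : ℝ} (hη : 0 < η)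
    (hw : ∀ x, w x ≠ 0 → ∀ i, η ≤ x i ∧ x i ≤ y) {x : BlockIdx e → ℝ} (hx : testSubst φ w x ≠ 0) :
    η ≤ (blockMat x).det ∧ ∀ i, 0 < blockRow x i ∧ blockRow x i ≤ y / η := by
  have h := hw _ (left_ne_zero_of_mul (right_ne_zero_of_mul hx))
  rw [minors_neg_vecMul] at h
  have h1 := h (Fin.last e)
  simp only [Pi.smul_apply, Fin.snoc_last, smul_eq_mul, mul_one] at h1
  refine ⟨h1.1, fun i => ?_⟩
  have h2 := h i.castSucc
  simp only [Pi.smul_apply, Fin.snoc_castSucc, smul_eq_mul] at h2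
  have hd : 0 < (blockMat x).det := hη.trans_le h1.1
  have hp : 0 < blockRow x i := pos_of_mul_pos_right (hη.trans_le h2.1) hd.le
  refine ⟨hp, ?_⟩
  rw [le_div_iff₀ hη]
  nlinarith

lemma integrable_testFlat (φ : C_c(SLR e, ℝ)) {w : (Fin (e + 1) → ℝ) → ℝ} (hwc : Continuous w)
    {η y : ℝ} (hη : 0 < η) (hw : ∀ x, w x ≠ 0 → ∀ i, η ≤ x i ∧ x i ≤ y) :
    Integrable (testFlat φ w) := by
  obtain ⟨Y, hY⟩ := exists_support_testFlat φ hη hw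
  exact integrable_of_bounded_coords (continuous_testFlat φ hwc hη fun x hx i => (hw x hx i).1) hY

lemma integrable_testSubst (φ : C_c(SLR e, ℝ)) {w : (Fin (e + 1) → ℝ) → ℝ} (hwc : Continuous w)
    {η y : ℝ} (hη : 0 < η) (hw : ∀ x, w x ≠ 0 → ∀ i, η ≤ x i ∧ x i ≤ y) :
    Integrable (testSubst φ w) := by
  obtain ⟨Y, hY⟩ := exists_support_testFlat φ hη hw
  refine integrable_of_bounded_coords (Y := max Y (y / η))
    (continuous_testSubst φ hwc hη fun x hx i => (hw x hx i).1) fun x hx i => ?_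
  rcases i with q | j
  · exact (hY (Sum.elim (fun q => x (Sum.inl q)) (-(blockRow x ᵥ* blockMat x)))
      (right_ne_zero_of_mul hx) (Sum.inl q)).trans (le_max_left _ _)
  · have := (testSubst_ne_zero hη hw hx).2 j
    exact (abs_of_pos this.1).le.trans (this.2.trans (le_max_right _ _))

lemma integral_testFlat_eq (φ : C_c(SLR e, ℝ)) {w : (Fin (e + 1) → ℝ) → ℝ} (hwc : Continuous w)
    {η y : ℝ} (hη : 0 < η) (hw : ∀ x, w x ≠ 0 → ∀ i, η ≤ x i ∧ x i ≤ y) :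
    ∫ x, testFlat φ w x = ∫ u : Fin e → ℝ, ∫ b : Fin e × Fin e → ℝ,
      testSubst φ w (Sum.elim b u) := by
  rw [← integral_block_symm (integrable_testSubst φ hwc hη hw),
    integral_block (integrable_testFlat φ hwc hη hw)]
  refine integral_congr_ae (Eventually.of_forall fun b => ?_)
  have hcont : Continuous fun r : Fin e → ℝ => testFlat φ w (Sum.elim b r) := by
    refine (continuous_testFlat φ hwc hη fun x hx i => (hw x hx i).1).comp
      (continuous_pi fun i => ?_)
    rcases i with q | j
    · exact continuous_const
    · exact continuous_apply j
  by_cases hdet : 0 < (entryMat b).det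
  · simp only
    rw [← integral_neg_vecMul hdet.ne' hcont, abs_of_pos hdet, ← integral_const_mul]
    rfl
  · have h1 : ∀ r : Fin e → ℝ, testFlat φ w (Sum.elim b r) = 0 := by
      intro r
      by_contra h
      have h1 := (hw _ (left_ne_zero_of_mul (a := w _) (b := φ _) h) (Fin.last e)).1
      rw [minors_last] at h1
      exact hdet (hη.trans_le h1)
    have h2 : ∀ u : Fin e → ℝ, testSubst φ w (Sum.elim b u) = 0 := by
      intro u
      by_contra h
      exact hdet (hη.trans_le (testSubst_ne_zero hη hw h).1)
    simp only [h1, h2]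

lemma integral_testFlat_mul_left (h : SLR e) {φ ψ : C_c(SLR e, ℝ)} (hψ : ∀ g, ψ g = φ (h * g))
    {w : (Fin (e + 1) → ℝ) → ℝ} (hwc : Continuous w)
    {η y : ℝ} (hη : 0 < η) (hw : ∀ x, w x ≠ 0 → ∀ i, η ≤ x i ∧ x i ≤ y) :
    ∫ x, testFlat ψ w x = ∫ x, testFlat φ w x := by
  rw [integral_testFlat_eq φ hwc hη hw, integral_testFlat_eq ψ hwc hη hw]
  refine integral_congr_ae (Eventually.of_forall fun u => ?_)
  simp only
  by_cases hu : ∀ i, 0 < u i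
  · set k : Matrix (Fin e) (Fin e) ℝ :=
      Matrix.diagonal (fun i => (u i)⁻¹) * h.1 * Matrix.diagonal u with hk
    have hD : Matrix.diagonal u * Matrix.diagonal (fun i => (u i)⁻¹) = 1 := by
      rw [Matrix.diagonal_mul_diagonal, ← Matrix.diagonal_one]
      congr 1
      ext i
      exact mul_inv_cancel₀ (hu i).ne'
    have hDk : Matrix.diagonal u * k = h.1 * Matrix.diagonal u := by
      rw [hk, ← Matrix.mul_assoc, ← Matrix.mul_assoc, hD, Matrix.one_mul]
    have hkdet : k.det = 1 := by
      have h1 := congrArg Matrix.det hDk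
      rw [Matrix.det_mul (Matrix.diagonal u) k, Matrix.det_mul h.1, h.2, one_mul,
        Matrix.det_diagonal] at h1
      exact mul_left_cancel₀ (Finset.prod_pos fun i _ => hu i).ne' (h1.trans (mul_one _).symm)
    have hG : Continuous fun B : Matrix (Fin e) (Fin e) ℝ =>
        testSubst φ w (Sum.elim (fun q => B q.1 q.2) u) := by
      refine (continuous_testSubst φ hwc hη fun x hx i => (hw x hx i).1).comp
        (continuous_pi fun i => ?_)
      rcases i with q | j
      · exact continuous_id.matrix_elem _ _
      · exact continuous_const
    refine Eq.trans ?_ (integral_entryMat_mul hkdet hG)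
    refine integral_congr_ae (Eventually.of_forall fun b => ?_)
    change (entryMat b).det * (w (minors (entryMat b) (-(u ᵥ* entryMat b))) *
      ψ (shape (entryMat b) (-(u ᵥ* entryMat b)))) = (k * entryMat b).det *
      (w (minors (k * entryMat b) (-(u ᵥ* (k * entryMat b)))) *
      φ (shape (k * entryMat b) (-(u ᵥ* (k * entryMat b)))))
    rw [shape, shape, minors_neg_vecMul, minors_neg_vecMul, Matrix.det_mul, hkdet, one_mul]
    congr 1
    by_cases h0 : w ((entryMat b).det • (Fin.snoc (α := fun _ => ℝ) u 1 : Fin (e + 1) → ℝ)) = 0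
    · rw [h0, zero_mul, zero_mul]
    congr 1
    have hdet : 0 < (entryMat b).det := by
      have := (hw _ h0 (Fin.last e)).1
      simp only [Pi.smul_apply, Fin.snoc_last, smul_eq_mul, mul_one] at this
      exact hη.trans_le this
    have hdiag : (Matrix.diagonal fun i : Fin e => ((entryMat b).det •
        (Fin.snoc (α := fun _ => ℝ) u 1 : Fin (e + 1) → ℝ)) i.castSucc) =
        (entryMat b).det • Matrix.diagonal u := by
      ext i j
      simp [Matrix.diagonal_apply]
    rw [hψ, hdiag, mul_toSL]
    · congr 2
      rw [Matrix.smul_mul, Matrix.mul_smul, Matrix.smul_mul, ← Matrix.mul_assoc, ← Matrix.mul_assoc,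
        hDk]
    · rw [Matrix.smul_mul, Matrix.det_smul, Matrix.det_mul, Matrix.det_diagonal]
      have := Finset.prod_pos fun i (_ : i ∈ Finset.univ) => hu i
      positivity
  · have : ∀ (χ : SLR e → ℝ) b, testSubst χ w (Sum.elim b u) = 0 := by
      intro χ b
      by_contra hne
      exact hu fun i => ((testSubst_ne_zero hη hw hne).2 i).1
    simp only [this]

/-- Equidistribution of the weighted lattices of primitive vectors, up to the value of the
constant. -/
theorem exists_tendsto_primSum (μ : Measure (XQuot e)) [IsProbabilityMeasure μ]
    (hinv : ∀ g : SLR e, Measure.map (fun x => g • x) μ = μ)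
    {w : (Fin (e + 1) → ℝ) → ℝ} {η y Cw : ℝ} (hwc : Continuous w) (hw0 : ∀ x, 0 ≤ w x)
    (hCw : ∀ x, w x ≤ Cw) (hη : 0 < η) (hy : 0 ≤ y) (hw : ∀ x, w x ≠ 0 → ∀ i, η ≤ x i ∧ x i ≤ y) :
    ∃ κ : ℝ, 0 ≤ κ ∧ ∀ φ : C_c(SLR e, ℝ), (∀ g, 0 ≤ φ g) →
      Tendsto (fun T => primSum φ w T / T ^ (e + 1)) atTop (𝓝 (κ * ∫ x, quotSum φ x ∂μ)) := by
  obtain ⟨δ, hδ0, hδ⟩ := exists_density_primSum e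
  obtain ⟨c, hc0, hc⟩ := exists_integral_haar_eq μ hinv
  obtain ⟨c', hc'0, hc'⟩ := exists_eq_mul_integral_haar (e := e)
    (fun φ => ∫ x, testFlat φ w x) (fun φ ψ => by
      rw [← integral_add (integrable_testFlat φ hwc hη hw) (integrable_testFlat ψ hwc hη hw)]
      refine integral_congr_ae (Eventually.of_forall fun x => ?_)
      exact mul_add _ _ _)
    (fun a φ => by
      rw [← integral_const_mul]
      refine integral_congr_ae (Eventually.of_forall fun x => ?_)
      exact mul_left_comm _ _ _)
    (fun φ hφ => integral_nonneg fun x => testFlat_nonneg hφ hw0 x)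
    (fun h φ ψ hψ => integral_testFlat_mul_left h hψ hwc hη hw)
  refine ⟨δ * (c' * c), by positivity, fun φ hφ => ?_⟩
  have := hδ φ w η y Cw hφ hwc hw0 hCw hη hy hw
  rwa [hc', hc, ← mul_assoc, ← mul_assoc, mul_assoc δ] at this

end Invariance

section LevelSets

open Filter Topology CompactlySupported

variable {e : ℕ}

lemma mk_mul_castSL (g : SLR e) (γ : Matrix.SpecialLinearGroup (Fin e) ℤ) :
    (QuotientGroup.mk (g * castSL γ) : XQuot e) = QuotientGroup.mk g := by
  rw [QuotientGroup.eq]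
  simp only [_root_.mul_inv_rev, inv_mul_cancel_right]
  exact inv_mem ⟨γ, rfl⟩

/-- The product of a continuous function on `XQuot e` and a compactly supported function. -/
def mulQuot (f : XQuot e → ℝ) (hf : Continuous f) (φ : C_c(SLR e, ℝ)) : C_c(SLR e, ℝ) :=
  mulCc (fun g => f (QuotientGroup.mk g)) (hf.comp continuous_quot_mk) φ

@[simp] lemma mulQuot_apply (f : XQuot e → ℝ) (hf : Continuous f) (φ : C_c(SLR e, ℝ)) (g : SLR e) :
    mulQuot f hf φ g = f (QuotientGroup.mk g) * φ g := rfl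

lemma orbitSum_mulQuot (f : XQuot e → ℝ) (hf : Continuous f) (φ : C_c(SLR e, ℝ)) (g : SLR e) :
    orbitSum (mulQuot f hf φ) g = f (QuotientGroup.mk g) * orbitSum φ g :=
  orbitSum_mulCc _ _ (fun g γ => by rw [mk_mul_castSL]) φ g

lemma quotSum_mulQuot (f : XQuot e → ℝ) (hf : Continuous f) (φ : C_c(SLR e, ℝ)) (x : XQuot e) :
    quotSum (mulQuot f hf φ) x = f x * quotSum φ x := by
  obtain ⟨g, rfl⟩ := QuotientGroup.mk_surjective x
  exact orbitSum_mulQuot f hf φ g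

variable [NeZero e]

/-- A bump function of the determinant times the value at the normalized matrix. -/
def detBump (φ : SLR e → ℝ) (b : Fin e × Fin e → ℝ) : ℝ :=
  max 0 (1 - 2 * |(entryMat b).det - 1|) * φ (toSL (entryMat b))

lemma det_mem_of_detBump_ne_zero {φ : SLR e → ℝ} {b : Fin e × Fin e → ℝ} (h : detBump φ b ≠ 0) :
    1 / 2 < (entryMat b).det ∧ (entryMat b).det < 3 / 2 := by
  have h1 := left_ne_zero_of_mul h
  have h2 : |(entryMat b).det - 1| < 1 / 2 := by
    by_contra! h3
    exact h1 (max_eq_left (by linarith))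
  rw [abs_lt] at h2
  constructor <;> linarith

lemma continuous_detBump (φ : C_c(SLR e, ℝ)) : Continuous (detBump φ) := by
  rw [continuous_iff_continuousAt]
  intro b
  have hdet : Continuous fun b : Fin e × Fin e → ℝ => (entryMat b).det :=
    continuous_entryMat.matrix_det
  by_cases hb : 0 < (entryMat b).det
  · refine ContinuousAt.mul
      (continuous_const.max (continuous_const.sub
        (continuous_const.mul (hdet.sub continuous_const).abs))).continuousAt ?_
    refine φ.continuous.continuousAt.comp ?_
    have hopen : IsOpen {A : Matrix (Fin e) (Fin e) ℝ | 0 < A.det} :=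
      isOpen_lt continuous_const (continuous_id.matrix_det)
    exact (continuousOn_toSL.continuousAt (hopen.mem_nhds hb)).comp continuous_entryMat.continuousAt
  · have h0 : ∀ᶠ z in 𝓝 b, detBump φ z = 0 := by
      filter_upwards [hdet.continuousAt.eventually_lt continuousAt_const
        (show (entryMat b).det < 1 / 2 by linarith)] with z hz
      by_contra h
      exact absurd (det_mem_of_detBump_ne_zero h).1 (not_lt.2 hz.le)
    exact continuousAt_const.congr (h0.mono fun z hz => hz.symm)

lemma exists_support_detBump (φ : C_c(SLR e, ℝ)) :
    ∃ Y : ℝ, ∀ b, detBump φ b ≠ 0 → ∀ i, |b i| ≤ Y := by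
  obtain ⟨C, hC0, hC⟩ := exists_bound_entries φ
  refine ⟨(3 / 2) ^ (1 / (e : ℝ)) * C, fun b hb q => ?_⟩
  obtain ⟨h1, h2⟩ := det_mem_of_detBump_ne_zero hb
  have hdet : 0 < (entryMat b).det := by linarith
  have h3 := hC _ (right_ne_zero_of_mul hb) q.1 q.2
  rw [coe_toSL hdet, Matrix.smul_apply, smul_eq_mul, Real.rpow_neg hdet.le, abs_mul,
    abs_of_pos (inv_pos.2 (Real.rpow_pos_of_pos hdet _)),
    inv_mul_le_iff₀ (Real.rpow_pos_of_pos hdet _)] at h3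
  refine le_trans h3 (mul_le_mul_of_nonneg_right ?_ hC0)
  exact Real.rpow_le_rpow hdet.le h2.le (by positivity)

lemma integrable_detBump (φ : C_c(SLR e, ℝ)) : Integrable (detBump φ) := by
  obtain ⟨Y, hY⟩ := exists_support_detBump φ
  exact integrable_of_bounded_coords (continuous_detBump φ) hY

lemma detBump_nonneg {φ : SLR e → ℝ} (hφ : ∀ g, 0 ≤ φ g) (b : Fin e × Fin e → ℝ) :
    0 ≤ detBump φ b := mul_nonneg (le_max_left _ _) (hφ _)

lemma integral_detBump_mul_left (h : SLR e) {φ ψ : C_c(SLR e, ℝ)} (hψ : ∀ g, ψ g = φ (h * g)) :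
    ∫ b, detBump ψ b = ∫ b, detBump φ b := by
  have hG : Continuous fun B : Matrix (Fin e) (Fin e) ℝ => detBump φ fun q => B q.1 q.2 :=
    (continuous_detBump φ).comp (continuous_pi fun q => continuous_id.matrix_elem _ _)
  refine Eq.trans ?_ (integral_entryMat_mul h.2 hG)
  refine integral_congr_ae (Eventually.of_forall fun b => ?_)
  change max 0 (1 - 2 * |(entryMat b).det - 1|) * ψ (toSL (entryMat b)) =
    max 0 (1 - 2 * |(h.1 * entryMat b).det - 1|) * φ (toSL (h.1 * entryMat b))
  rw [Matrix.det_mul h.1, h.2, one_mul]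
  by_cases h0 : max 0 (1 - 2 * |(entryMat b).det - 1|) = 0
  · rw [h0, zero_mul, zero_mul]
  · have hdet : 0 < (entryMat b).det := by
      by_contra hneg
      refine h0 (max_eq_left ?_)
      have := neg_abs_le ((entryMat b).det - 1)
      linarith
    rw [hψ, mul_toSL h hdet]

lemma exists_integral_quotSum_eq_detBump (μ : Measure (XQuot e)) [IsProbabilityMeasure μ]
    (hinv : ∀ g : SLR e, Measure.map (fun x => g • x) μ = μ) :
    ∃ c : ℝ, 0 ≤ c ∧ ∀ φ : C_c(SLR e, ℝ), ∫ x, quotSum φ x ∂μ = c * ∫ b, detBump φ b := by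
  obtain ⟨c, hc0, hc⟩ := exists_integral_haar_eq μ hinv
  obtain ⟨c', hc'0, hc'⟩ := exists_eq_mul_integral_haar (e := e)
    (fun φ => ∫ b, detBump φ b) (fun φ ψ => by
      rw [← integral_add (integrable_detBump φ) (integrable_detBump ψ)]
      refine integral_congr_ae (Eventually.of_forall fun x => ?_)
      exact mul_add _ _ _)
    (fun a φ => by
      rw [← integral_const_mul]
      refine integral_congr_ae (Eventually.of_forall fun x => ?_)
      exact mul_left_comm _ _ _)
    (fun φ hφ => integral_nonneg fun x => detBump_nonneg hφ x)
    (fun h φ ψ hψ => integral_detBump_mul_left h hψ)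
  have hc'pos : c' ≠ 0 := by
    rintro rfl
    have h1 := hc' (cutoff e 1)
    obtain ⟨Y, hY⟩ := exists_support_detBump (cutoff e 1)
    have hone : entryMat (fun q : Fin e × Fin e => (1 : Matrix (Fin e) (Fin e) ℝ) q.1 q.2) = 1 := rfl
    have h2 : 0 < ∫ b, detBump (cutoff e 1) b := by
      refine (continuous_detBump (cutoff e 1)).integral_pos_of_hasCompactSupport_nonneg_nonzero
        (x := fun q => (1 : Matrix (Fin e) (Fin e) ℝ) q.1 q.2)
        (HasCompactSupport.intro (K := Set.pi Set.univ fun _ => Set.Icc (-Y) Y)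
          (isCompact_univ_pi fun _ => isCompact_Icc) fun x hx => ?_)
        (fun b => detBump_nonneg (cutoff_nonneg 1) b) ?_
      · by_contra h
        exact hx fun i _ => abs_le.1 (hY x h i)
      · rw [detBump, hone, Matrix.det_one]
        have h3 : toSL (1 : Matrix (Fin e) (Fin e) ℝ) = 1 := toSL_coe (1 : SLR e)
        rw [h3]
        refine mul_ne_zero (by norm_num) (cutoff_pos fun i j => ?_).ne'
        change |(1 : Matrix (Fin e) (Fin e) ℝ) i j| ≤ _
        rw [Matrix.one_apply]
        split_ifs <;> simp
    rw [zero_mul] at h1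
    exact h2.ne' h1
  refine ⟨(c' * c)⁻¹, by positivity, fun φ => ?_⟩
  rw [hc', hc, ← mul_assoc c' c, inv_mul_cancel_left₀ (mul_ne_zero hc'pos hc0.ne')]

/-- A level set of a continuous function on the space of lattices is null if it is null for Lebesgue
measure on the space of matrices. -/
theorem measure_level_eq_zero (μ : Measure (XQuot e)) [IsProbabilityMeasure μ]
    (hinv : ∀ g : SLR e, Measure.map (fun x => g • x) μ = μ) {f : XQuot e → ℝ} (hf : Continuous f)
    {R : ℝ} (hnull : volume {b : Fin e × Fin e → ℝ | 0 < (entryMat b).det ∧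
      f (QuotientGroup.mk (toSL (entryMat b))) = R} = 0) : μ {x | f x = R} = 0 := by
  obtain ⟨c, hc0, hc⟩ := exists_integral_quotSum_eq_detBump μ hinv
  set θ : ℕ → ℝ → ℝ := fun k s => max 0 (1 - k * |s - R|) with hθ
  have hθc : ∀ k, Continuous (fun x => θ k (f x)) := fun k => by simp only [hθ]; fun_prop
  have hθ0 : ∀ k s, 0 ≤ θ k s := fun k s => le_max_left _ _
  have hθ1 : ∀ k s, θ k s ≤ 1 := fun k s =>
    max_le zero_le_one (by have : 0 ≤ (k : ℝ) * |s - R| := by positivity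
                           linarith)
  have hE : MeasurableSet {x | f x = R} := (isClosed_eq hf continuous_const).measurableSet
  have hzero : ∀ n, ∫ x in {x | f x = R}, quotSum (cutoff e n) x ∂μ = 0 := by
    intro n
    have hJ : Tendsto (fun k => ∫ b, detBump (mulQuot (fun x => θ k (f x)) (hθc k) (cutoff e n)) b)
        atTop (𝓝 0) := by
      rw [← integral_zero (Fin e × Fin e → ℝ) ℝ]
      refine tendsto_integral_of_dominated_convergence (detBump (cutoff e n))
        (fun k => (continuous_detBump _).aestronglyMeasurable) (integrable_detBump _)
        (fun k => Eventually.of_forall fun b => ?_) ?_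
      · have hnn : ∀ g, 0 ≤ mulQuot (fun x => θ k (f x)) (hθc k) (cutoff e n) g := fun g =>
          mul_nonneg (hθ0 _ _) (cutoff_nonneg _ _)
        rw [Real.norm_of_nonneg (detBump_nonneg hnn b)]
        refine mul_le_mul_of_nonneg_left ?_ (le_max_left _ _)
        exact mul_le_of_le_one_left (cutoff_nonneg _ _) (hθ1 _ _)
      · have hae : ∀ᵐ b : Fin e × Fin e → ℝ, ¬ (0 < (entryMat b).det ∧
            f (QuotientGroup.mk (toSL (entryMat b))) = R) := by
          rw [ae_iff]; simpa only [not_not] using hnull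
        filter_upwards [hae] with b hb
        by_cases hdet : 0 < (entryMat b).det
        · have hne : f (QuotientGroup.mk (toSL (entryMat b))) ≠ R := fun h => hb ⟨hdet, h⟩
          have habs : 0 < |f (QuotientGroup.mk (toSL (entryMat b))) - R| :=
            abs_pos.2 (sub_ne_zero.2 hne)
          refine tendsto_const_nhds.congr' ?_
          obtain ⟨K, hK⟩ := exists_nat_gt (|f (QuotientGroup.mk (toSL (entryMat b))) - R|)⁻¹
          filter_upwards [eventually_ge_atTop K] with k hk
          have h1 : θ k (f (QuotientGroup.mk (toSL (entryMat b)))) = 0 := by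
            refine max_eq_left ?_
            have h2 : (K : ℝ) ≤ k := by exact_mod_cast hk
            have h3 : 1 < (K : ℝ) * |f (QuotientGroup.mk (toSL (entryMat b))) - R| := by
              rwa [inv_lt_iff_one_lt_mul₀ habs] at hK
            nlinarith
          rw [detBump, mulQuot_apply, h1, zero_mul, mul_zero]
        · have : ∀ φ : C_c(SLR e, ℝ), detBump φ b = 0 := fun φ => by
            by_contra h
            have := (det_mem_of_detBump_ne_zero h).1
            exact hdet (by linarith)
          simp only [this]
          exact tendsto_const_nhds
    have hub : ∀ k, ∫ x in {x | f x = R}, quotSum (cutoff e n) x ∂μ ≤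
        c * ∫ b, detBump (mulQuot (fun x => θ k (f x)) (hθc k) (cutoff e n)) b := by
      intro k
      rw [← hc, ← integral_indicator hE]
      refine integral_mono ((integrable_quotSum _ μ).indicator hE) (integrable_quotSum _ μ) fun x => ?_
      simp only [quotSum_mulQuot]
      by_cases hx : f x = R
      · rw [Set.indicator_of_mem (by exact hx)]
        simp [hθ, hx]
      · rw [Set.indicator_of_notMem (by exact hx)]
        exact mul_nonneg (hθ0 _ _) (quotSum_cutoff_nonneg _ _)
    refine le_antisymm ?_ (integral_nonneg fun x => quotSum_cutoff_nonneg _ _)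
    simpa using ge_of_tendsto' (hJ.const_mul c) hub
  have hlim := tendsto_integral_of_dominated_convergence (μ := μ.restrict {x | f x = R})
    (fun _ => (1 : ℝ)) (F := fun n x => quotSum (cutoff e n) x) (f := fun _ => 1)
    (fun n => (continuous_quotSum _).aestronglyMeasurable) (integrable_const _)
    (fun n => Eventually.of_forall fun x => by
      rw [Real.norm_of_nonneg (quotSum_cutoff_nonneg _ _)]; exact quotSum_cutoff_le _ _)
    (Eventually.of_forall fun x => tendsto_quotSum_cutoff x)
  simp only [hzero] at hlim
  have h1 := tendsto_nhds_unique hlim tendsto_const_nhds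
  rw [integral_const, smul_eq_mul, mul_one, Measure.real, Measure.restrict_apply_univ] at h1
  exact ((ENNReal.toReal_eq_zero_iff _).1 h1).resolve_right (measure_ne_top _ _)

end LevelSets

section CoveringRadius

open Filter Topology

variable {e : ℕ}

lemma abs_mulVec_le (A : Matrix (Fin e) (Fin e) ℝ) (u : Fin e → ℝ) (i : Fin e) :
    |(A *ᵥ u) i| ≤ ∑ j, |A i j * u j| :=
  Finset.abs_sum_le_sum_abs (fun j => A i j * u j) Finset.univ

lemma coe_mul_coe_inv (g : SLR e) : g.1 * g⁻¹.1 = 1 :=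
  congrArg Subtype.val (mul_inv_cancel g)

lemma coe_inv_mul_coe (g : SLR e) : g⁻¹.1 * g.1 = 1 :=
  congrArg Subtype.val (inv_mul_cancel g)

/-- Every point lies within a translate by the lattice `M·ℤ^e` of the simplex of size `t`. -/
def Covers (M : Matrix (Fin e) (Fin e) ℝ) (t : ℝ) : Prop :=
  ∀ x : Fin e → ℝ, ∃ v : Fin e → ℤ,
    (∀ i, (M *ᵥ fun j => (v j : ℝ)) i ≤ x i) ∧ ∑ i, (x i - (M *ᵥ fun j => (v j : ℝ)) i) ≤ t

lemma Covers.mono {M : Matrix (Fin e) (Fin e) ℝ} {s t : ℝ} (h : Covers M s) (hst : s ≤ t) :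
    Covers M t := fun x => by
  obtain ⟨v, h1, h2⟩ := h x
  exact ⟨v, h1, h2.trans hst⟩

lemma covRad_matLattice (M : Matrix (Fin e) (Fin e) ℝ) :
    covRad e (simplexStd e) (matLattice M) = sInf {t : ℝ | 0 < t ∧ Covers M t} := by
  unfold covRad
  congr 1
  ext t
  refine and_congr_right fun ht => forall_congr' fun x => ⟨?_, ?_⟩
  · rintro ⟨k, ⟨hk0, hk1⟩, l, ⟨v, rfl⟩, rfl⟩
    refine ⟨v, fun i => ?_, ?_⟩
    · simpa using mul_nonneg ht.le (hk0 i)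
    · simp only [Pi.add_apply, Pi.smul_apply, smul_eq_mul, add_sub_cancel_right, ← Finset.mul_sum]
      exact mul_le_of_le_one_right ht.le hk1
  · rintro ⟨v, h1, h2⟩
    refine ⟨t⁻¹ • (x - M *ᵥ fun j => (v j : ℝ)), ⟨fun i => ?_, ?_⟩, _, ⟨v, rfl⟩, ?_⟩
    · simpa using mul_nonneg (inv_nonneg.2 ht.le) (sub_nonneg.2 (h1 i))
    · simp only [Pi.smul_apply, Pi.sub_apply, smul_eq_mul, ← Finset.mul_sum]
      rwa [inv_mul_le_iff₀ ht, mul_one]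
    · rw [smul_smul, mul_inv_cancel₀ ht.ne', one_smul, sub_add_cancel]

/-- The covering radius of the standard simplex with respect to the lattice of `g`. -/
def covSL (g : SLR e) : ℝ := covRad e (simplexStd e) (latticeOf g)

lemma covSL_eq (g : SLR e) : covSL g = sInf {t : ℝ | 0 < t ∧ Covers g.1 t} :=
  covRad_matLattice _

lemma bddBelow_covers (M : Matrix (Fin e) (Fin e) ℝ) : BddBelow {t : ℝ | 0 < t ∧ Covers M t} :=
  ⟨0, fun _ ht => ht.1.le⟩

lemma covSL_nonneg (g : SLR e) : 0 ≤ covSL g := by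
  rw [covSL_eq]
  exact Real.sInf_nonneg fun t ht => ht.1.le

lemma covSL_le {g : SLR e} {t : ℝ} (ht : 0 < t) (h : Covers g.1 t) : covSL g ≤ t := by
  rw [covSL_eq]
  exact csInf_le (bddBelow_covers _) ⟨ht, h⟩

lemma exists_covers (g : SLR e) : ∃ t : ℝ, 0 < t ∧ Covers g.1 t := by
  set C : ℝ := ∑ i, ∑ j, |g.1 i j|
  have hC : ∀ (u : Fin e → ℝ), (∀ j, |u j| ≤ 1) → ∀ i, |(g.1 *ᵥ u) i| ≤ C := by
    intro u hu i
    calc |(g.1 *ᵥ u) i| ≤ ∑ j, |g.1 i j * u j| := abs_mulVec_le _ _ _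
      _ ≤ ∑ j, |g.1 i j| := Finset.sum_le_sum fun j _ => by
          rw [abs_mul]; exact mul_le_of_le_one_right (abs_nonneg _) (hu j)
      _ ≤ C := Finset.single_le_sum (f := fun i => ∑ j, |g.1 i j|)
          (fun i _ => Finset.sum_nonneg fun j _ => abs_nonneg _) (Finset.mem_univ i)
  refine ⟨e * (2 * C) + 1, ?_, fun x => ?_⟩
  · have : 0 ≤ C := Finset.sum_nonneg fun i _ => Finset.sum_nonneg fun j _ => abs_nonneg _
    positivity
  set u := g⁻¹.1 *ᵥ fun i => x i - C
  have hgu : g.1 *ᵥ u = fun i => x i - C := by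
    rw [Matrix.mulVec_mulVec, coe_mul_coe_inv, Matrix.one_mulVec]
  have hv : ∀ i, x i - (g.1 *ᵥ fun j => ((⌊u j⌋ : ℤ) : ℝ)) i =
      C + (g.1 *ᵥ fun j => Int.fract (u j)) i := by
    intro i
    have h1 : (fun j => Int.fract (u j)) = u - fun j => ((⌊u j⌋ : ℤ) : ℝ) := rfl
    rw [h1, Matrix.mulVec_sub, hgu]
    simp only [Pi.sub_apply]
    ring
  have hb : ∀ i, |(g.1 *ᵥ fun j => Int.fract (u j)) i| ≤ C := hC _ fun j => by
    rw [abs_of_nonneg (Int.fract_nonneg _)]; exact (Int.fract_lt_one _).le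
  refine ⟨fun j => ⌊u j⌋, fun i => ?_, ?_⟩
  · rw [← sub_nonneg, hv]
    linarith [neg_abs_le ((g.1 *ᵥ fun j => Int.fract (u j)) i), hb i]
  · calc ∑ i, (x i - (g.1 *ᵥ fun j => ((⌊u j⌋ : ℤ) : ℝ)) i) ≤ ∑ i : Fin e, 2 * C :=
        Finset.sum_le_sum fun i _ => by
          rw [hv]; linarith [le_abs_self ((g.1 *ᵥ fun j => Int.fract (u j)) i), hb i]
      _ ≤ e * (2 * C) + 1 := by simp

lemma covers_of_covSL_lt {g : SLR e} {t : ℝ} (h : covSL g < t) : Covers g.1 t := by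
  rw [covSL_eq] at h
  obtain ⟨s, hs, hst⟩ := exists_lt_of_csInf_lt (exists_covers g) h
  exact hs.2.mono hst.le

lemma covSL_mul_castSL (g : SLR e) (γ : Matrix.SpecialLinearGroup (Fin e) ℤ) :
    covSL (g * castSL γ) = covSL g := by
  have key : ∀ (γ : Matrix.SpecialLinearGroup (Fin e) ℤ) (v : Fin e → ℤ),
      (castSL γ).1 *ᵥ (fun j => (v j : ℝ)) = fun j => (((γ.1 *ᵥ v) j : ℤ) : ℝ) := by
    intro γ v
    ext i
    simp [Matrix.mulVec, dotProduct, castSL_apply]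
  unfold covSL
  congr 1
  ext x
  constructor
  · rintro ⟨v, rfl⟩
    refine ⟨γ.1 *ᵥ v, ?_⟩
    rw [← key, Matrix.mulVec_mulVec]; rfl
  · rintro ⟨v, rfl⟩
    refine ⟨γ⁻¹.1 *ᵥ v, ?_⟩
    rw [← key, Matrix.mulVec_mulVec]
    have h1 : (g * castSL γ).1 * (castSL γ⁻¹).1 = g.1 := by
      have : g * castSL γ * castSL γ⁻¹ = g := by
        rw [mul_assoc, castSL, castSL, ← map_mul, mul_inv_cancel, map_one, mul_one]
      exact congrArg Subtype.val this
    rw [h1]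

lemma Covers.mul_left {h g : SLR e} {t η : ℝ} (ht : 0 < t) (hg : Covers g.1 t)
    (hη : ∀ i j, |h.1 i j - (1 : Matrix (Fin e) (Fin e) ℝ) i j| ≤ η) (hη1 : 2 * e * η ≤ 1)
    (hη0 : 0 ≤ η) : Covers (h * g).1 (t * (1 + 4 * e * η)) := by
  intro x
  set c : ℝ := 2 * η * t
  have hc : 0 ≤ c := by positivity
  obtain ⟨v, hv1, hv2⟩ := hg fun i => (h⁻¹.1 *ᵥ x) i - c
  set l := g.1 *ᵥ fun j => (v j : ℝ)
  set k : Fin e → ℝ := fun i => (h⁻¹.1 *ᵥ x) i - l i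
  have hk0 : ∀ i, 0 ≤ k i := fun i => by have := hv1 i; simp only [k]; linarith
  have hk1 : ∑ i, k i ≤ t + e * c := by
    have : ∑ i, k i = ∑ i, ((h⁻¹.1 *ᵥ x) i - c - l i) + ∑ i : Fin e, c := by
      rw [← Finset.sum_add_distrib]; exact Finset.sum_congr rfl fun i _ => by simp only [k]; ring
    rw [this]; simp only [Finset.sum_const, Finset.card_univ, Fintype.card_fin, nsmul_eq_mul]
    linarith
  have hkc : ∀ i, c ≤ k i := fun i => by have := hv1 i; simp only [k]; linarith
  have hx : ∀ i, x i - ((h * g).1 *ᵥ fun j => (v j : ℝ)) i =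
      k i + ((h.1 - 1) *ᵥ k) i := by
    intro i
    have h1 := coe_mul_coe_inv h
    have h2 : h.1 *ᵥ k = x - (h * g).1 *ᵥ fun j => (v j : ℝ) := by
      have : k = h⁻¹.1 *ᵥ x - l := rfl
      rw [this, Matrix.mulVec_sub, Matrix.mulVec_mulVec, h1, Matrix.one_mulVec,
        Matrix.mulVec_mulVec]
      rfl
    have h3 := congrFun h2 i
    simp only [Pi.sub_apply] at h3
    rw [← h3, Matrix.sub_mulVec, Matrix.one_mulVec]
    simp
  have hec : 2 * (e * c) ≤ 2 * t := by
    have : 2 * (e * c) = 2 * (2 * e * η) * t := by simp only [c]; ring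
    rw [this]; nlinarith
  have herr : ∀ i, |((h.1 - 1) *ᵥ k) i| ≤ c := by
    intro i
    calc |((h.1 - 1) *ᵥ k) i| ≤ ∑ j, |(h.1 - 1) i j * k j| := abs_mulVec_le _ _ _
      _ ≤ ∑ j, η * k j := Finset.sum_le_sum fun j _ => by
          rw [abs_mul, abs_of_nonneg (hk0 j)]
          exact mul_le_mul_of_nonneg_right (hη i j) (hk0 j)
      _ ≤ η * (t + e * c) := by rw [← Finset.mul_sum]; exact mul_le_mul_of_nonneg_left hk1 hη0
      _ ≤ c := by simp only [c] at hec ⊢; nlinarith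
  refine ⟨v, fun i => ?_, ?_⟩
  · rw [← sub_nonneg, hx]
    linarith [neg_abs_le (((h.1 - 1) *ᵥ k) i), herr i, hkc i]
  · calc ∑ i, (x i - ((h * g).1 *ᵥ fun j => (v j : ℝ)) i) ≤ ∑ i, (k i + c) :=
        Finset.sum_le_sum fun i _ => by
          rw [hx]; linarith [le_abs_self (((h.1 - 1) *ᵥ k) i), herr i]
      _ ≤ t + e * c + e * c := by
          rw [Finset.sum_add_distrib]
          simpa using hk1
      _ = t * (1 + 4 * e * η) := by simp only [c]; ring

lemma covSL_mul_le {h g : SLR e} {η : ℝ}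
    (hη : ∀ i j, |h.1 i j - (1 : Matrix (Fin e) (Fin e) ℝ) i j| ≤ η) (hη1 : 2 * e * η ≤ 1)
    (hη0 : 0 ≤ η) : covSL (h * g) ≤ covSL g * (1 + 4 * e * η) := by
  have h1 : ∀ t, covSL g < t → covSL (h * g) ≤ t * (1 + 4 * e * η) := fun t ht => by
    have ht0 := (covSL_nonneg g).trans_lt ht
    exact covSL_le (by positivity) ((covers_of_covSL_lt ht).mul_left ht0 hη hη1 hη0)
  have hpos : (0 : ℝ) < 1 + 4 * e * η := by positivity
  rw [← div_le_iff₀ hpos]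
  refine le_of_forall_gt_imp_ge_of_dense fun t ht => ?_
  rw [div_le_iff₀ hpos]
  exact h1 t ht

lemma continuous_covSL : Continuous (covSL : SLR e → ℝ) := by
  rw [continuous_iff_continuousAt]
  intro g
  set η : SLR e → ℝ := fun g' => ∑ i, ∑ j,
    (|(g' * g⁻¹).1 i j - (1 : Matrix (Fin e) (Fin e) ℝ) i j| +
      |(g * g'⁻¹).1 i j - (1 : Matrix (Fin e) (Fin e) ℝ) i j|) with hηdef
  have hηc : Continuous η := by
    refine continuous_finsetSum _ fun i _ => continuous_finsetSum _ fun j _ => ?_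
    have h1 : Continuous fun g' : SLR e => (g' * g⁻¹).1 i j :=
      (continuous_coe_SLR e).comp (continuous_id.mul continuous_const) |>.matrix_elem i j
    have h2 : Continuous fun g' : SLR e => (g * g'⁻¹).1 i j :=
      (continuous_coe_SLR e).comp (continuous_const.mul continuous_inv) |>.matrix_elem i j
    exact (h1.sub continuous_const).abs.add (h2.sub continuous_const).abs
  have hη0 : η g = 0 := by
    simp only [hηdef, mul_inv_cancel]
    simp
  have hηnn : ∀ g', 0 ≤ η g' := fun g' => by positivity
  have hle : ∀ g' i j, |(g' * g⁻¹).1 i j - (1 : Matrix (Fin e) (Fin e) ℝ) i j| +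
      |(g * g'⁻¹).1 i j - (1 : Matrix (Fin e) (Fin e) ℝ) i j| ≤ η g' := fun g' i j =>
    le_trans (Finset.single_le_sum (f := fun j =>
      |(g' * g⁻¹).1 i j - (1 : Matrix (Fin e) (Fin e) ℝ) i j| +
      |(g * g'⁻¹).1 i j - (1 : Matrix (Fin e) (Fin e) ℝ) i j|) (fun _ _ => by positivity)
      (Finset.mem_univ j)) (Finset.single_le_sum (f := fun i => ∑ j,
      (|(g' * g⁻¹).1 i j - (1 : Matrix (Fin e) (Fin e) ℝ) i j| +
      |(g * g'⁻¹).1 i j - (1 : Matrix (Fin e) (Fin e) ℝ) i j|)) (fun _ _ => by positivity)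
      (Finset.mem_univ i))
  have hev : ∀ᶠ g' in 𝓝 g, 2 * e * η g' ≤ 1 := by
    have : Tendsto (fun g' => 2 * e * η g') (𝓝 g) (𝓝 (2 * e * η g)) :=
      (continuous_const.mul hηc).continuousAt
    rw [hη0, mul_zero] at this
    exact this.eventually_le_const one_pos
  have hup : Tendsto (fun g' => covSL g * (1 + 4 * e * η g')) (𝓝 g) (𝓝 (covSL g)) := by
    have : Continuous fun g' => covSL g * (1 + 4 * e * η g') := by fun_prop
    simpa [hη0] using this.tendsto g
  have hlow : Tendsto (fun g' => covSL g / (1 + 4 * e * η g')) (𝓝 g) (𝓝 (covSL g)) := by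
    have : Continuous fun g' => covSL g / (1 + 4 * e * η g') :=
      continuous_const.div (by fun_prop) fun g' => by have := hηnn g'; positivity
    simpa [hη0] using this.tendsto g
  refine tendsto_of_tendsto_of_tendsto_of_le_of_le' hlow hup ?_ ?_
  · filter_upwards [hev] with g' hg'
    have := hηnn g'
    rw [div_le_iff₀ (by positivity)]
    have h1 := covSL_mul_le (h := g * g'⁻¹) (g := g') (η := η g')
      (fun i j => by
        linarith [hle g' i j, abs_nonneg ((g' * g⁻¹).1 i j - (1 : Matrix (Fin e) (Fin e) ℝ) i j)]) hg' this
    rwa [inv_mul_cancel_right] at h1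
  · filter_upwards [hev] with g' hg'
    have h1 := covSL_mul_le (h := g' * g⁻¹) (g := g) (η := η g')
      (fun i j => by
        linarith [hle g' i j, abs_nonneg ((g * g'⁻¹).1 i j - (1 : Matrix (Fin e) (Fin e) ℝ) i j)]) hg' (hηnn g')
    rwa [inv_mul_cancel_right] at h1

lemma covSL_pos [NeZero e] (g : SLR e) : 0 < covSL g := by
  set C : ℝ := ∑ i, ∑ j, |g⁻¹.1 i j|
  have hC0 : 0 ≤ C := by positivity
  have hmain : ∀ t, 0 < t → Covers g.1 t → 1 / 2 ≤ C * t := by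
    intro t ht h
    obtain ⟨v, h1, h2⟩ := h (g.1 *ᵥ fun _ => 1 / 2)
    set y : Fin e → ℝ := fun i => (g.1 *ᵥ fun _ => (1 / 2 : ℝ)) i - (g.1 *ᵥ fun j => (v j : ℝ)) i
    have hy : g⁻¹.1 *ᵥ y = fun j => 1 / 2 - (v j : ℝ) := by
      have hinv := coe_inv_mul_coe g
      have : y = g.1 *ᵥ ((fun _ => (1 / 2 : ℝ)) - fun j => (v j : ℝ)) := by
        rw [Matrix.mulVec_sub]; rfl
      rw [this, Matrix.mulVec_mulVec, hinv, Matrix.one_mulVec]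
      rfl
    have hyt : ∀ j, |y j| ≤ t := fun j => by
      rw [abs_of_nonneg (sub_nonneg.2 (h1 j))]
      exact (Finset.single_le_sum (f := y) (fun i _ => sub_nonneg.2 (h1 i))
        (Finset.mem_univ j)).trans h2
    have hhalf : 1 / 2 ≤ |1 / 2 - (v 0 : ℝ)| := by
      rcases le_or_gt (v 0) 0 with h0 | h0
      · have : (v 0 : ℝ) ≤ 0 := by exact_mod_cast h0
        exact le_trans (by linarith) (le_abs_self _)
      · have : (1 : ℝ) ≤ v 0 := by exact_mod_cast h0
        exact le_trans (by linarith) (neg_le_abs _)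
    calc 1 / 2 ≤ |(g⁻¹.1 *ᵥ y) 0| := by rw [hy]; exact hhalf
      _ ≤ ∑ j, |g⁻¹.1 0 j * y j| := abs_mulVec_le _ _ _
      _ ≤ ∑ j, |g⁻¹.1 0 j| * t := Finset.sum_le_sum fun j _ => by
          rw [abs_mul]; exact mul_le_mul_of_nonneg_left (hyt j) (abs_nonneg _)
      _ ≤ C * t := by
          rw [← Finset.sum_mul]
          exact mul_le_mul_of_nonneg_right (Finset.single_le_sum
            (f := fun i => ∑ j, |g⁻¹.1 i j|) (fun _ _ => by positivity) (Finset.mem_univ 0)) ht.le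
  have hC : 0 < C := by
    obtain ⟨t, ht, h⟩ := exists_covers g
    by_contra h0
    have : C = 0 := le_antisymm (not_lt.1 h0) hC0
    have := hmain t ht h
    simp_all
    linarith
  refine lt_of_lt_of_le (show 0 < 1 / 2 / C by positivity) ?_
  rw [covSL_eq]
  refine le_csInf (exists_covers g) fun t ht => ?_
  rw [div_le_iff₀ hC, mul_comm]
  exact hmain t ht.1 ht.2

/-- The covering radius as a function on the space of lattices. -/
def covQuot : XQuot e → ℝ :=
  Quotient.lift covSL fun g h hgh => by
    obtain ⟨γ, hγ⟩ := QuotientGroup.leftRel_apply.1 hgh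
    have : h = g * castSL γ := by
      rw [← mul_inv_cancel_left g h, ← hγ]
    rw [this, covSL_mul_castSL]

@[simp] lemma covQuot_mk (g : SLR e) : covQuot (QuotientGroup.mk g) = covSL g := rfl

lemma continuous_covQuot : Continuous (covQuot : XQuot e → ℝ) :=
  continuous_quot_lift _ continuous_covSL

lemma image_mk_covRad_le (R : ℝ) : ((QuotientGroup.mk : SLR e → XQuot e) ''
    {g : SLR e | covRad e (simplexStd e) (latticeOf g) ≤ R}) = {x | covQuot x ≤ R} := by
  ext x
  constructor
  · rintro ⟨g, hg, rfl⟩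
    exact hg
  · obtain ⟨g, rfl⟩ := QuotientGroup.mk_surjective x
    exact fun hx => ⟨g, hx, rfl⟩

end CoveringRadius

section CoveringRadiusLevels

open Filter Topology

lemma exists_eq_zero_of_forall_lt {α : Type*} {F : Set α} (hF : F.Finite) (f : α → ℝ)
    (h : ∀ δ : ℝ, 0 < δ → δ < 1 → ∃ v ∈ F, 0 ≤ f v ∧ f v < δ) : ∃ v ∈ F, f v = 0 := by
  by_contra! hne
  have h1 : ∀ᶠ δ in 𝓝[>] (0 : ℝ), ∀ v ∈ F, δ < |f v| :=
    (Filter.eventually_all_finite hF).2 fun v hv =>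
      nhdsWithin_le_nhds (eventually_lt_nhds (abs_pos.2 (hne v hv)))
  have h2 : ∀ᶠ δ in 𝓝[>] (0 : ℝ), δ < 1 := nhdsWithin_le_nhds (eventually_lt_nhds one_pos)
  obtain ⟨δ, ⟨hδ1, hδ2⟩, hδ0⟩ := ((h1.and h2).and self_mem_nhdsWithin).exists
  obtain ⟨v, hv, hv0, hvδ⟩ := h δ hδ0 hδ2
  have := hδ1 v hv
  rw [abs_of_nonneg hv0] at this
  linarith

variable {e : ℕ}

lemma finite_lattice_box (g : SLR e) (C : ℝ) :
    {v : Fin e → ℤ | ∀ i, |(g.1 *ᵥ fun j => (v j : ℝ)) i| ≤ C}.Finite := by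
  set M : ℝ := ∑ i, ∑ j, |g⁻¹.1 i j| * |C|
  refine (Set.finite_Icc (fun _ : Fin e => -⌈M⌉) (fun _ => ⌈M⌉)).subset fun v hv => ?_
  have hb : ∀ j, |(v j : ℝ)| ≤ ⌈M⌉ := by
    intro j
    have h1 : (v j : ℝ) = (g⁻¹.1 *ᵥ (g.1 *ᵥ fun j => (v j : ℝ))) j := by
      rw [Matrix.mulVec_mulVec, coe_inv_mul_coe, Matrix.one_mulVec]
    rw [h1]
    calc _ ≤ _ := abs_mulVec_le _ _ _
      _ ≤ ∑ k, |g⁻¹.1 j k| * |C| := Finset.sum_le_sum fun k _ => by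
          rw [abs_mul]
          exact mul_le_mul_of_nonneg_left ((hv k).trans (le_abs_self C)) (abs_nonneg _)
      _ ≤ M := Finset.single_le_sum (f := fun i => ∑ j, |g⁻¹.1 i j| * |C|)
          (fun _ _ => by positivity) (Finset.mem_univ j)
      _ ≤ _ := Int.le_ceil _
  constructor <;> intro j <;> have := abs_le.1 (hb j)
  · exact_mod_cast this.1
  · exact_mod_cast this.2

/-- The open simplex with upper corner `x` and lower bound `b` for the coordinate sum contains no
point of the lattice of `g`. -/
def LatticeFree (g : SLR e) (x : Fin e → ℝ) (b : ℝ) : Prop :=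
  ∀ v : Fin e → ℤ, ¬ ((∀ i, (g.1 *ᵥ fun j => (v j : ℝ)) i < x i) ∧
    b < ∑ i, (g.1 *ᵥ fun j => (v j : ℝ)) i)

lemma LatticeFree.le_covSL {g : SLR e} {x : Fin e → ℝ} {b : ℝ} (h : LatticeFree g x b) :
    ∑ i, x i - b ≤ covSL g := by
  by_contra! hlt
  obtain ⟨s, hs, hst⟩ := exists_between hlt
  set δ : ℝ := (∑ i, x i - b - s) / (e + 1)
  have he : (0 : ℝ) < e + 1 := by positivity
  have hδ : 0 < δ := div_pos (by linarith) he
  have hδe : δ * (e + 1) = ∑ i, x i - b - s := div_mul_cancel₀ _ he.ne'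
  obtain ⟨v, h1, h2⟩ := covers_of_covSL_lt hs fun i => x i - δ
  refine h v ⟨fun i => by linarith [h1 i], ?_⟩
  rw [Finset.sum_sub_distrib, Finset.sum_sub_distrib] at h2
  simp only [Finset.sum_const, Finset.card_univ, Fintype.card_fin, nsmul_eq_mul] at h2
  nlinarith

lemma exists_latticeFree_of_lt {g : SLR e} {s : ℝ} (hs : 0 < s) (hsq : s < covSL g) :
    ∃ u : Fin e → ℝ, (∀ i, u i ∈ Set.Icc (0 : ℝ) 1) ∧
      LatticeFree g (g.1 *ᵥ u) (∑ i, (g.1 *ᵥ u) i - s) := by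
  have hn : ¬ Covers g.1 s := fun h => absurd (covSL_le hs h) (not_le.2 hsq)
  simp only [Covers, not_forall, not_exists] at hn
  obtain ⟨x, hx⟩ := hn
  set y := g⁻¹.1 *ᵥ x
  have hy : g.1 *ᵥ y = x := by rw [Matrix.mulVec_mulVec, coe_mul_coe_inv, Matrix.one_mulVec]
  have hu : g.1 *ᵥ (fun i => Int.fract (y i)) = x - g.1 *ᵥ fun j => ((⌊y j⌋ : ℤ) : ℝ) := by
    rw [← hy, ← Matrix.mulVec_sub]; rfl
  refine ⟨fun i => Int.fract (y i), fun i => ⟨Int.fract_nonneg _, (Int.fract_lt_one _).le⟩, ?_⟩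
  rintro v ⟨h1, h2⟩
  have hadd : g.1 *ᵥ (fun j => ((v j + ⌊y j⌋ : ℤ) : ℝ)) =
      (g.1 *ᵥ fun j => (v j : ℝ)) + g.1 *ᵥ fun j => ((⌊y j⌋ : ℤ) : ℝ) := by
    rw [← Matrix.mulVec_add]; congr 1; ext j; simp
  refine hx (fun j => v j + ⌊y j⌋) ⟨fun i => ?_, ?_⟩
  · rw [hadd]
    have := h1 i
    rw [hu] at this
    simp only [Pi.sub_apply, Pi.add_apply] at this ⊢
    linarith
  · rw [hadd]
    rw [hu] at h2
    simp only [Pi.sub_apply, Pi.add_apply, Finset.sum_sub_distrib, Finset.sum_add_distrib] at h2 ⊢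
    linarith

lemma exists_latticeFree_max [NeZero e] (g : SLR e) :
    ∃ x : Fin e → ℝ, LatticeFree g x (∑ i, x i - covSL g) := by
  have hq := covSL_pos g
  set K : Set ((Fin e → ℝ) × ℝ) := (Set.univ.pi fun _ => Set.Icc (0 : ℝ) 1) ×ˢ
    Set.Icc (0 : ℝ) (covSL g) with hKdef
  set P : Set ((Fin e → ℝ) × ℝ) :=
    {p | LatticeFree g (g.1 *ᵥ p.1) (∑ i, (g.1 *ᵥ p.1) i - p.2)} with hPdef
  have hmul : ∀ i, Continuous fun p : (Fin e → ℝ) × ℝ => (g.1 *ᵥ p.1) i := fun i =>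
    (continuous_apply i).comp (Continuous.matrix_mulVec continuous_const continuous_fst)
  have hP : IsClosed P := by
    have : P = ⋂ v : Fin e → ℤ, ({p : (Fin e → ℝ) × ℝ |
        (∀ i, (g.1 *ᵥ fun j => (v j : ℝ)) i < (g.1 *ᵥ p.1) i) ∧
        ∑ i, (g.1 *ᵥ p.1) i - p.2 < ∑ i, (g.1 *ᵥ fun j => (v j : ℝ)) i})ᶜ := by
      ext p
      simp only [hPdef, LatticeFree, Set.mem_iInter, Set.mem_compl_iff, Set.mem_ofPred_eq]
    rw [this]
    refine isClosed_iInter fun v => IsOpen.isClosed_compl ?_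
    refine IsOpen.inter ?_ ?_
    · have : {p : (Fin e → ℝ) × ℝ | ∀ i, (g.1 *ᵥ fun j => (v j : ℝ)) i < (g.1 *ᵥ p.1) i} =
          ⋂ i, {p | (g.1 *ᵥ fun j => (v j : ℝ)) i < (g.1 *ᵥ p.1) i} := by
        ext; simp
      change IsOpen {p : (Fin e → ℝ) × ℝ | ∀ i, (g.1 *ᵥ fun j => (v j : ℝ)) i < (g.1 *ᵥ p.1) i}
      rw [this]
      exact isOpen_iInter_of_finite fun i => isOpen_lt continuous_const (hmul i)
    · exact isOpen_lt ((continuous_finsetSum _ fun i _ => hmul i).sub continuous_snd)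
        continuous_const
  have hK : IsCompact K := (isCompact_univ_pi fun _ => isCompact_Icc).prod isCompact_Icc
  have hmem : ∀ s, 0 < s → s < covSL g → ∃ p ∈ K ∩ P, p.2 = s := fun s hs hsq => by
    obtain ⟨u, hu, hfree⟩ := exists_latticeFree_of_lt hs hsq
    exact ⟨(u, s), ⟨⟨fun i _ => hu i, hs.le, hsq.le⟩, hfree⟩, rfl⟩
  obtain ⟨p0, hp0, -⟩ := hmem (covSL g / 2) (by linarith) (by linarith)
  obtain ⟨p, hp, hmax⟩ := (hK.inter_right hP).exists_isMaxOn ⟨p0, hp0⟩ continuous_snd.continuousOn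
  have hp2 : p.2 = covSL g := by
    refine le_antisymm hp.1.2.2 (le_of_forall_lt fun s hs => ?_)
    obtain ⟨s', h1, h2⟩ := exists_between (max_lt hs hq)
    obtain ⟨p', hp', rfl⟩ := hmem s' ((le_max_right _ _).trans_lt h1) h2
    exact ((le_max_left _ _).trans_lt h1).trans_le (hmax hp')
  exact ⟨g.1 *ᵥ p.1, by have := hp.2; rwa [hPdef, Set.mem_ofPred_eq, hp2] at this⟩

lemma abs_le_of_forall_le_of_lt_sum {y z : Fin e → ℝ} {b : ℝ} (hyz : ∀ i, y i ≤ z i)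
    (hb : b ≤ ∑ i, y i) (i : Fin e) : |y i| ≤ |b| + ∑ k, |z k| := by
  have hz : ∀ k, |z k| ≤ ∑ k, |z k| := fun k =>
    Finset.single_le_sum (f := fun k => |z k|) (fun _ _ => abs_nonneg _) (Finset.mem_univ k)
  rw [abs_le]
  constructor
  · have h1 : ∑ k ∈ Finset.univ.erase i, y k ≤ ∑ k ∈ Finset.univ.erase i, |z k| :=
      Finset.sum_le_sum fun k _ => (hyz k).trans (le_abs_self _)
    have h2 : ∑ k ∈ Finset.univ.erase i, |z k| ≤ ∑ k, |z k| :=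
      Finset.sum_le_sum_of_subset_of_nonneg (Finset.erase_subset _ _) fun _ _ _ => abs_nonneg _
    rw [← Finset.add_sum_erase _ _ (Finset.mem_univ i)] at hb
    linarith [neg_abs_le b]
  · linarith [hyz i, le_abs_self (z i), hz i, abs_nonneg b]

/-- The covering radius of the simplex is a sum of coordinates of lattice vectors. -/
theorem exists_covSL_eq_sum [NeZero e] (g : SLR e) : ∃ m : Fin e → Fin e → ℤ,
    covSL g = ∑ i, (g.1 *ᵥ fun j => (m i j : ℝ)) i := by
  obtain ⟨x, hx⟩ := exists_latticeFree_max g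
  set b : ℝ := ∑ i, x i - covSL g with hb
  set C : ℝ := (|b| + 1) + ∑ k, (|x k| + 1) with hC
  have hF := finite_lattice_box g C
  have hbox : ∀ v : Fin e → ℤ, (∀ i, (g.1 *ᵥ fun j => (v j : ℝ)) i ≤ x i + 1) →
      b - 1 ≤ ∑ i, (g.1 *ᵥ fun j => (v j : ℝ)) i →
      v ∈ {v : Fin e → ℤ | ∀ i, |(g.1 *ᵥ fun j => (v j : ℝ)) i| ≤ C} := fun v h1 h2 i => by
    refine (abs_le_of_forall_le_of_lt_sum h1 h2 i).trans ?_
    refine add_le_add ?_ (Finset.sum_le_sum fun k _ => ?_)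
    · simpa using abs_sub b 1
    · simpa using abs_add_le (x k) 1
  have htouch : ∀ i, ∃ v : Fin e → ℤ, (g.1 *ᵥ fun j => (v j : ℝ)) i = x i := by
    intro i
    obtain ⟨v, -, hv⟩ := exists_eq_zero_of_forall_lt hF
      (fun v => (g.1 *ᵥ fun j => (v j : ℝ)) i - x i) fun δ hδ0 hδ1 => by
        have hnf : ¬ LatticeFree g (x + Pi.single i δ) b := fun h => by
          have := h.le_covSL
          simp only [Pi.add_apply, Finset.sum_add_distrib, Finset.sum_pi_single',
            Finset.mem_univ, if_true] at this
          linarith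
        simp only [LatticeFree, not_forall, not_not] at hnf
        obtain ⟨v, h1, h2⟩ := hnf
        have hi : (g.1 *ᵥ fun j => (v j : ℝ)) i < x i + δ := by simpa using h1 i
        have hne : ∀ k, k ≠ i → (g.1 *ᵥ fun j => (v j : ℝ)) k < x k := fun k hk => by
          simpa [hk] using h1 k
        refine ⟨v, hbox v (fun k => ?_) (by linarith), ?_, by linarith⟩
        · rcases eq_or_ne k i with rfl | hk
          · linarith
          · linarith [hne k hk]
        · by_contra! hlt
          refine hx v ⟨fun k => ?_, h2⟩
          rcases eq_or_ne k i with rfl | hk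
          · linarith
          · exact hne k hk
    exact ⟨v, by linarith⟩
  have htouch0 : ∃ v : Fin e → ℤ, ∑ i, (g.1 *ᵥ fun j => (v j : ℝ)) i = b := by
    obtain ⟨v, -, hv⟩ := exists_eq_zero_of_forall_lt hF
      (fun v => b - ∑ i, (g.1 *ᵥ fun j => (v j : ℝ)) i) fun δ hδ0 hδ1 => by
        have hnf : ¬ LatticeFree g x (b - δ) := fun h => by
          have := h.le_covSL
          linarith
        simp only [LatticeFree, not_forall, not_not] at hnf
        obtain ⟨v, h1, h2⟩ := hnf
        refine ⟨v, hbox v (fun k => by linarith [h1 k]) (by linarith), ?_, by linarith⟩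
        by_contra! hlt
        exact hx v ⟨h1, by linarith⟩
    exact ⟨v, by linarith⟩
  choose w hw using htouch
  obtain ⟨w0, hw0⟩ := htouch0
  refine ⟨fun i j => w i j - w0 j, ?_⟩
  have : ∀ i, (g.1 *ᵥ fun j => ((w i j - w0 j : ℤ) : ℝ)) i =
      x i - (g.1 *ᵥ fun j => (w0 j : ℝ)) i := by
    intro i
    have h1 : (fun j => ((w i j - w0 j : ℤ) : ℝ)) = (fun j => (w i j : ℝ)) - fun j => (w0 j : ℝ) := by
      ext j; simp
    rw [h1, Matrix.mulVec_sub, Pi.sub_apply, hw]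
  simp only [this, Finset.sum_sub_distrib, hw0, hb]
  ring

lemma finite_setOf_pow_eq {n : ℕ} (hn : 2 ≤ n) {c : ℝ} (hc : c ≠ 0) (α β γ : ℝ) :
    {x : ℝ | (α + x * c) ^ n = β + x * γ}.Finite := by
  by_contra hinf
  have h1 : (Polynomial.C c * Polynomial.X + Polynomial.C α) ^ n =
      Polynomial.C γ * Polynomial.X + Polynomial.C β := by
    refine Polynomial.eq_of_infinite_eval_eq _ _ (Set.Infinite.mono (fun x hx => ?_) hinf)
    simp only [Set.mem_ofPred_eq, Polynomial.eval_pow, Polynomial.eval_add, Polynomial.eval_mul,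
      Polynomial.eval_C, Polynomial.eval_X] at hx ⊢
    rw [add_comm, mul_comm c, hx]; ring
  have h2 := congrArg Polynomial.natDegree h1
  rw [Polynomial.natDegree_pow, Polynomial.natDegree_linear hc] at h2
  have h3 := Polynomial.natDegree_linear_le (a := γ) (b := β)
  omega

lemma volume_setOf_sum_pow_eq (he : 2 ≤ e) (R : ℝ) {m : Fin e → Fin e → ℤ} (hm : m ≠ 0) :
    volume {b : Fin e × Fin e → ℝ | (∑ i, (entryMat b *ᵥ fun j => (m i j : ℝ)) i) ^ e =
      R * (entryMat b).det} = 0 := by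
  obtain ⟨i, hi⟩ := Function.ne_iff.1 hm
  obtain ⟨j, hij⟩ := Function.ne_iff.1 hi
  have hmul : ∀ k, Continuous fun b : Fin e × Fin e → ℝ =>
      (entryMat b *ᵥ fun j => (m k j : ℝ)) k := fun k =>
    (continuous_apply k).comp (continuous_entryMat.matrix_mulVec continuous_const)
  have hmeas : MeasurableSet {b : Fin e × Fin e → ℝ |
      (∑ i, (entryMat b *ᵥ fun j => (m i j : ℝ)) i) ^ e = R * (entryMat b).det} :=
    (isClosed_eq ((continuous_finsetSum _ fun k _ => hmul k).pow e)
      (continuous_const.mul continuous_entryMat.matrix_det)).measurableSet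
  have key := ae_mem_of_ae_add_linearMap_mem
    (LinearMap.single ℝ (fun _ : Fin e × Fin e => ℝ) (i, j)) volume volume hmeas.compl fun b => by
      set A := entryMat b
      have hA : ∀ x : ℝ, entryMat (b + LinearMap.single ℝ (fun _ : Fin e × Fin e => ℝ) (i, j) x) =
          A.updateRow i (A i + x • Pi.single j 1) := by
        intro x
        ext k l
        rcases eq_or_ne k i with rfl | hk
        · rcases eq_or_ne l j with rfl | hl
          · simp [entryMat, A]
          · simp [entryMat, A, hl]
        · simp [entryMat, A, hk]
      have hfin : ({x : ℝ | (∑ k, (A *ᵥ fun j => (m k j : ℝ)) k + x * m i j) ^ e =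
          R * A.det + x * (R * (A.updateRow i (Pi.single j 1)).det)}).Finite :=
        finite_setOf_pow_eq he (by exact_mod_cast hij) _ _ _
      have hae : ∀ᵐ x : ℝ, x ∉ {x : ℝ | (∑ k, (A *ᵥ fun j => (m k j : ℝ)) k + x * m i j) ^ e =
          R * A.det + x * (R * (A.updateRow i (Pi.single j 1)).det)} :=
        measure_eq_zero_iff_ae_notMem.1 (hfin.measure_zero _)
      filter_upwards [hae] with x hx hmem
      refine hx ?_
      simp only [Set.mem_ofPred_eq, hA] at hmem ⊢
      have hdet : (A.updateRow i (A i + x • Pi.single j 1)).det =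
          A.det + x * (A.updateRow i (Pi.single j 1)).det := by
        rw [Matrix.det_updateRow_add, Matrix.det_updateRow_smul, Matrix.updateRow_eq_self]
      have hsum : ∑ k, (A.updateRow i (A i + x • Pi.single j 1) *ᵥ fun j => (m k j : ℝ)) k =
          ∑ k, (A *ᵥ fun j => (m k j : ℝ)) k + x * m i j := by
        have : ∀ k, (A.updateRow i (A i + x • Pi.single j 1) *ᵥ fun j => (m k j : ℝ)) k =
            (A *ᵥ fun j => (m k j : ℝ)) k + if k = i then x * m i j else 0 := by
          intro k
          rcases eq_or_ne k i with rfl | hk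
          · rw [if_pos rfl, Matrix.mulVec, Matrix.updateRow_self, add_dotProduct, smul_dotProduct,
              single_one_dotProduct]
            rfl
          · simp [Matrix.mulVec, hk]
        simp only [this, Finset.sum_add_distrib, Finset.sum_ite_eq', Finset.mem_univ, if_true]
      rw [hdet, hsum] at hmem
      rw [hmem]; ring
  exact (measure_eq_zero_iff_ae_notMem).2 key

lemma volume_covSL_level [NeZero e] (he : 2 ≤ e) {R : ℝ} (hR : 0 < R) :
    volume {b : Fin e × Fin e → ℝ | 0 < (entryMat b).det ∧
      covQuot (QuotientGroup.mk (toSL (entryMat b)) : XQuot e) = R} = 0 := by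
  refine measure_mono_null (t := ⋃ m : {m : Fin e → Fin e → ℤ // m ≠ 0},
    {b : Fin e × Fin e → ℝ | (∑ i, (entryMat b *ᵥ fun j => (m.1 i j : ℝ)) i) ^ e =
      R ^ e * (entryMat b).det}) ?_ (measure_iUnion_null fun m =>
        volume_setOf_sum_pow_eq he _ m.2)
  rintro b ⟨hdet, hb⟩
  obtain ⟨m, hm⟩ := exists_covSL_eq_sum (toSL (entryMat b))
  rw [covQuot_mk] at hb
  rw [hb] at hm
  refine Set.mem_iUnion.2 ⟨⟨m, ?_⟩, ?_⟩
  · rintro rfl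
    simp [Matrix.mulVec, dotProduct] at hm
    exact hR.ne' hm
  · rw [coe_toSL hdet] at hm
    simp only [Matrix.smul_mulVec, Pi.smul_apply, smul_eq_mul, ← Finset.mul_sum] at hm
    rw [Set.mem_ofPred_eq]
    refine Eq.trans ?_ (congrArg (fun r => r ^ e * (entryMat b).det) hm.symm)
    simp only
    rw [mul_pow, ← Real.rpow_natCast ((entryMat b).det ^ _), ← Real.rpow_mul hdet.le]
    have he0 : (e : ℝ) ≠ 0 := by exact_mod_cast (NeZero.ne e)
    have : -(1 / (e : ℝ)) * e = -1 := by field_simp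
    rw [this, Real.rpow_neg_one]
    field_simp

theorem measure_covQuot_level [NeZero e] (he : 2 ≤ e) (μ : Measure (XQuot e))
    [IsProbabilityMeasure μ] (hinv : ∀ g : SLR e, Measure.map (fun x => g • x) μ = μ)
    {R : ℝ} (hR : 0 ≤ R) : μ {x | covQuot x = R} = 0 := by
  rcases hR.eq_or_lt with rfl | hR
  · refine measure_mono_null (t := ∅) (fun x hx => ?_) measure_empty
    obtain ⟨g, rfl⟩ := QuotientGroup.mk_surjective x
    exact absurd hx (covSL_pos g).ne'
  · exact measure_level_eq_zero μ hinv continuous_covQuot (volume_covSL_level he hR)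

end CoveringRadiusLevels

section FrobeniusNumber

variable {e : ℕ}

/-- The normalizing factor `(a₁⋯a_d)^{1/(d-1)}`. -/
def geomScale (a : Fin (e + 1) → ℤ) : ℝ := (∏ i, (a i : ℝ)) ^ (1 / (e : ℝ))

lemma geomScale_pos {a : Fin (e + 1) → ℤ} (ha : ∀ i, 0 < a i) : 0 < geomScale a :=
  Real.rpow_pos_of_pos (Finset.prod_pos fun i _ => by exact_mod_cast ha i) _

lemma IsKernelBasis.dvd_iff {a : Fin (e + 1) → ℤ} {B : Matrix (Fin e) (Fin e) ℤ} {r : Fin e → ℤ}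
    (h : IsKernelBasis a B r) (x : Fin e → ℤ) :
    a (Fin.last e) ∣ ∑ i, a i.castSucc * x i ↔ ∃ y, x = B *ᵥ y := by
  constructor
  · rintro ⟨k, hk⟩
    obtain ⟨y, hy, -⟩ := h.span (Fin.snoc x (-k)) (by
      rw [Fin.sum_univ_castSucc]; simp [hk])
    exact ⟨y, funext fun i => by simpa using hy i⟩
  · rintro ⟨y, rfl⟩
    refine ⟨-(r ⬝ᵥ y), ?_⟩
    have h1 : ∑ i, a i.castSucc * (B *ᵥ y) i = ∑ j, (∑ i, a i.castSucc * B i j) * y j := by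
      simp only [Matrix.mulVec, dotProduct, Finset.mul_sum, Finset.sum_mul]
      rw [Finset.sum_comm]
      exact Finset.sum_congr rfl fun j _ => Finset.sum_congr rfl fun i _ => by ring
    rw [h1, dotProduct, mul_neg, Finset.mul_sum, ← Finset.sum_neg_distrib]
    refine Finset.sum_congr rfl fun j _ => ?_
    have := h.orth j
    linear_combination y j * this

variable [NeZero e]

lemma latticePoint_mulVec (a : PosPrim (e + 1)) (v : Fin e → ℤ) (i : Fin e) :
    ((latticePoint a.1).1 *ᵥ fun j => (v j : ℝ)) i =
      (geomScale a.1)⁻¹ * ((a.1 i.castSucc : ℝ) * (((kerB a.1 *ᵥ v) i : ℤ) : ℝ)) := by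
  have hB := isKernelBasis_ker a.2.1
  have hdet : (Matrix.diagonal (fun i : Fin e => (a.1 i.castSucc : ℝ)) * castMat (kerB a.1)).det =
      ∏ i, (a.1 i : ℝ) := by
    rw [Matrix.det_mul, Matrix.det_diagonal, det_castMat, hB.det_eq, Fin.prod_univ_castSucc]
  have hpos : (0 : ℝ) < ∏ i, (a.1 i : ℝ) :=
    Finset.prod_pos fun i _ => by exact_mod_cast a.2.2 i
  have h1 : (latticePoint a.1).1 = (geomScale a.1)⁻¹ •
      (Matrix.diagonal (fun i : Fin e => (a.1 i.castSucc : ℝ)) * castMat (kerB a.1)) := by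
    rw [geomScale, ← Real.rpow_neg hpos.le, ← hdet]
    exact coe_toSL (by rw [hdet]; exact hpos)
  rw [h1, Matrix.smul_mulVec, ← Matrix.mulVec_mulVec, Pi.smul_apply, Matrix.mulVec_diagonal,
    smul_eq_mul]
  congr 2
  simp [castMat, Matrix.mulVec, dotProduct]

lemma covers_latticePoint_iff (a : PosPrim (e + 1)) (t : ℝ) :
    Covers (latticePoint a.1).1 t ↔ ∀ y : Fin e → ℝ, ∃ z : Fin e → ℤ,
      a.1 (Fin.last e) ∣ ∑ i, a.1 i.castSucc * z i ∧ (∀ i, (a.1 i.castSucc : ℝ) * z i ≤ y i) ∧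
      ∑ i, (y i - (a.1 i.castSucc : ℝ) * z i) ≤ t * geomScale a.1 := by
  have hS := geomScale_pos a.2.2
  have hB := isKernelBasis_ker a.2.1
  constructor
  · intro h y
    obtain ⟨v, h1, h2⟩ := h fun i => (geomScale a.1)⁻¹ * y i
    simp only [latticePoint_mulVec, ← mul_sub, ← Finset.mul_sum] at h1 h2
    refine ⟨kerB a.1 *ᵥ v, (hB.dvd_iff _).2 ⟨v, rfl⟩, fun i => ?_, ?_⟩
    · exact le_of_mul_le_mul_left (h1 i) (inv_pos.2 hS)
    · rwa [inv_mul_le_iff₀ hS, mul_comm] at h2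
  · intro h x
    obtain ⟨z, hz, h1, h2⟩ := h fun i => geomScale a.1 * x i
    obtain ⟨v, rfl⟩ := (hB.dvd_iff _).1 hz
    refine ⟨v, fun i => ?_, ?_⟩
    · rw [latticePoint_mulVec, inv_mul_le_iff₀ hS]
      exact h1 i
    · have : ∀ i, x i - ((latticePoint a.1).1 *ᵥ fun j => (v j : ℝ)) i = (geomScale a.1)⁻¹ *
          (geomScale a.1 * x i - (a.1 i.castSucc : ℝ) * (((kerB a.1 *ᵥ v) i : ℤ) : ℝ)) := fun i => by
        rw [latticePoint_mulVec, mul_sub, inv_mul_cancel_left₀ hS.ne']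
      simp only [this, ← Finset.mul_sum]
      rwa [inv_mul_le_iff₀ hS, mul_comm]

lemma exists_representation_of_covers {a : PosPrim (e + 1)} {t : ℝ}
    (h : Covers (latticePoint a.1).1 t) {m : ℕ} (hm : t * geomScale a.1 ≤ m) :
    ∃ k : Fin (e + 1) → ℕ, (m : ℤ) = ∑ i, (k i : ℤ) * a.1 i := by
  obtain ⟨c, hc⟩ : ∃ c : Fin (e + 1) → ℤ, ∑ i, a.1 i * c i = 1 := by
    have : Nontrivial (Fin (e + 1)) :=
      Fin.nontrivial_iff_two_le.2 (by have := NeZero.pos e; omega)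
    obtain ⟨γ, hγ⟩ := exists_vecMul_eq_single a.1 a.2.1 (Fin.last e)
    exact ⟨fun i => γ.1 i (Fin.last e), by
      simpa [Matrix.vecMul, dotProduct] using congrFun hγ (Fin.last e)⟩
  obtain ⟨z, ⟨q, hq⟩, h1, h2⟩ := (covers_latticePoint_iff a t).1 h
    fun i => (a.1 i.castSucc : ℝ) * (m * c i.castSucc : ℤ)
  have hpos : ∀ i : Fin e, 0 ≤ m * c i.castSucc - z i := fun i => by
    have ha : (0 : ℝ) < a.1 i.castSucc := by exact_mod_cast a.2.2 i.castSucc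
    have := le_of_mul_le_mul_left (h1 i) ha
    exact sub_nonneg.2 (by exact_mod_cast this)
  have hmain : (m : ℤ) = ∑ i : Fin e, (m * c i.castSucc - z i) * a.1 i.castSucc +
      (m * c (Fin.last e) + q) * a.1 (Fin.last e) := by
    have h3 : (m : ℤ) * ∑ i, a.1 i * c i = m := by rw [hc, mul_one]
    rw [Fin.sum_univ_castSucc] at h3
    have h4 : ∑ i : Fin e, (m * c i.castSucc - z i) * a.1 i.castSucc =
        m * ∑ i : Fin e, a.1 i.castSucc * c i.castSucc - ∑ i : Fin e, a.1 i.castSucc * z i := by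
      rw [Finset.mul_sum, ← Finset.sum_sub_distrib]
      exact Finset.sum_congr rfl fun i _ => by ring
    rw [h4, hq]
    linear_combination -h3
  have hlast : 0 ≤ m * c (Fin.last e) + q := by
    by_contra! hneg
    have h5 : ∑ i : Fin e, (m * c i.castSucc - z i) * a.1 i.castSucc ≤ m := by
      have h6 := h2.trans hm
      have h7 : ((∑ i : Fin e, (m * c i.castSucc - z i) * a.1 i.castSucc : ℤ) : ℝ) ≤ m := by
        refine le_trans (le_of_eq ?_) h6
        push_cast
        exact Finset.sum_congr rfl fun i _ => by ring
      exact_mod_cast h7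
    have := a.2.2 (Fin.last e)
    nlinarith
  refine ⟨Fin.snoc (fun i => (m * c i.castSucc - z i).toNat) (m * c (Fin.last e) + q).toNat, ?_⟩
  rw [Fin.sum_univ_castSucc]
  simp only [Fin.snoc_castSucc, Fin.snoc_last, Int.toNat_of_nonneg hlast]
  refine hmain.trans (congrArg (· + _) ?_)
  exact Finset.sum_congr rfl fun i _ => by rw [Int.toNat_of_nonneg (hpos i)]

/-- The Frobenius number is bounded above through the covering radius. -/
lemma frobNum_le_of_covSL_lt {a : PosPrim (e + 1)} {R : ℝ} (h : covSL (latticePoint a.1) < R) :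
    (frobNum (e + 1) a.1 : ℝ) ≤ R * geomScale a.1 := by
  have hR : 0 ≤ R := (covSL_nonneg _).trans h.le
  have hlt : ∀ m ∈ nonRepresentable (e + 1) a.1, m ≤ ⌊R * geomScale a.1⌋₊ := fun m hm => by
    refine Nat.le_floor (le_of_not_ge fun hle => hm ?_)
    exact exists_representation_of_covers (covers_of_covSL_lt h) hle
  refine le_trans (Nat.cast_le.2 ?_) (Nat.floor_le (mul_nonneg hR (geomScale_pos a.2.2).le))
  exact csSup_le' hlt

lemma exists_representation_of_frobNum_lt {a : PosPrim (e + 1)} {m : ℕ}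
    (h : frobNum (e + 1) a.1 < m) : ∃ k : Fin (e + 1) → ℕ, (m : ℤ) = ∑ i, (k i : ℤ) * a.1 i := by
  by_contra hm
  obtain ⟨t, ht, hcov⟩ := exists_covers (latticePoint a.1)
  refine absurd (le_csSup ⟨⌊t * geomScale a.1⌋₊, fun n hn => ?_⟩ hm) (not_le.2 h)
  exact Nat.le_floor (le_of_not_ge fun hle => hn (exists_representation_of_covers hcov hle))

lemma exists_mem_residue (r : ℤ) {n : ℤ} (hn : 0 < n) {x : ℝ} (hx : 0 ≤ x) :
    ∃ m : ℕ, x < m ∧ (m : ℝ) ≤ x + n ∧ n ∣ (m : ℤ) - r := by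
  have hpos : 0 ≤ (r - (⌊x⌋ + 1)) % n := Int.emod_nonneg _ hn.ne'
  have hlt : (r - (⌊x⌋ + 1)) % n < n := Int.emod_lt_of_pos _ hn
  have hfl : 0 ≤ ⌊x⌋ := Int.floor_nonneg.2 hx
  obtain ⟨m, hm⟩ := Int.eq_ofNat_of_zero_le
    (show 0 ≤ ⌊x⌋ + 1 + (r - (⌊x⌋ + 1)) % n by omega)
  have hmr : (m : ℝ) = ((⌊x⌋ + 1 + (r - (⌊x⌋ + 1)) % n : ℤ) : ℝ) := by rw [hm]; simp
  refine ⟨m, ?_, ?_, ?_⟩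
  · rw [hmr]
    push_cast
    have : (0 : ℝ) ≤ ((r - (⌊x⌋ + 1)) % n : ℤ) := by exact_mod_cast hpos
    linarith [Int.lt_floor_add_one x]
  · rw [hmr]
    have : ((⌊x⌋ + 1 + (r - (⌊x⌋ + 1)) % n : ℤ) : ℝ) ≤ ((⌊x⌋ + n : ℤ) : ℝ) := by
      exact_mod_cast (by omega)
    push_cast at this ⊢
    linarith [Int.floor_le x]
  · refine ⟨-((r - (⌊x⌋ + 1)) / n), ?_⟩
    have := Int.emod_add_mul_ediv (r - (⌊x⌋ + 1)) n
    have h2 : (m : ℤ) = ⌊x⌋ + 1 + (r - (⌊x⌋ + 1)) % n := hm.symm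
    rw [h2]
    linarith

/-- The covering radius is bounded above through the Frobenius number. -/
lemma covSL_le_of_frobNum_le {a : PosPrim (e + 1)} {R : ℝ} (hR : 0 ≤ R)
    (h : (frobNum (e + 1) a.1 : ℝ) ≤ R * geomScale a.1) :
    covSL (latticePoint a.1) ≤ R + (∑ i, (a.1 i : ℝ)) / geomScale a.1 := by
  have hS := geomScale_pos a.2.2
  have hapos : ∀ i, (0 : ℝ) < a.1 i := fun i => by exact_mod_cast a.2.2 i
  have hsum : 0 < ∑ i, (a.1 i : ℝ) := Finset.sum_pos (fun i _ => hapos i) ⟨0, Finset.mem_univ _⟩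
  refine covSL_le (by positivity) ((covers_latticePoint_iff a _).2 fun y => ?_)
  set z : Fin e → ℤ := fun i => ⌊y i / a.1 i.castSucc⌋
  obtain ⟨m, hm1, hm2, q, hq⟩ := exists_mem_residue (∑ i, a.1 i.castSucc * z i)
    (a.2.2 (Fin.last e)) (mul_nonneg hR hS.le)
  obtain ⟨k, hk⟩ := exists_representation_of_frobNum_lt (a := a) (m := m)
    (by exact_mod_cast h.trans_lt hm1)
  rw [Fin.sum_univ_castSucc] at hk
  have hz1 : ∀ i, (a.1 i.castSucc : ℝ) * z i ≤ y i := fun i => by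
    rw [mul_comm, ← le_div_iff₀ (hapos _)]; exact Int.floor_le _
  have hz2 : ∀ i, y i - (a.1 i.castSucc : ℝ) * z i ≤ a.1 i.castSucc := fun i => by
    have := Int.lt_floor_add_one (y i / a.1 i.castSucc)
    rw [div_lt_iff₀ (hapos _)] at this
    simp only [z]
    linarith
  refine ⟨fun i => z i - k i.castSucc, ⟨k (Fin.last e) - q, ?_⟩, fun i => ?_, ?_⟩
  · simp only [mul_sub, Finset.sum_sub_distrib]
    have h1 : ∑ i : Fin e, a.1 i.castSucc * (k i.castSucc : ℤ) =
        ∑ i : Fin e, (k i.castSucc : ℤ) * a.1 i.castSucc :=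
      Finset.sum_congr rfl fun i _ => mul_comm _ _
    rw [h1]
    linear_combination -hq + hk
  · push_cast
    have : 0 ≤ (a.1 i.castSucc : ℝ) * k i.castSucc := by have := hapos i.castSucc; positivity
    linarith [hz1 i]
  · have h1 : ∑ i : Fin e, (k i.castSucc : ℝ) * a.1 i.castSucc ≤ m := by
      have h2 : ∑ i : Fin e, (k i.castSucc : ℤ) * a.1 i.castSucc ≤ m := by
        rw [hk]
        have := a.2.2 (Fin.last e)
        have : 0 ≤ (k (Fin.last e) : ℤ) * a.1 (Fin.last e) := by positivity
        linarith
      exact_mod_cast h2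
    have h3 : ∑ i : Fin e, (y i - (a.1 i.castSucc : ℝ) * ((z i - k i.castSucc : ℤ) : ℝ)) =
        ∑ i : Fin e, (y i - (a.1 i.castSucc : ℝ) * z i) +
          ∑ i : Fin e, (k i.castSucc : ℝ) * a.1 i.castSucc := by
      rw [← Finset.sum_add_distrib]
      exact Finset.sum_congr rfl fun i _ => by push_cast; ring
    rw [h3, add_mul, div_mul_cancel₀ _ hS.ne', Fin.sum_univ_castSucc]
    linarith [Finset.sum_le_sum fun i (_ : i ∈ (Finset.univ : Finset (Fin e))) => hz2 i]

end FrobeniusNumber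

section PrimitiveVectors

open Filter Topology

lemma tsum_moebius_div_pow {n : ℕ} (hn : 2 ≤ n) :
    ∑' g : ℕ, (ArithmeticFunction.moebius g : ℝ) / (g : ℝ) ^ n = (zetaVal n)⁻¹ := by
  have hs : 1 < ((n : ℂ)).re := by
    rw [Complex.natCast_re]; exact_mod_cast (by omega : 1 < n)
  have h1 := LSeries_one_mul_Lseries_moebius hs
  rw [LSeries_one_eq_riemannZeta hs, zeta_eq_tsum_one_div_nat_add_one_cpow hs] at h1
  have h2 : (∑' k : ℕ, 1 / ((k : ℂ) + 1) ^ (n : ℂ)) = ((zetaVal n : ℝ) : ℂ) := by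
    rw [zetaVal, Complex.ofReal_tsum]
    refine tsum_congr fun k => ?_
    rw [Complex.cpow_natCast]
    push_cast
    rfl
  have h3 : LSeries (fun g => ((ArithmeticFunction.moebius g : ℤ) : ℂ)) n =
      ((∑' g : ℕ, (ArithmeticFunction.moebius g : ℝ) / (g : ℝ) ^ n : ℝ) : ℂ) := by
    rw [LSeries, Complex.ofReal_tsum]
    refine tsum_congr fun g => ?_
    rw [LSeries.term_def]
    split_ifs with hg
    · simp [hg]
    · rw [Complex.cpow_natCast]
      push_cast
      rfl
  rw [h2, h3, ← Complex.ofReal_mul] at h1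
  exact eq_inv_of_mul_eq_one_right (by exact_mod_cast h1)

variable {n : ℕ}

/-- A box containing all integer points of the support of a function supported in `(0, y]^n`. -/
lemma mem_box_of_ne_zero {w : (Fin n → ℝ) → ℝ} {y : ℝ}
    (hw : ∀ x, w x ≠ 0 → ∀ i, 0 < x i ∧ x i ≤ y) {s : ℝ} (hs : 0 < s) {k : Fin n → ℤ}
    (hk : w (fun i => k i / s) ≠ 0) :
    k ∈ Fintype.piFinset fun _ : Fin n => Finset.Icc 1 ⌊y * s⌋ := by
  rw [Fintype.mem_piFinset]
  intro i
  obtain ⟨h1, h2⟩ := hw _ hk i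
  rw [Finset.mem_Icc, Int.le_floor]
  rw [div_le_iff₀ hs] at h2
  have h3 : 0 < (k i : ℝ) := by
    have := mul_pos h1 hs
    rwa [div_mul_cancel₀ _ hs.ne'] at this
  exact ⟨by exact_mod_cast h3, h2⟩

lemma abs_tsum_le_of_support {w : (Fin n → ℝ) → ℝ} {C y : ℝ} (hC : ∀ x, |w x| ≤ C) (hy : 0 ≤ y)
    (hw : ∀ x, w x ≠ 0 → ∀ i, 0 < x i ∧ x i ≤ y) {s : ℝ} (hs : 0 < s) :
    |∑' k : Fin n → ℤ, w (fun i => k i / s)| ≤ C * (y * s) ^ n := by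
  have hC0 : 0 ≤ C := (abs_nonneg _).trans (hC 0)
  rw [tsum_eq_sum (s := Fintype.piFinset fun _ : Fin n => Finset.Icc 1 ⌊y * s⌋) fun k hk => by
    by_contra h; exact hk (mem_box_of_ne_zero hw hs h)]
  refine (Finset.abs_sum_le_sum_abs _ _).trans ((Finset.sum_le_card_nsmul _ _ C
    fun k _ => hC _).trans ?_)
  rw [nsmul_eq_mul, mul_comm]
  refine mul_le_mul_of_nonneg_left ?_ hC0
  rw [Fintype.card_piFinset_const, Int.card_Icc, add_sub_cancel_right, Nat.cast_pow]
  refine pow_le_pow_left₀ (Nat.cast_nonneg _) ?_ _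
  have h0 : 0 ≤ ⌊y * s⌋ := Int.floor_nonneg.2 (by positivity)
  have h1 : ((⌊y * s⌋.toNat : ℕ) : ℝ) = (⌊y * s⌋ : ℝ) := by
    exact_mod_cast congrArg (Int.cast (R := ℝ)) (Int.toNat_of_nonneg h0)
  rw [h1]
  exact Int.floor_le _

lemma sum_divisors_moebius (m : ℕ) :
    ∑ g ∈ m.divisors, (ArithmeticFunction.moebius g : ℝ) = if m = 1 then 1 else 0 := by
  have h := congrArg (fun f : ArithmeticFunction ℤ => f m)
    ArithmeticFunction.moebius_mul_coe_zeta
  simp only [ArithmeticFunction.coe_mul_zeta_apply, ArithmeticFunction.one_apply] at h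
  exact_mod_cast h

lemma tsum_posPrim_eq [NeZero n] {w : (Fin n → ℝ) → ℝ} {y : ℝ}
    (hw : ∀ x, w x ≠ 0 → ∀ i, 0 < x i ∧ x i ≤ y) {T : ℝ} (hT : 0 < T) :
    ∑' a : PosPrim n, w (fun i => a.1 i / T) = ∑' g : ℕ, (ArithmeticFunction.moebius g : ℝ) *
      ∑' k : Fin n → ℤ, w (fun i => k i / (T / g)) := by
  set F := Fintype.piFinset fun _ : Fin n => Finset.Icc 1 ⌊y * T⌋
  have hF : ∀ k : Fin n → ℤ, k ∉ F → w (fun i => k i / T) = 0 := fun k hk => by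
    by_contra h; exact hk (mem_box_of_ne_zero hw hT h)
  have hscale : ∀ g : ℕ, g ≠ 0 → ∑' k : Fin n → ℤ, w (fun i => k i / (T / g)) =
      ∑ k ∈ F, if ∀ i, (g : ℤ) ∣ k i then w (fun i => k i / T) else 0 := by
    intro g hg
    have hg' : (g : ℝ) ≠ 0 := by exact_mod_cast hg
    have hinj : Function.Injective fun k : Fin n → ℤ => fun i => (g : ℤ) * k i := fun k l h => by
      ext i
      exact mul_left_cancel₀ (by exact_mod_cast hg) (congrFun h i)
    have hsum : ∑' k : Fin n → ℤ, (if ∀ i, (g : ℤ) ∣ k i then w (fun i => k i / T) else 0) =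
        ∑ k ∈ F, if ∀ i, (g : ℤ) ∣ k i then w (fun i => k i / T) else 0 :=
      tsum_eq_sum fun k hk => by rw [hF k hk, ite_self]
    refine Eq.trans (tsum_congr fun k => ?_) ((hinj.tsum_eq ?_).trans hsum)
    · rw [if_pos fun i => dvd_mul_right _ _]
      congr 1
      ext i
      push_cast
      rw [div_div_eq_mul_div, mul_comm]
    · intro k hk
      have : ∀ i, (g : ℤ) ∣ k i := by
        by_contra h
        exact hk (if_neg h)
      choose l hl using this
      exact ⟨l, funext fun i => (hl i).symm⟩
  have hterm : ∀ g : ℕ, (ArithmeticFunction.moebius g : ℝ) *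
      ∑' k : Fin n → ℤ, w (fun i => k i / (T / g)) =
      ∑ k ∈ F, (ArithmeticFunction.moebius g : ℝ) *
        if ∀ i, (g : ℤ) ∣ k i then w (fun i => k i / T) else 0 := by
    intro g
    rcases eq_or_ne g 0 with rfl | hg
    · simp
    · rw [hscale g hg, Finset.mul_sum]
  have hzero : ∀ k ∈ F, ∀ g ∉ (Finset.univ.gcd k).natAbs.divisors,
      ((ArithmeticFunction.moebius g : ℝ) *
        if ∀ i, (g : ℤ) ∣ k i then w (fun i => k i / T) else 0) = 0 := by
    intro k hk g hg
    rw [if_neg, mul_zero]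
    intro h
    refine hg (Nat.mem_divisors.2 ⟨?_, ?_⟩)
    · rw [← Int.natCast_dvd]
      exact Finset.dvd_gcd fun i _ => h i
    · rw [Int.natAbs_ne_zero]
      intro h0
      have h1 := Finset.gcd_eq_zero_iff.1 h0 0 (Finset.mem_univ _)
      have h2 := Finset.mem_Icc.1 (Fintype.mem_piFinset.1 hk 0)
      omega
  simp only [hterm]
  rw [Summable.tsum_finsetSum fun k hk => summable_of_ne_finset_zero (hzero k hk)]
  have hinner : ∀ k ∈ F, ∑' g : ℕ, ((ArithmeticFunction.moebius g : ℝ) *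
      if ∀ i, (g : ℤ) ∣ k i then w (fun i => k i / T) else 0) =
      Set.indicator {a : Fin n → ℤ | Finset.univ.gcd a = 1 ∧ ∀ i, 0 < a i}
        (fun k => w (fun i => k i / T)) k := by
    intro k hk
    rw [tsum_eq_sum (hzero k hk)]
    have h1 : ∀ g ∈ (Finset.univ.gcd k).natAbs.divisors, ((ArithmeticFunction.moebius g : ℝ) *
        if ∀ i, (g : ℤ) ∣ k i then w (fun i => k i / T) else 0) =
        (ArithmeticFunction.moebius g : ℝ) * w (fun i => k i / T) := fun g hg => by
      rw [if_pos]
      intro i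
      exact (Int.natCast_dvd.2 (Nat.dvd_of_mem_divisors hg)).trans
        (Finset.gcd_dvd (Finset.mem_univ i))
    rw [Finset.sum_congr rfl h1, ← Finset.sum_mul, sum_divisors_moebius]
    have hpos : ∀ i, 0 < k i := fun i => by
      have := (Finset.mem_Icc.1 (Fintype.mem_piFinset.1 hk i)).1
      omega
    by_cases hg : Finset.univ.gcd k = 1
    · rw [Set.indicator_of_mem (show k ∈ {a : Fin n → ℤ | Finset.univ.gcd a = 1 ∧ ∀ i, 0 < a i}
        from ⟨hg, hpos⟩), hg]
      simp
    · rw [Set.indicator_of_notMem fun h => hg h.1, if_neg, zero_mul]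
      intro h
      refine hg ?_
      have h2 : 0 ≤ Finset.univ.gcd k := by
        rw [← Finset.normalize_gcd, ← Int.abs_eq_normalize]
        exact abs_nonneg _
      omega
  have hsum : ∑' k, Set.indicator {a : Fin n → ℤ | Finset.univ.gcd a = 1 ∧ ∀ i, 0 < a i}
      (fun k => w (fun i => k i / T)) k = ∑ k ∈ F,
      Set.indicator {a : Fin n → ℤ | Finset.univ.gcd a = 1 ∧ ∀ i, 0 < a i}
      (fun k => w (fun i => k i / T)) k :=
    tsum_eq_sum fun k hk => by rw [Set.indicator_apply, hF k hk, ite_self]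
  rw [Finset.sum_congr rfl hinner, ← hsum]
  exact tsum_subtype {a : Fin n → ℤ | Finset.univ.gcd a = 1 ∧ ∀ i, 0 < a i}
    (fun k => w (fun i => k i / T))

/-- Equidistribution of primitive integer vectors. -/
theorem tendsto_tsum_posPrim (hn : 2 ≤ n) {w : (Fin n → ℝ) → ℝ} {C y : ℝ}
    (hC : ∀ x, |w x| ≤ C) (hy : 0 ≤ y) (hw : ∀ x, w x ≠ 0 → ∀ i, 0 < x i ∧ x i ≤ y)
    (hcont : ∀ᵐ x, ContinuousAt w x) :
    Tendsto (fun T : ℝ => (∑' a : PosPrim n, w (fun i => a.1 i / T)) / T ^ n) atTop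
      (𝓝 ((∫ x, w x) / zetaVal n)) := by
  have : NeZero n := ⟨by omega⟩
  have hC0 : 0 ≤ C := (abs_nonneg _).trans (hC 0)
  have hA : Tendsto (fun s : ℝ => (∑' k : Fin n → ℤ, w (fun i => k i / s)) / s ^ n) atTop
      (𝓝 (∫ x, w x)) := by
    have h := tendsto_riemannSum hC (y := y) (fun x hx i => by
      rw [abs_of_pos (hw x hx i).1]; exact (hw x hx i).2) hcont one_pos 0
    simp only [Nat.cast_one, one_pow, div_one, Fintype.card_fin] at h
    refine h.congr fun s => ?_
    congr 1
    refine tsum_congr fun k => ?_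
    congr 1
    ext i
    simp [div_eq_inv_mul]
  have hlim : Tendsto (fun T : ℝ => ∑' g : ℕ, (ArithmeticFunction.moebius g : ℝ) *
      (∑' k : Fin n → ℤ, w (fun i => k i / (T / g))) / T ^ n) atTop
      (𝓝 (∑' g : ℕ, (ArithmeticFunction.moebius g : ℝ) / (g : ℝ) ^ n * ∫ x, w x)) := by
    refine tendsto_tsum_of_dominated_convergence
      (bound := fun g : ℕ => C * y ^ n * (1 / (g : ℝ) ^ n))
      ((Real.summable_one_div_nat_pow.2 (by omega)).mul_left _) (fun g => ?_) ?_
    · rcases eq_or_ne g 0 with rfl | hg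
      · simp
      have hg' : (0 : ℝ) < g := by exact_mod_cast Nat.pos_of_ne_zero hg
      refine ((hA.comp (tendsto_id.atTop_div_const hg')).const_mul
        ((ArithmeticFunction.moebius g : ℝ) / (g : ℝ) ^ n)).congr' ?_
      filter_upwards [eventually_gt_atTop 0] with T hT
      simp only [Function.comp, id]
      generalize ∑' k : Fin n → ℤ, w (fun i => k i / (T / g)) = S
      rw [div_pow]
      field_simp
    · filter_upwards [eventually_gt_atTop 0] with T hT g
      rcases eq_or_ne g 0 with rfl | hg
      · simp; positivity
      have hg' : (0 : ℝ) < g := by exact_mod_cast Nat.pos_of_ne_zero hg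
      have h1 := abs_tsum_le_of_support hC hy hw (div_pos hT hg')
      have h2 : |(ArithmeticFunction.moebius g : ℝ)| ≤ 1 := by
        exact_mod_cast ArithmeticFunction.abs_moebius_le_one
      rw [Real.norm_eq_abs, abs_div, abs_mul, abs_of_pos (pow_pos hT n),
        div_le_iff₀ (pow_pos hT n)]
      calc _ ≤ 1 * (C * (y * (T / g)) ^ n) := mul_le_mul h2 h1 (abs_nonneg _) zero_le_one
        _ = _ := by rw [mul_pow, div_pow]; field_simp
  rw [tsum_mul_right, tsum_moebius_div_pow hn, inv_mul_eq_div] at hlim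
  refine hlim.congr' ?_
  filter_upwards [eventually_gt_atTop 0] with T hT
  rw [tsum_div_const, tsum_posPrim_eq hw hT]

end PrimitiveVectors

section ShortOrthogonalVectors

variable {e : ℕ}

lemma exists_residue_translates {x : Fin (e + 1) → ℤ} (hx : Finset.univ.gcd x = 1)
    (k : Fin (e + 1)) (hk : x k ≠ 0) :
    ∃ u : Fin (x k).natAbs → Fin e → ℤ, (∀ r j, 0 ≤ u r j ∧ u r j < |x k|) ∧
      ∀ r, (∑ j, u r j * x (k.succAbove j)) ≡ (r : ℤ) [ZMOD x k] := by
  obtain ⟨v, hv⟩ : ∃ v : Fin (e + 1) → ℤ, ∑ j, x j * v j = 1 := by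
    obtain ⟨v, hv⟩ := Finset.gcd_eq_sum_mul (Finset.univ : Finset (Fin (e + 1))) x
    exact ⟨v, by rw [← hx, hv]⟩
  refine ⟨fun r j => (r * v (k.succAbove j)) % x k, fun r j =>
    ⟨Int.emod_nonneg _ hk, Int.emod_lt_abs _ hk⟩, fun r => ?_⟩
  have h1 : (∑ j, (r : ℤ) * v (k.succAbove j) % x k * x (k.succAbove j)) ≡
      ∑ j, (r : ℤ) * v (k.succAbove j) * x (k.succAbove j) [ZMOD x k] := by
    rw [Int.modEq_iff_dvd, ← Finset.sum_sub_distrib]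
    refine Finset.dvd_sum fun j _ => ?_
    rw [← sub_mul]
    exact (Int.dvd_self_sub_emod).mul_right _
  refine h1.trans ?_
  rw [Fin.sum_univ_succAbove _ k] at hv
  have h2 : ∑ j, (r : ℤ) * v (k.succAbove j) * x (k.succAbove j) =
      r - x k * (r * v k) := by
    calc _ = (r : ℤ) * ∑ j, x (k.succAbove j) * v (k.succAbove j) := by
          rw [Finset.mul_sum]; exact Finset.sum_congr rfl fun j _ => by ring
      _ = _ := by
          rw [eq_sub_of_add_eq' hv]; ring
  rw [h2, Int.modEq_iff_dvd]
  exact ⟨r * v k, by ring⟩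

lemma natAbs_mul_card_le (A : ℕ) (k : Fin (e + 1)) {v : ℤ} (hv : v ≠ 0)
    (Z : Finset (Fin (e + 1) → ℤ)) (hA : ∀ a ∈ Z, ∀ i, 0 < a i ∧ a i ≤ A)
    (hZ : ∀ a ∈ Z, ∃ x : Fin (e + 1) → ℤ, Finset.univ.gcd x = 1 ∧ x k = v ∧
      (∀ j, |x j| ≤ |v|) ∧ ∑ i, a i * x i = 0) :
    v.natAbs * Z.card ≤ (2 * v.natAbs + 1) ^ e * (A + v.natAbs) ^ e := by
  classical
  choose! x hx1 hxk hxle hx0 using hZ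
  have hu : ∀ z : Fin (e + 1) → ℤ, Finset.univ.gcd z = 1 ∧ z k = v →
      ∃ u : Fin v.natAbs → Fin e → ℤ, (∀ r j, 0 ≤ u r j ∧ u r j < |v|) ∧
        ∀ r, (∑ j, u r j * z (k.succAbove j)) ≡ (r : ℤ) [ZMOD v] := by
    rintro z ⟨hz, rfl⟩
    exact exists_residue_translates hz k hv
  choose! u hu1 hu2 using hu
  have hcard := Finset.card_le_card_of_injOn
    (s := Z ×ˢ (Finset.univ : Finset (Fin v.natAbs)))
    (t := (Fintype.piFinset fun _ : Fin e => Finset.Icc (-|v|) |v|) ×ˢ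
      (Fintype.piFinset fun _ : Fin e => Finset.Icc 1 ((A : ℤ) + |v|)))
    (fun p => (fun j => x p.1 (k.succAbove j), fun j => p.1 (k.succAbove j) + u (x p.1) p.2 j))
    ?_ ?_
  · rw [Finset.card_product, Finset.card_product, Fintype.card_piFinset_const,
      Fintype.card_piFinset_const, Int.card_Icc, Int.card_Icc, Finset.card_univ,
      Fintype.card_fin] at hcard
    rw [mul_comm]
    refine hcard.trans (le_of_eq ?_)
    have habs := Int.abs_eq_natAbs v
    rw [show (|v| + 1 - -|v|).toNat = 2 * v.natAbs + 1 by omega,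
      show ((A : ℤ) + |v| + 1 - 1).toNat = A + v.natAbs by omega]
  · rintro ⟨a, r⟩ h
    obtain ⟨ha, -⟩ := Finset.mem_product.1 (Finset.mem_coe.1 h)
    refine Finset.mem_coe.2 (Finset.mem_product.2 ⟨?_, ?_⟩)
    · exact Fintype.mem_piFinset.2 fun j => Finset.mem_Icc.2 (abs_le.1 (hxle a ha _))
    · refine Fintype.mem_piFinset.2 fun j => Finset.mem_Icc.2 ?_
      have h1 := hA a ha (k.succAbove j)
      have h2 := hu1 (x a) ⟨hx1 a ha, hxk a ha⟩ r j
      dsimp only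
      omega
  · rintro ⟨a, r⟩ h ⟨b, s⟩ h' hab
    obtain ⟨ha, -⟩ := Finset.mem_product.1 (Finset.mem_coe.1 h)
    obtain ⟨hb, -⟩ := Finset.mem_product.1 (Finset.mem_coe.1 h')
    obtain ⟨hxab, huab⟩ := Prod.ext_iff.1 hab
    dsimp only at ha hb hxab huab
    have hkey : ∀ c ∈ Z, ∀ t, (∑ j, (c (k.succAbove j) + u (x c) t j) * x c (k.succAbove j)) ≡
        (t : ℤ) [ZMOD v] := by
      intro c hc t
      have h0 := hx0 c hc
      rw [Fin.sum_univ_succAbove _ k, hxk c hc] at h0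
      simp only [add_mul, Finset.sum_add_distrib]
      rw [eq_neg_of_add_eq_zero_right h0]
      have h3 := (hu2 (x c) ⟨hx1 c hc, hxk c hc⟩ t).add_left (-(c k * v))
      refine h3.trans ?_
      rw [Int.modEq_iff_dvd]
      exact ⟨c k, by ring⟩
    have hrs : ((r : ℕ) : ℤ) ≡ (s : ℕ) [ZMOD v] := by
      refine (hkey a ha r).symm.trans (Int.ModEq.trans ?_ (hkey b hb s))
      rw [Finset.sum_congr rfl fun j _ => by rw [congrFun huab j, congrFun hxab j]]
    have hrs' : r = s := by
      have h4 := Int.modEq_natAbs.2 hrs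
      rw [Int.natCast_modEq_iff] at h4
      exact Fin.ext (Nat.ModEq.eq_of_lt_of_lt h4 r.2 s.2)
    subst hrs'
    have hxx : x a = x b := by
      funext j
      rcases Fin.eq_self_or_eq_succAbove k j with rfl | ⟨i, rfl⟩
      · rw [hxk a ha, hxk b hb]
      · exact congrFun hxab i
    rw [hxx] at huab
    have hoff : ∀ j, a (k.succAbove j) = b (k.succAbove j) := fun j =>
      add_right_cancel (congrFun huab j)
    have hk : a k = b k := by
      have h5 := (hx0 a ha).trans (hx0 b hb).symm
      rw [hxx, Fin.sum_univ_succAbove _ k, Fin.sum_univ_succAbove _ k,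
        Finset.sum_congr rfl fun j _ => by rw [hoff j], hxk b hb] at h5
      exact mul_right_cancel₀ hv (add_right_cancel h5)
    refine Prod.ext (funext fun j => ?_) rfl
    rcases Fin.eq_self_or_eq_succAbove k j with rfl | ⟨i, rfl⟩
    · exact hk
    · exact hoff i

lemma card_le_of_short_orthogonal (he : 1 ≤ e) (A X : ℕ) (Z : Finset (Fin (e + 1) → ℤ))
    (hA : ∀ a ∈ Z, ∀ i, 0 < a i ∧ a i ≤ A)
    (hZ : ∀ a ∈ Z, ∃ x : Fin (e + 1) → ℤ, x ≠ 0 ∧ (∀ j, |x j| ≤ X) ∧ ∑ i, a i * x i = 0) :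
    Z.card ≤ (e + 1) * (2 * X) * (3 ^ e * (A + X) ^ e * X ^ (e - 1)) := by
  classical
  let W : Fin (e + 1) → ℤ → Finset (Fin (e + 1) → ℤ) := fun k v => Z.filter fun a =>
    ∃ x : Fin (e + 1) → ℤ, Finset.univ.gcd x = 1 ∧ x k = v ∧
      (∀ j, |x j| ≤ |v|) ∧ ∑ i, a i * x i = 0
  have hW : ∀ k, ∀ v ∈ (Finset.Icc (-X : ℤ) X).erase 0,
      (W k v).card ≤ 3 ^ e * (A + X) ^ e * X ^ (e - 1) := by
    intro k v hv
    obtain ⟨hv0, hvX⟩ := Finset.mem_erase.1 hv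
    rw [Finset.mem_Icc] at hvX
    have h1 := natAbs_mul_card_le A k hv0 (W k v)
      (fun a ha => hA a (Finset.mem_filter.1 ha).1) (fun a ha => (Finset.mem_filter.1 ha).2)
    have hpos : 0 < v.natAbs := Int.natAbs_pos.2 hv0
    have hle : v.natAbs ≤ X := by omega
    refine Nat.le_of_mul_le_mul_left (h1.trans ?_) hpos
    calc (2 * v.natAbs + 1) ^ e * (A + v.natAbs) ^ e
        ≤ (3 * v.natAbs) ^ e * (A + X) ^ e := by gcongr; omega
      _ = v.natAbs * (3 ^ e * (A + X) ^ e * v.natAbs ^ (e - 1)) := by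
          obtain ⟨f, rfl⟩ := Nat.exists_eq_add_of_le' he
          rw [Nat.add_sub_cancel]
          ring
      _ ≤ _ := by gcongr
  have hsub : Z ⊆ Finset.univ.biUnion fun k => ((Finset.Icc (-X : ℤ) X).erase 0).biUnion (W k) := by
    intro a ha
    obtain ⟨x, hx0, hxX, hax⟩ := hZ a ha
    obtain ⟨z, hxz, hz⟩ := Finset.extract_gcd x (s := Finset.univ) ⟨0, Finset.mem_univ _⟩
    have hg0 : Finset.univ.gcd x ≠ 0 := fun h =>
      hx0 (funext fun i => Finset.gcd_eq_zero_iff.1 h i (Finset.mem_univ i))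
    obtain ⟨k, -, hk⟩ := Finset.exists_max_image Finset.univ (fun j => |z j|)
      ⟨0, Finset.mem_univ _⟩
    have haz : ∑ i, a i * z i = 0 := by
      refine (mul_eq_zero.1 (Eq.trans ?_ hax)).resolve_left hg0
      rw [Finset.mul_sum]
      refine Finset.sum_congr rfl fun i _ => ?_
      rw [hxz i (Finset.mem_univ i)]
      ring
    have hzk : z k ≠ 0 := fun h => by
      have : ∀ j, z j = 0 := fun j => by
        have := hk j (Finset.mem_univ j)
        rw [h, abs_zero] at this
        exact abs_nonpos_iff.1 this
      exact hx0 (funext fun i => by rw [hxz i (Finset.mem_univ i), this, mul_zero]; rfl)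
    have hzX : |z k| ≤ X := by
      refine le_trans ?_ (hxX k)
      rw [hxz k (Finset.mem_univ k), abs_mul]
      exact le_mul_of_one_le_left (abs_nonneg _) (Int.one_le_abs hg0)
    refine Finset.mem_biUnion.2 ⟨k, Finset.mem_univ k, Finset.mem_biUnion.2 ⟨z k,
      Finset.mem_erase.2 ⟨hzk, Finset.mem_Icc.2 (abs_le.1 hzX)⟩, Finset.mem_filter.2 ⟨ha, z, hz,
      rfl, fun j => hk j (Finset.mem_univ j), haz⟩⟩⟩
  refine (Finset.card_le_card hsub).trans ?_
  rw [mul_assoc]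
  refine (Finset.card_biUnion_le_card_mul _ _ (2 * X * (3 ^ e * (A + X) ^ e * X ^ (e - 1)))
    fun k _ => ?_).trans_eq (by rw [Finset.card_univ, Fintype.card_fin])
  refine (Finset.card_biUnion_le_card_mul _ _ _ (hW k)).trans_eq ?_
  rw [Finset.card_erase_of_mem (Finset.mem_Icc.2 ⟨by omega, by omega⟩), Int.card_Icc]
  congr 1
  omega

end ShortOrthogonalVectors

section ReducedBasis

variable {e : ℕ}

lemma exists_linearForm_of_det_eq_zero (P : Set (Fin e → ℤ))
    (hP : ∀ V : Matrix (Fin e) (Fin e) ℤ, (∀ i, V i ∈ P) → V.det = 0) :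
    ∃ c : Fin e → ℝ, c ≠ 0 ∧ ∀ x ∈ P, ∑ j, c j * x j = 0 := by
  set Q : Set (Fin e → ℝ) := (fun x j => (x j : ℝ)) '' P
  have hspan : Submodule.span ℝ Q < ⊤ := by
    rw [lt_top_iff_ne_top]
    intro htop
    obtain ⟨b, hbQ, hb, hli⟩ := exists_linearIndependent ℝ Q
    rw [htop] at hb
    let bas := Module.Basis.mk hli (by rw [Subtype.range_coe, hb])
    have : Fintype b := FiniteDimensional.fintypeBasisIndex bas
    have σ : Fin e ≃ b := Fintype.equivOfCardEq (by
      rw [← Module.finrank_eq_card_basis bas, Module.finrank_fin_fun, Fintype.card_fin])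
    have hrow : ∀ i, ∃ x ∈ P, (fun j => (x j : ℝ)) = σ i := fun i => hbQ (σ i).2
    choose V hVP hV using hrow
    have h0 := hP (Matrix.of V) hVP
    have hli' : LinearIndependent ℝ ((Matrix.of V).map (Int.cast : ℤ → ℝ)).row := by
      have h1 := hli.comp σ σ.injective
      have h2 : ((Matrix.of V).map (Int.cast : ℤ → ℝ)).row = (Subtype.val ∘ σ) :=
        funext fun i => hV i
      rw [h2]
      exact h1
    rw [Matrix.linearIndependent_rows_iff_isUnit, Matrix.isUnit_iff_isUnit_det] at hli'
    refine hli'.ne_zero ?_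
    have h2 := (Int.castRingHom ℝ).map_det (Matrix.of V)
    rw [h0, map_zero] at h2
    exact h2.symm
  obtain ⟨f, hf, hker⟩ := Submodule.exists_le_ker_of_lt_top _ hspan
  refine ⟨fun j => f (Pi.single j 1), fun h => hf ?_, fun x hx => ?_⟩
  · refine LinearMap.pi_ext' fun j => LinearMap.ext_ring ?_
    exact congrFun h j
  · have h1 : f (fun j => (x j : ℝ)) = 0 :=
      hker (Submodule.subset_span ⟨x, hx, rfl⟩)
    rw [LinearMap.pi_apply_eq_sum_univ] at h1
    rw [← h1]
    refine Finset.sum_congr rfl fun j _ => ?_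
    rw [smul_eq_mul, mul_comm]
    congr 1
    refine congrArg f (funext fun i => ?_)
    simp [Pi.single_apply, eq_comm]

lemma card_le_of_linearForm {c : Fin e → ℝ} (hc : c ≠ 0) (P : Finset (Fin e → ℤ))
    (hP : ∀ x ∈ P, ∑ j, c j * x j = 0) {s : ℝ} (hs : 0 < s) (B : ℕ)
    (hB : ∀ x ∈ P, ∀ j, e * |(x j : ℝ)| ≤ B * s)
    (hsep : ∀ x ∈ P, ∀ y ∈ P, (∀ j, |(x j : ℝ) - y j| < s) → x = y) :
    P.card ≤ (2 * B + 1) ^ (e - 1) := by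
  classical
  obtain ⟨i₀, hi₀⟩ := Function.ne_iff.1 hc
  obtain ⟨k, -, hk⟩ := Finset.exists_max_image Finset.univ (fun j => |c j|)
    ⟨i₀, Finset.mem_univ _⟩
  have hck : 0 < |c k| := (abs_pos.2 hi₀).trans_le (hk i₀ (Finset.mem_univ _))
  have he : (0 : ℝ) < e := by exact_mod_cast (Nat.zero_le _).trans_lt k.2
  have hcard := Finset.card_le_card_of_injOn (s := P)
    (t := Fintype.piFinset fun j : Fin e => if j = k then {0} else Finset.Icc (-B : ℤ) B)
    (fun x j => if j = k then 0 else ⌊e * (x j : ℝ) / s⌋) ?_ ?_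
  · refine hcard.trans_eq ?_
    rw [Fintype.card_piFinset, ← Finset.mul_prod_erase _ _ (Finset.mem_univ k), if_pos rfl,
      Finset.card_singleton, one_mul, Finset.prod_congr rfl (g := fun _ => 2 * B + 1),
      Finset.prod_const, Finset.card_erase_of_mem (Finset.mem_univ k), Finset.card_univ,
      Fintype.card_fin]
    intro j hj
    rw [if_neg (Finset.ne_of_mem_erase hj), Int.card_Icc]
    omega
  · intro x hx
    refine Finset.mem_coe.2 (Fintype.mem_piFinset.2 fun j => ?_)
    dsimp only
    split_ifs with hj
    · exact Finset.mem_singleton_self _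
    · have h1 := hB x hx j
      have h2 : |e * (x j : ℝ) / s| ≤ B := by
        rwa [abs_div, abs_mul, abs_of_pos he, abs_of_pos hs, div_le_iff₀ hs]
      obtain ⟨h3, h4⟩ := abs_le.1 h2
      rw [Finset.mem_Icc, Int.le_floor]
      refine ⟨by push_cast; exact h3, ?_⟩
      have := (Int.floor_le (e * (x j : ℝ) / s)).trans h4
      exact_mod_cast this
  · intro x hx y hy hxy
    have hoff : ∀ j, j ≠ k → |(x j : ℝ) - y j| < s / e := by
      intro j hj
      have h1 := congrFun hxy j
      simp only [if_neg hj] at h1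
      have h2 := Int.abs_sub_lt_one_of_floor_eq_floor h1
      rw [← sub_div, ← mul_sub, abs_div, abs_mul, abs_of_pos he, abs_of_pos hs,
        div_lt_one hs] at h2
      rwa [lt_div_iff₀ he, mul_comm]
    have he1 : 1 ≤ e := (Nat.zero_le _).trans_lt k.2
    have hle : s / e ≤ s := div_le_self hs.le (by exact_mod_cast he1)
    refine hsep x hx y hy fun j => ?_
    by_cases hj : j = k
    swap
    · exact (hoff j hj).trans_le hle
    subst hj
    have h1 : ∑ i, c i * ((x i : ℝ) - y i) = 0 := by
      simp only [mul_sub, Finset.sum_sub_distrib]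
      rw [hP x hx, hP y hy, sub_zero]
    rw [← Finset.add_sum_erase _ _ (Finset.mem_univ j)] at h1
    have h2 : |c j| * |(x j : ℝ) - y j| ≤ |c j| * ∑ i ∈ Finset.univ.erase j, |(x i : ℝ) - y i| := by
      rw [← abs_mul, eq_neg_of_add_eq_zero_left h1, abs_neg, Finset.mul_sum]
      refine (Finset.abs_sum_le_sum_abs _ _).trans (Finset.sum_le_sum fun i _ => ?_)
      rw [abs_mul]
      exact mul_le_mul_of_nonneg_right (hk i (Finset.mem_univ i)) (abs_nonneg _)
    refine (le_of_mul_le_mul_left h2 hck).trans_lt ?_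
    refine (Finset.sum_le_card_nsmul _ _ (s / e) fun i hi =>
      (hoff i (Finset.ne_of_mem_erase hi)).le).trans_lt ?_
    rw [Finset.card_erase_of_mem (Finset.mem_univ j), Finset.card_univ, Fintype.card_fin,
      nsmul_eq_mul, Nat.cast_sub he1, Nat.cast_one, sub_mul, mul_div_cancel₀ _ he.ne', one_mul]
    exact sub_lt_self _ (by positivity)

/-- If the congruence lattice of `a` has no short vectors, it contains a full-rank system of
vectors of controlled size. -/
lemma exists_det_ne_zero_of_no_short {a : Fin e → ℤ} {q : ℤ} (hq : 0 < q) {s : ℝ} (hs : 0 < s)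
    {M B : ℕ} (hMB : (e : ℝ) * M ≤ B * s)
    (hcard : q.toNat * (2 * B + 1) ^ (e - 1) < (M + 1) ^ e)
    (hshort : ∀ x : Fin e → ℤ, q ∣ ∑ i, a i * x i → (∀ j, |(x j : ℝ)| < s) → x = 0) :
    ∃ V : Matrix (Fin e) (Fin e) ℤ, V.det ≠ 0 ∧ (∀ i j, |V i j| ≤ M) ∧
      ∀ i, q ∣ ∑ j, a j * V i j := by
  classical
  by_contra! hcon
  set F : Finset (Fin e → ℤ) := Fintype.piFinset fun _ => Finset.Icc (0 : ℤ) M with hF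
  have hFcard : F.card = (M + 1) ^ e := by
    rw [hF, Fintype.card_piFinset_const, Int.card_Icc]
    congr 1
  obtain ⟨r, -, hr⟩ := Finset.exists_lt_card_fiber_of_mul_lt_card_of_maps_to
    (s := F) (t := Finset.Ico 0 q) (f := fun x => (∑ i, a i * x i) % q)
    (n := (2 * B + 1) ^ (e - 1))
    (fun x _ => Finset.mem_Ico.2 ⟨Int.emod_nonneg _ hq.ne', Int.emod_lt_of_pos _ hq⟩)
    (by rwa [hFcard, Int.card_Ico, sub_zero])
  set G := F.filter fun x => (∑ i, a i * x i) % q = r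
  obtain ⟨x₀, hx₀⟩ : G.Nonempty := Finset.card_pos.1 ((Nat.zero_le _).trans_lt hr)
  set P := G.image fun x => x - x₀
  have hPcard : P.card = G.card := Finset.card_image_of_injective _ (sub_left_injective)
  have hPbound : ∀ x ∈ P, ∀ j, |x j| ≤ M := by
    intro x hx j
    obtain ⟨z, hz, rfl⟩ := Finset.mem_image.1 hx
    have h1 := Finset.mem_Icc.1 (Fintype.mem_piFinset.1 (Finset.mem_filter.1 hz).1 j)
    have h2 := Finset.mem_Icc.1 (Fintype.mem_piFinset.1 (Finset.mem_filter.1 hx₀).1 j)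
    rw [Pi.sub_apply, abs_le]
    omega
  have hPdvd : ∀ x ∈ P, q ∣ ∑ i, a i * x i := by
    intro x hx
    obtain ⟨z, hz, rfl⟩ := Finset.mem_image.1 hx
    simp only [Pi.sub_apply, mul_sub, Finset.sum_sub_distrib]
    refine Int.dvd_of_emod_eq_zero ?_
    exact Int.emod_eq_emod_iff_emod_sub_eq_zero.1
      ((Finset.mem_filter.1 hz).2.trans (Finset.mem_filter.1 hx₀).2.symm)
  obtain ⟨c, hc, hcP⟩ := exists_linearForm_of_det_eq_zero (P : Set (Fin e → ℤ)) fun V hV => by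
    by_contra h
    obtain ⟨i, hi⟩ := hcon V h fun i j => hPbound _ (hV i) j
    exact hi (hPdvd _ (hV i))
  have h := card_le_of_linearForm hc P hcP hs B (fun x hx j => le_trans ?_ hMB) ?_
  · rw [hPcard] at h
    omega
  · refine mul_le_mul_of_nonneg_left ?_ (Nat.cast_nonneg _)
    exact_mod_cast hPbound x hx j
  · intro x hx y hy hxy
    refine sub_eq_zero.1 (hshort (x - y) ?_ fun j => ?_)
    · simp only [Pi.sub_apply, mul_sub, Finset.sum_sub_distrib]
      exact dvd_sub (hPdvd x hx) (hPdvd y hy)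
    · rw [Pi.sub_apply, Int.cast_sub]
      exact hxy j

lemma HermiteFamily.finite_det_le (P : HermiteFamily e) (I : ℕ) :
    {i | (P.mat i).det ≤ I}.Finite := by
  have h := (P.summable (e + 1) le_rfl).tendsto_cofinite_zero
  have hpos : (0 : ℝ) < (((I : ℝ) + 1) ^ (e + 1))⁻¹ := by positivity
  refine (Filter.eventually_cofinite.1 (h.eventually (gt_mem_nhds hpos))).subset fun i hi => ?_
  have h1 : (0 : ℝ) < (P.mat i).det := by exact_mod_cast P.det_pos i
  have h2 : ((P.mat i).det : ℝ) ≤ I := by exact_mod_cast hi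
  refine not_lt.2 ?_
  gcongr
  linarith

lemma exists_mul_bound (I : ℕ) : ∃ K : ℕ, ∀ B N : Matrix (Fin e) (Fin e) ℤ, 0 < N.det →
    N.det ≤ I → ∀ M : ℕ, (∀ i j, |(B * N) i j| ≤ M) →
    ∃ γ : Matrix.SpecialLinearGroup (Fin e) ℤ, ∀ i j, |(B * γ.1) i j| ≤ K * M := by
  obtain ⟨P⟩ := nonempty_hermiteFamily e
  refine ⟨∑ p ∈ (P.finite_det_le I).toFinset, ∑ l, ∑ k, ((P.mat p)ᵀ.adjugate l k).natAbs,
    fun B N hN hI M hM => ?_⟩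
  obtain ⟨p, γ, hγ⟩ := P.factor Nᵀ (by rwa [Matrix.det_transpose])
  have hNγ : N = γ.1ᵀ * (P.mat p)ᵀ := by
    rw [← Matrix.transpose_mul, ← hγ, Matrix.transpose_transpose]
  refine ⟨γ.transpose, fun i j => ?_⟩
  have hdet : (P.mat p).det = N.det := by
    rw [hNγ, Matrix.det_mul, Matrix.det_transpose, Matrix.det_transpose, γ.2, one_mul]
  have hadj : B * N * (P.mat p)ᵀ.adjugate = (P.mat p).det • (B * γ.1ᵀ) := by
    rw [hNγ, ← Matrix.mul_assoc, Matrix.mul_assoc _ _ (P.mat p)ᵀ.adjugate, Matrix.mul_adjugate,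
      Matrix.det_transpose, Matrix.mul_smul, Matrix.mul_one]
  have h1 := congrFun (congrFun hadj i) j
  rw [Matrix.smul_apply, smul_eq_mul, Matrix.mul_apply] at h1
  have h2 : |(B * γ.1ᵀ) i j| ≤ ∑ l, |(P.mat p)ᵀ.adjugate l j| * M := by
    calc |(B * γ.1ᵀ) i j| ≤ (P.mat p).det * |(B * γ.1ᵀ) i j| :=
          le_mul_of_one_le_left (abs_nonneg _) (P.det_pos p)
      _ = |∑ l, (B * N) i l * (P.mat p)ᵀ.adjugate l j| := by
          rw [h1, abs_mul, abs_of_pos (P.det_pos p)]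
      _ ≤ ∑ l, |(B * N) i l * (P.mat p)ᵀ.adjugate l j| := Finset.abs_sum_le_sum_abs _ _
      _ ≤ _ := Finset.sum_le_sum fun l _ => by
          rw [abs_mul, mul_comm]
          exact mul_le_mul_of_nonneg_left (hM i l) (abs_nonneg _)
  refine h2.trans ?_
  rw [← Finset.sum_mul]
  refine mul_le_mul_of_nonneg_right ?_ (Nat.cast_nonneg _)
  have hp : p ∈ (P.finite_det_le I).toFinset := by
    rw [Set.Finite.mem_toFinset]
    exact hdet.trans_le hI
  have h3 := Finset.single_le_sum (f := fun p => ∑ l, ∑ k, ((P.mat p)ᵀ.adjugate l k).natAbs)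
    (fun _ _ => Nat.zero_le _) hp
  have h4 : ∑ l, ((P.mat p)ᵀ.adjugate l j).natAbs ≤ ∑ l, ∑ k, ((P.mat p)ᵀ.adjugate l k).natAbs :=
    Finset.sum_le_sum fun l _ => Finset.single_le_sum
      (f := fun k => ((P.mat p)ᵀ.adjugate l k).natAbs) (fun _ _ => Nat.zero_le _)
      (Finset.mem_univ j)
  have h5 : ∑ l, |(P.mat p)ᵀ.adjugate l j| = ((∑ l, ((P.mat p)ᵀ.adjugate l j).natAbs : ℕ) : ℤ) := by
    push_cast
    rfl
  rw [h5]
  exact_mod_cast h4.trans h3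

lemma geomScale_ge [NeZero e] {a : Fin (e + 1) → ℤ} {η T : ℝ} (hη : 0 < η) (hT : 0 < T)
    (ha : ∀ i, η * T ≤ a i) :
    (η ^ (e + 1)) ^ (1 / (e : ℝ)) * (T * T ^ (1 / (e : ℝ))) ≤ geomScale a := by
  have he : e ≠ 0 := NeZero.ne e
  have h1 : (η ^ (e + 1)) ^ (1 / (e : ℝ)) * (T * T ^ (1 / (e : ℝ))) =
      ((η * T) ^ (e + 1)) ^ (1 / (e : ℝ)) := by
    rw [mul_pow, Real.mul_rpow (by positivity) (by positivity), pow_succ T,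
      Real.mul_rpow (by positivity) hT.le, one_div, Real.pow_rpow_inv_natCast hT.le he]
  rw [h1]
  refine Real.rpow_le_rpow (by positivity) ?_ (by positivity)
  calc (η * T) ^ (e + 1) = ∏ _i : Fin (e + 1), η * T := by simp
    _ ≤ _ := Finset.prod_le_prod (fun _ _ => by positivity) fun i _ => ha i

/-- The congruence lattice of `a` contains a nonzero vector of size less than `s`. -/
def HasShort (a : Fin (e + 1) → ℤ) (s : ℝ) : Prop :=
  ∃ x : Fin e → ℤ, x ≠ 0 ∧ a (Fin.last e) ∣ ∑ i, a (Fin.castSucc i) * x i ∧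
    ∀ j, |(x j : ℝ)| < s

lemma exists_det_pos_of_not_hasShort [NeZero e] {a : PosPrim (e + 1)} {s : ℝ} (hs : 0 < s)
    {M B : ℕ} (hMB : (e : ℝ) * M ≤ B * s)
    (hcard : (a.1 (Fin.last e)).toNat * (2 * B + 1) ^ (e - 1) < (M + 1) ^ e)
    (hshort : ¬ HasShort a.1 s) :
    ∃ N : Matrix (Fin e) (Fin e) ℤ, 0 < N.det ∧ ∀ i j, |(kerB a.1 * N) i j| ≤ M := by
  have hB := isKernelBasis_ker a.2.1
  have hq : 0 < a.1 (Fin.last e) := a.2.2 _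
  obtain ⟨V, hV0, hVM, hV⟩ := exists_det_ne_zero_of_no_short (a := fun i => a.1 i.castSucc)
    hq hs hMB hcard fun x hx hxs => by_contra fun h => hshort ⟨x, h, hx, hxs⟩
  obtain ⟨W, hW0, hWM, hW⟩ : ∃ W : Matrix (Fin e) (Fin e) ℤ, 0 < W.det ∧ (∀ i j, |W i j| ≤ M) ∧
      ∀ i, a.1 (Fin.last e) ∣ ∑ j, a.1 (Fin.castSucc j) * W i j := by
    rcases hV0.lt_or_gt with h | h
    · refine ⟨Matrix.of fun i j => (if i = 0 then -1 else 1) * V i j, ?_, fun i j => ?_, fun i => ?_⟩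
      · rw [Matrix.det_mul_column, Finset.prod_ite_eq' Finset.univ (0 : Fin e) fun _ => (-1 : ℤ),
          if_pos (Finset.mem_univ _)]
        omega
      · rw [Matrix.of_apply, abs_mul]
        split_ifs <;> simpa using hVM i j
      · simp only [Matrix.of_apply, mul_left_comm _ (ite _ _ _), ← Finset.mul_sum]
        exact (hV i).mul_left _
    · exact ⟨V, h, hVM, hV⟩
  choose N hN using fun i => (hB.dvd_iff _).1 (hW i)
  have hWN : kerB a.1 * (Matrix.of N)ᵀ = Wᵀ := by
    ext i j
    exact (congrFun (hN j) i).symm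
  refine ⟨(Matrix.of N)ᵀ, ?_, fun i j => ?_⟩
  · rw [← Matrix.det_transpose W, ← hWN, Matrix.det_mul, hB.det_eq] at hW0
    exact pos_of_mul_pos_right hW0 hq.le
  · rw [hWN]
    exact hWM j i

/-- Points of the form `latticePoint a` without short vectors stay in a compact part of the space
of lattices. -/
theorem exists_orbitSum_cutoff_latticePoint [NeZero e] {ε η y : ℝ} (hε : 0 < ε) (hη : 0 < η)
    (hy : 0 ≤ y) : ∃ n₀ : ℕ, ∀ n ≥ n₀, ∀ T : ℝ, 1 ≤ T → ∀ a : PosPrim (e + 1),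
      (∀ i, η * T ≤ a.1 i ∧ a.1 i ≤ y * T) → ¬ HasShort a.1 (ε * T ^ (1 / (e : ℝ))) →
      orbitSum (cutoff e n) (latticePoint a.1) = 1 := by
  have he : 1 ≤ e := NeZero.one_le
  have he0 : (0 : ℝ) < e := by exact_mod_cast he
  set C : ℝ := 1 + y * (4 * e / ε + 3) ^ (e - 1) with hC
  have hC1 : 1 ≤ C := le_add_of_nonneg_right (by positivity)
  set I : ℕ := ⌈(e.factorial : ℝ) * (2 * C) ^ e / η⌉₊ with hI
  obtain ⟨K, hK⟩ := exists_mul_bound (e := e) I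
  refine ⟨⌈((η ^ (e + 1)) ^ (1 / (e : ℝ)))⁻¹ * (y * (K * (2 * C)))⌉₊,
    fun n hn T hT a ha hshort => ?_⟩
  have hn' := Nat.ceil_le.1 hn
  have hT0 : 0 < T := by linarith
  set θ : ℝ := T ^ (1 / (e : ℝ)) with hθ
  have hθ1 : 1 ≤ θ := Real.one_le_rpow hT (by positivity)
  have hθe : θ ^ e = T := by
    rw [hθ, one_div, Real.rpow_inv_natCast_pow hT0.le (NeZero.ne e)]
  set M : ℕ := ⌈C * θ⌉₊ with hM
  set B : ℕ := ⌈2 * e * C / ε⌉₊ with hB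
  have hCθ : 1 ≤ C * θ := one_le_mul_of_one_le_of_one_le hC1 hθ1
  have hM1 : C * θ ≤ M := Nat.le_ceil _
  have hM2 : (M : ℝ) ≤ 2 * C * θ := by
    have := (Nat.ceil_lt_add_one (zero_le_one.trans hCθ)).le
    rw [← hM] at this
    linarith
  have hB1 : 2 * e * C / ε ≤ B := Nat.le_ceil _
  have hB2 : (2 * B + 1 : ℝ) ≤ C * (4 * e / ε + 3) := by
    have h1 : (B : ℝ) ≤ 2 * e * C / ε + 1 := (Nat.ceil_lt_add_one (by positivity)).le
    have h2 : C * (4 * e / ε + 3) = 2 * (2 * e * C / ε) + 3 * C := by ring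
    linarith
  have hMB : (e : ℝ) * M ≤ B * (ε * θ) := by
    calc (e : ℝ) * M ≤ e * (2 * C * θ) := by gcongr
      _ = 2 * e * C / ε * (ε * θ) := by field_simp
      _ ≤ _ := by gcongr
  have hlast := ha (Fin.last e)
  have hq0 : 0 < a.1 (Fin.last e) := a.2.2 _
  have hcard : (a.1 (Fin.last e)).toNat * (2 * B + 1) ^ (e - 1) < (M + 1) ^ e := by
    have h1 : ((a.1 (Fin.last e)).toNat : ℝ) = a.1 (Fin.last e) := by
      exact_mod_cast congrArg (Int.cast (R := ℝ)) (Int.toNat_of_nonneg hq0.le)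
    have h2 : ((a.1 (Fin.last e)).toNat : ℝ) * (2 * B + 1) ^ (e - 1) < (M + 1) ^ e := by
      rw [h1]
      calc (a.1 (Fin.last e) : ℝ) * (2 * B + 1) ^ (e - 1)
          ≤ y * T * (C * (4 * e / ε + 3)) ^ (e - 1) := by gcongr; exact hlast.2
        _ = (y * (4 * e / ε + 3) ^ (e - 1)) * C ^ (e - 1) * T := by rw [mul_pow]; ring
        _ ≤ C * C ^ (e - 1) * T := by
            gcongr
            rw [hC]
            linarith
        _ = (C * θ) ^ e := by
            rw [mul_pow, hθe, ← pow_succ', Nat.sub_add_cancel he]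
        _ < _ := pow_lt_pow_left₀ (by linarith) (by positivity) (NeZero.ne e)
    exact_mod_cast h2
  obtain ⟨N, hN0, hN⟩ := exists_det_pos_of_not_hasShort (by positivity) hMB hcard hshort
  have hker := isKernelBasis_ker a.2.1
  have hNI : N.det ≤ I := by
    have h1 := Matrix.det_le (abv := (AbsoluteValue.abs : AbsoluteValue ℤ ℤ)) (x := (M : ℤ))
      (A := kerB a.1 * N) hN
    rw [Matrix.det_mul, hker.det_eq, AbsoluteValue.abs_apply,
      abs_of_pos (mul_pos hq0 hN0), Fintype.card_fin, nsmul_eq_mul] at h1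
    have h2 : (a.1 (Fin.last e) : ℝ) * N.det ≤ e.factorial * M ^ e := by exact_mod_cast h1
    have h3 : (0 : ℝ) < N.det := by exact_mod_cast hN0
    have h4 : (N.det : ℝ) ≤ e.factorial * (2 * C) ^ e / η := by
      rw [le_div_iff₀ hη]
      refine le_of_mul_le_mul_right ?_ hT0
      calc (N.det : ℝ) * η * T = η * T * N.det := by ring
        _ ≤ a.1 (Fin.last e) * N.det := by gcongr; exact hlast.1
        _ ≤ e.factorial * M ^ e := h2
        _ ≤ e.factorial * (2 * C * θ) ^ e := by gcongr
        _ = _ := by rw [mul_pow, hθe]; ring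
    exact_mod_cast h4.trans (Nat.le_ceil _)
  obtain ⟨γ, hγ⟩ := hK _ _ hN0 hNI M hN
  have hmem : latticePoint a.1 * castSL γ ∈ boundedSL e n := by
    intro i j
    have h1 : (latticePoint a.1 * castSL γ).1 i j =
        (geomScale a.1)⁻¹ * ((a.1 i.castSucc : ℝ) * (((kerB a.1 * γ.1) i j : ℤ) : ℝ)) :=
      latticePoint_mulVec a (fun k => γ.1 k j) i
    have hS := geomScale_pos a.2.2
    have hSge := geomScale_ge hη hT0 fun i => (ha i).1
    have h2 : |(((kerB a.1 * γ.1) i j : ℤ) : ℝ)| ≤ K * M := by exact_mod_cast hγ i j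
    have h3 : |(a.1 i.castSucc : ℝ)| ≤ y * T := by
      rw [abs_of_pos (by exact_mod_cast a.2.2 _)]
      exact (ha _).2
    rw [h1, abs_mul, abs_mul, abs_of_pos (inv_pos.2 hS)]
    refine le_trans ?_ hn'
    have hη' : 0 < (η ^ (e + 1)) ^ (1 / (e : ℝ)) := by positivity
    calc (geomScale a.1)⁻¹ * (|(a.1 i.castSucc : ℝ)| * |(((kerB a.1 * γ.1) i j : ℤ) : ℝ)|)
        ≤ ((η ^ (e + 1)) ^ (1 / (e : ℝ)) * (T * θ))⁻¹ * (y * T * (K * (2 * C * θ))) := by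
          gcongr
          exact h2.trans (by gcongr)
      _ = _ := by
          field_simp
  have h := orbitSum_cutoff_eq_one hmem 1
  rwa [orbitSum_mul_castSL, orbitSum_mul_castSL] at h

end ReducedBasis

section Tightness

open Filter Topology CompactlySupported

variable {e : ℕ}

lemma finite_posPrim_support {n : ℕ} {w : (Fin n → ℝ) → ℝ} {y : ℝ}
    (hw : ∀ x, w x ≠ 0 → ∀ i, 0 < x i ∧ x i ≤ y) {T : ℝ} (hT : 0 < T) :
    {a : PosPrim n | w (fun i => a.1 i / T) ≠ 0}.Finite := by
  refine Set.Finite.of_finite_image ((Finset.finite_toSet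
    (Fintype.piFinset fun _ : Fin n => Finset.Icc 1 ⌊y * T⌋)).subset ?_)
    Subtype.val_injective.injOn
  rintro _ ⟨a, ha, rfl⟩
  exact Finset.mem_coe.2 (mem_box_of_ne_zero hw hT ha)

lemma HasShort.exists_orthogonal {a : Fin (e + 1) → ℤ} {η y T s : ℝ} (hη : 0 < η) (hT : 0 < T)
    (ha : ∀ i, η * T ≤ a i ∧ (a i : ℝ) ≤ y * T) (h : HasShort a s) :
    ∃ x : Fin (e + 1) → ℤ, x ≠ 0 ∧ (∀ j, |(x j : ℝ)| ≤ (1 + e * y / η) * s) ∧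
      ∑ i, a i * x i = 0 := by
  obtain ⟨x, hx0, ⟨k, hk⟩, hxs⟩ := h
  have hpos : ∀ i, (0 : ℝ) < a i := fun i => (mul_pos hη hT).trans_le (ha i).1
  obtain ⟨j₀, hj₀⟩ := Function.ne_iff.1 hx0
  have hs : 0 < s := (abs_nonneg _).trans_lt (hxs j₀)
  have hy : 0 < y := pos_of_mul_pos_left ((hpos (Fin.last e)).trans_le (ha _).2) hT.le
  refine ⟨Fin.snoc x (-k), fun h => hx0 (funext fun i => ?_), fun j => ?_, ?_⟩
  · simpa using congrFun h i.castSucc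
  · refine Fin.lastCases ?_ (fun i => ?_) j
    · rw [Fin.snoc_last, Int.cast_neg, abs_neg]
      have h1 : (a (Fin.last e) : ℝ) * |(k : ℝ)| ≤ e * (y * T * s) := by
        rw [← abs_of_pos (hpos (Fin.last e)), ← abs_mul, ← Int.cast_mul, ← hk]
        push_cast
        refine (Finset.abs_sum_le_sum_abs _ _).trans ((Finset.sum_le_card_nsmul _ _ (y * T * s)
          fun i _ => ?_).trans_eq (by simp))
        rw [abs_mul, abs_of_pos (hpos _)]
        exact mul_le_mul (ha _).2 (hxs i).le (abs_nonneg _) (by positivity)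
      have h2 : η * T * |(k : ℝ)| ≤ e * (y * T * s) :=
        (mul_le_mul_of_nonneg_right (ha _).1 (abs_nonneg _)).trans h1
      have h3 : |(k : ℝ)| ≤ e * y / η * s := by
        refine le_of_mul_le_mul_left (h2.trans_eq ?_) (mul_pos hη hT)
        field_simp
      refine h3.trans ?_
      rw [add_mul, one_mul]
      linarith
    · rw [Fin.snoc_castSucc]
      refine (hxs i).le.trans (le_mul_of_one_le_left hs.le ?_)
      have : 0 ≤ e * y / η := by positivity
      linarith
  · rw [Fin.sum_univ_castSucc]
    simp [hk]

/-- Vectors whose congruence lattice contains a short vector are rare. -/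
lemma exists_card_hasShort_le [NeZero e] {η y : ℝ} (hη : 0 < η) (hy : 0 ≤ y) :
    ∃ C : ℝ, 0 ≤ C ∧ ∀ ε : ℝ, 0 < ε → ε ≤ 1 → ∀ T : ℝ, 1 ≤ T → ∀ Z : Finset (PosPrim (e + 1)),
      (∀ a ∈ Z, (∀ i, η * T ≤ a.1 i ∧ (a.1 i : ℝ) ≤ y * T) ∧
        HasShort a.1 (ε * T ^ (1 / (e : ℝ)))) → (Z.card : ℝ) ≤ C * ε * T ^ (e + 1) := by
  have he : 1 ≤ e := NeZero.one_le
  set c : ℝ := 1 + e * y / η with hc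
  have hc0 : 0 ≤ c := by positivity
  refine ⟨(e + 1) * 2 * 3 ^ e * (y + c) ^ e * c ^ e, by positivity, fun ε hε hε1 T hT Z hZ => ?_⟩
  have hT0 : 0 < T := by linarith
  set θ : ℝ := T ^ (1 / (e : ℝ)) with hθ
  have hθ0 : 0 < θ := Real.rpow_pos_of_pos hT0 _
  have hθe : θ ^ e = T := by
    rw [hθ, one_div, Real.rpow_inv_natCast_pow hT0.le (NeZero.ne e)]
  have hθT : θ ≤ T := by
    refine (Real.rpow_le_rpow_of_exponent_le hT ?_).trans_eq (Real.rpow_one T)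
    rw [one_div]
    exact inv_le_one_of_one_le₀ (by exact_mod_cast he)
  set A : ℕ := ⌊y * T⌋₊
  set X : ℕ := ⌊c * (ε * θ)⌋₊
  have hA : (A : ℝ) ≤ y * T := Nat.floor_le (by positivity)
  have hX : (X : ℝ) ≤ c * (ε * θ) := Nat.floor_le (by positivity)
  have hcard := card_le_of_short_orthogonal he A X (Z.map ⟨Subtype.val, Subtype.val_injective⟩)
    (fun a ha => ?_) (fun a ha => ?_)
  · replace hcard := (Finset.card_map _).symm.trans_le hcard
    have h1 : (Z.card : ℝ) ≤ (e + 1) * (2 * X) * (3 ^ e * (A + X) ^ e * X ^ (e - 1)) := by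
      exact_mod_cast hcard
    calc (Z.card : ℝ) ≤ (e + 1) * (2 * X) * (3 ^ e * (A + X) ^ e * X ^ (e - 1)) := h1
      _ = (e + 1) * 2 * 3 ^ e * (A + X) ^ e * X ^ e := by
          obtain ⟨f, hf⟩ := Nat.exists_eq_add_of_le' he
          rw [hf, Nat.add_sub_cancel]
          ring
      _ ≤ (e + 1) * 2 * 3 ^ e * ((y + c) * T) ^ e * (c * (ε * θ)) ^ e := by
          gcongr
          rw [add_mul]
          refine add_le_add hA (hX.trans ?_)
          gcongr
          exact (mul_le_of_le_one_left hθ0.le hε1).trans hθT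
      _ = (e + 1) * 2 * 3 ^ e * (y + c) ^ e * c ^ e * ε ^ e * T ^ (e + 1) := by
          rw [mul_pow, mul_pow, mul_pow, hθe]
          ring
      _ ≤ _ := by
          gcongr
          exact pow_le_of_le_one hε.le hε1 (NeZero.ne e)
  · obtain ⟨b, hb, rfl⟩ := Finset.mem_map.1 ha
    intro i
    refine ⟨b.2.2 i, ?_⟩
    have h1 := (b.2.2 i).le
    have h2 : (b.1 i).toNat ≤ A := by
      refine Nat.le_floor ?_
      have h3 : ((b.1 i).toNat : ℝ) = b.1 i := by
        exact_mod_cast congrArg (Int.cast (R := ℝ)) (Int.toNat_of_nonneg h1)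
      rw [h3]
      exact ((hZ b hb).1 i).2
    change b.1 i ≤ A
    omega
  · obtain ⟨b, hb, rfl⟩ := Finset.mem_map.1 ha
    obtain ⟨x, hx0, hx, hbx⟩ := (hZ b hb).2.exists_orthogonal hη hT0 (hZ b hb).1
    refine ⟨x, hx0, fun j => ?_, hbx⟩
    have h1 : (x j).natAbs ≤ X := by
      refine Nat.le_floor ?_
      rw [Nat.cast_natAbs, Int.cast_abs]
      exact hx j
    rw [Int.abs_eq_natAbs]
    exact_mod_cast h1

lemma exists_abs_sub_primSum_cutoff_le [NeZero e] {w : (Fin (e + 1) → ℝ) → ℝ} {η y Cw : ℝ}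
    (hw0 : ∀ x, 0 ≤ w x) (hCw : ∀ x, w x ≤ Cw) (hη : 0 < η) (hy : 0 ≤ y)
    (hw : ∀ x, w x ≠ 0 → ∀ i, η ≤ x i ∧ x i ≤ y) :
    ∃ C : ℝ, 0 ≤ C ∧ ∀ ε : ℝ, 0 < ε → ε ≤ 1 → ∃ n₀ : ℕ, ∀ n ≥ n₀, ∀ T : ℝ, 1 ≤ T →
      |(∑' a : PosPrim (e + 1), w (fun i => a.1 i / T)) / T ^ (e + 1) -
        primSum (cutoff e n) w T / T ^ (e + 1)| ≤ C * ε := by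
  classical
  obtain ⟨C, hC0, hC⟩ := exists_card_hasShort_le (e := e) hη hy
  have hCw0 : 0 ≤ Cw := (hw0 0).trans (hCw 0)
  refine ⟨Cw * C, by positivity, fun ε hε hε1 => ?_⟩
  obtain ⟨n₀, hn₀⟩ := exists_orbitSum_cutoff_latticePoint (e := e) hε hη hy
  refine ⟨n₀, fun n hn T hT => ?_⟩
  have hT0 : 0 < T := by linarith
  have hw' : ∀ x, w x ≠ 0 → ∀ i, 0 < x i ∧ x i ≤ y := fun x hx i =>
    ⟨hη.trans_le (hw x hx i).1, (hw x hx i).2⟩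
  have hfin := finite_posPrim_support hw' hT0
  set F := hfin.toFinset
  have hF : ∀ a ∉ F, w (fun i => a.1 i / T) = 0 := fun a ha => by
    by_contra h
    exact ha (hfin.mem_toFinset.2 h)
  have hbound : ∀ a ∈ F, ∀ i, η * T ≤ a.1 i ∧ (a.1 i : ℝ) ≤ y * T := fun a ha i => by
    have h := hw _ (hfin.mem_toFinset.1 ha) i
    rwa [le_div_iff₀ hT0, div_le_iff₀ hT0] at h
  set Z := F.filter fun a => HasShort a.1 (ε * T ^ (1 / (e : ℝ)))
  have hZ := hC ε hε hε1 T hT Z fun a ha =>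
    ⟨hbound a (Finset.mem_filter.1 ha).1, (Finset.mem_filter.1 ha).2⟩
  rw [← sub_div, abs_div, abs_of_pos (pow_pos hT0 _), div_le_iff₀ (pow_pos hT0 _), primSum,
    tsum_eq_sum hF, tsum_eq_sum (s := F) fun a ha => by rw [hF a ha, zero_mul],
    ← Finset.sum_sub_distrib]
  have hterm : ∀ a ∈ F, |w (fun i => a.1 i / T) -
      w (fun i => a.1 i / T) * orbitSum (cutoff e n) (latticePoint a.1)| ≤
      if HasShort a.1 (ε * T ^ (1 / (e : ℝ))) then Cw else 0 := by
    intro a ha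
    split_ifs with h
    · have h0 := orbitSum_nonneg (φ := cutoff e n) (cutoff_nonneg n) (latticePoint a.1)
      have h1 := orbitSum_cutoff_le n (latticePoint a.1)
      have h2 := hw0 (fun i => a.1 i / T)
      rw [abs_le]
      constructor <;> nlinarith [hCw (fun i => a.1 i / T)]
    · rw [hn₀ n hn T hT a (hbound a ha) h, mul_one, sub_self, abs_zero]
  refine (Finset.abs_sum_le_sum_abs _ _).trans ((Finset.sum_le_sum hterm).trans ?_)
  rw [← Finset.sum_filter, Finset.sum_const, nsmul_eq_mul]
  calc (Z.card : ℝ) * Cw ≤ C * ε * T ^ (e + 1) * Cw := by gcongr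
    _ = _ := by ring

/-- Equidistribution of the lattices attached to positive primitive integer vectors. -/
theorem tendsto_primSum [NeZero e] (μ : Measure (XQuot e)) [IsProbabilityMeasure μ]
    (hinv : ∀ g : SLR e, Measure.map (fun x => g • x) μ = μ)
    {w : (Fin (e + 1) → ℝ) → ℝ} {η y Cw : ℝ} (hwc : Continuous w) (hw0 : ∀ x, 0 ≤ w x)
    (hCw : ∀ x, w x ≤ Cw) (hη : 0 < η) (hy : 0 ≤ y) (hw : ∀ x, w x ≠ 0 → ∀ i, η ≤ x i ∧ x i ≤ y)
    {φ : C_c(SLR e, ℝ)} (hφ : ∀ g, 0 ≤ φ g) :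
    Tendsto (fun T => primSum φ w T / T ^ (e + 1)) atTop
      (𝓝 ((∫ x, w x) / zetaVal (e + 1) * ∫ x, quotSum φ x ∂μ)) := by
  have he := NeZero.one_le (n := e)
  obtain ⟨κ, -, hκ⟩ := exists_tendsto_primSum μ hinv hwc hw0 hCw hη hy hw
  suffices h : κ = (∫ x, w x) / zetaVal (e + 1) by
    rw [← h]
    exact hκ φ hφ
  obtain ⟨C, hC0, hC⟩ := exists_abs_sub_primSum_cutoff_le hw0 hCw hη hy hw
  have hall := tendsto_tsum_posPrim (n := e + 1) (by omega) (w := w) (C := Cw)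
    (fun x => by rw [abs_of_nonneg (hw0 x)]; exact hCw x) hy
    (fun x hx i => ⟨hη.trans_le (hw x hx i).1, (hw x hx i).2⟩)
    (Eventually.of_forall fun x => hwc.continuousAt)
  set J := (∫ x, w x) / zetaVal (e + 1)
  have key : ∀ ε : ℝ, 0 < ε → ε ≤ 1 → |J - κ| ≤ C * ε := by
    intro ε hε hε1
    obtain ⟨n₀, hn₀⟩ := hC ε hε hε1
    have h1 : ∀ n ≥ n₀, |J - κ * ∫ x, quotSum (cutoff e n) x ∂μ| ≤ C * ε := fun n hn =>
      le_of_tendsto (hall.sub (hκ _ (cutoff_nonneg n))).abs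
        ((eventually_ge_atTop 1).mono fun T hT => hn₀ n hn T hT)
    have h2 : Tendsto (fun n => |J - κ * ∫ x, quotSum (cutoff e n) x ∂μ|) atTop
        (𝓝 |J - κ * 1|) :=
      (tendsto_const_nhds.sub ((tendsto_integral_quotSum_cutoff μ).const_mul κ)).abs
    rw [mul_one] at h2
    exact le_of_tendsto h2 ((eventually_ge_atTop n₀).mono h1)
  have hlim : Tendsto (fun ε : ℝ => C * ε) (𝓝[>] 0) (𝓝 (C * 0)) :=
    ((continuous_const.mul continuous_id).tendsto 0).mono_left nhdsWithin_le_nhds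
  rw [mul_zero] at hlim
  have h0 : |J - κ| ≤ 0 := ge_of_tendsto hlim (by
    filter_upwards [Ioc_mem_nhdsGT (zero_lt_one (α := ℝ))] with ε hε using key ε hε.1 hε.2)
  exact (sub_eq_zero.1 (abs_nonpos_iff.1 h0)).symm

end Tightness

section LimitDistribution

open Filter Topology CompactlySupported

variable {e : ℕ}

lemma eventually_lt_ncard_of_weights [NeZero e] (μ : Measure (XQuot e)) [IsProbabilityMeasure μ]
    (hinv : ∀ g : SLR e, Measure.map (fun x => g • x) μ = μ)
    {w : (Fin (e + 1) → ℝ) → ℝ} {η y : ℝ} (hwc : Continuous w) (hw0 : ∀ x, 0 ≤ w x)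
    (hw1 : ∀ x, w x ≤ 1) (hη : 0 < η) (hy : 0 ≤ y) (hw : ∀ x, w x ≠ 0 → ∀ i, η ≤ x i ∧ x i ≤ y)
    {f : XQuot e → ℝ} (hf : Continuous f) (hf0 : ∀ x, 0 ≤ f x) (hf1 : ∀ x, f x ≤ 1)
    {S : ℝ → Set (Fin (e + 1) → ℤ)} (hS : ∀ T, 0 < T → (S T).Finite)
    (h : ∀ᶠ T in atTop, ∀ a : PosPrim (e + 1), w (fun i => a.1 i / T) ≠ 0 →
      f (QuotientGroup.mk (latticePoint a.1)) ≠ 0 → a.1 ∈ S T)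
    {b : ℝ} (hb : b < (∫ x, w x) / zetaVal (e + 1) * ∫ x, f x ∂μ) :
    ∀ᶠ T in atTop, b < (S T).ncard / T ^ (e + 1) := by
  classical
  have hlim : Tendsto (fun n => ∫ x, f x * quotSum (cutoff e n) x ∂μ) atTop
      (𝓝 (∫ x, f x ∂μ)) := by
    refine tendsto_integral_of_dominated_convergence (fun _ => (1 : ℝ))
      (fun n => (hf.mul (continuous_quotSum _)).aestronglyMeasurable) (integrable_const _)
      (fun n => Eventually.of_forall fun x => ?_) (Eventually.of_forall fun x => ?_)
    · rw [Real.norm_of_nonneg (mul_nonneg (hf0 x) (quotSum_cutoff_nonneg n x))]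
      exact mul_le_one₀ (hf1 x) (quotSum_cutoff_nonneg n x) (quotSum_cutoff_le n x)
    · simpa using (tendsto_quotSum_cutoff x).const_mul (f x)
  obtain ⟨n, hn⟩ := ((hlim.const_mul _).eventually_const_lt hb).exists
  have hφ : ∀ g, 0 ≤ mulQuot f hf (cutoff e n) g := fun g => by
    rw [mulQuot_apply]
    exact mul_nonneg (hf0 _) (cutoff_nonneg n g)
  have hp := tendsto_primSum μ hinv hwc hw0 hw1 hη hy hw hφ
  simp only [quotSum_mulQuot] at hp
  filter_upwards [hp.eventually_const_lt hn, h, eventually_gt_atTop 0] with T hT hST hT0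
  refine hT.trans_le ?_
  gcongr
  have hfin := finite_posPrim_support (fun x hx i => ⟨hη.trans_le (hw x hx i).1, (hw x hx i).2⟩) hT0
  set F := hfin.toFinset.filter fun a => f (QuotientGroup.mk (latticePoint a.1)) ≠ 0
  have hF : ∀ a ∉ F, w (fun i => a.1 i / T) *
      orbitSum (mulQuot f hf (cutoff e n)) (latticePoint a.1) = 0 := fun a ha => by
    by_contra hne
    refine ha (Finset.mem_filter.2 ⟨hfin.mem_toFinset.2 (left_ne_zero_of_mul hne), fun h0 => ?_⟩)
    exact right_ne_zero_of_mul hne (by rw [orbitSum_mulQuot, h0, zero_mul])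
  rw [primSum, tsum_eq_sum hF]
  have hle : (∑ a ∈ F, w (fun i => a.1 i / T) *
      orbitSum (mulQuot f hf (cutoff e n)) (latticePoint a.1)) ≤ F.card := by
    refine (Finset.sum_le_card_nsmul _ _ 1 fun a _ => ?_).trans_eq (by simp)
    rw [orbitSum_mulQuot]
    have h0 := orbitSum_nonneg (cutoff_nonneg n) (latticePoint a.1)
    exact mul_le_one₀ (hw1 _) (mul_nonneg (hf0 _) h0)
      (mul_le_one₀ (hf1 _) h0 (orbitSum_cutoff_le n _))
  refine hle.trans (Nat.cast_le.2 ?_)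
  rw [← Set.ncard_coe_finset F, ← Set.ncard_image_of_injective (F : Set (PosPrim (e + 1)))
    (f := fun a : PosPrim (e + 1) => a.1) Subtype.val_injective]
  refine Set.ncard_le_ncard ?_ (hS T hT0)
  rintro _ ⟨a, ha, rfl⟩
  obtain ⟨h1, h2⟩ := Finset.mem_filter.1 (Finset.mem_coe.1 ha)
  exact hST a (hfin.mem_toFinset.1 h1) h2

lemma exists_weight_lt_integral {n : ℕ} [NeZero n] {D : Set (Fin n → ℝ)}
    (hDpos : D ⊆ {x | ∀ i, 0 < x i}) (hDbdd : Bornology.IsBounded D)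
    (hD : volume (frontier D) = 0) {b : ℝ} (hb : b < (volume D).toReal) :
    ∃ (w : (Fin n → ℝ) → ℝ) (η y : ℝ), Continuous w ∧ (∀ x, 0 ≤ w x) ∧ (∀ x, w x ≤ 1) ∧ 0 < η ∧
      0 ≤ y ∧ (∀ x, w x ≠ 0 → x ∈ D) ∧ (∀ x, w x ≠ 0 → ∀ i, η ≤ x i ∧ x i ≤ y) ∧
      b < ∫ x, w x ∧ ∫ x, w x ≤ (volume D).toReal := by
  have hint := measure_interior_of_null_frontier hD
  have hfinD : volume (interior D) ≠ ⊤ := by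
    rw [hint]; exact hDbdd.measure_lt_top.ne
  rw [← hint] at hb ⊢
  obtain ⟨K, hKD, hK, hbK⟩ : ∃ K ⊆ interior D, IsCompact K ∧ b < (volume K).toReal := by
    rcases lt_or_ge b 0 with h | h
    · exact ⟨∅, Set.empty_subset _, isCompact_empty, by simpa using h⟩
    · obtain ⟨K, h1, h2, h3⟩ := isOpen_interior.exists_lt_isCompact
        ((ENNReal.ofReal_lt_iff_lt_toReal h hfinD).2 hb)
      exact ⟨K, h1, h2, (ENNReal.ofReal_lt_iff_lt_toReal h h2.measure_lt_top.ne).1 h3⟩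
  obtain ⟨w, hwK, hwc, hwD, hw01⟩ :=
    exists_continuousMap_one_of_isCompact_subset_isOpen hK isOpen_interior hKD
  have hsupp : ∀ x, w x ≠ 0 → x ∈ tsupport w := fun x hx => subset_tsupport _ hx
  have hη : ∀ i, ∃ η : ℝ, 0 < η ∧ ∀ x ∈ tsupport w, η ≤ x i := fun i =>
    hwc.exists_forall_le' (continuous_apply i).continuousOn
      fun x hx => hDpos (interior_subset (hwD hx)) i
  choose η hη0 hηle using hη
  obtain ⟨i₀, hi₀⟩ := Finite.exists_min η
  obtain ⟨y, hy⟩ := hDbdd.exists_norm_le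
  have hwi : Integrable w := w.continuous.integrable_of_hasCompactSupport hwc
  refine ⟨w, η i₀, max y 0, w.continuous, fun x => (hw01 x).1, fun x => (hw01 x).2, hη0 i₀,
    le_max_right _ _, fun x hx => interior_subset (hwD (hsupp x hx)), fun x hx i =>
    ⟨(hi₀ i).trans (hηle i x (hsupp x hx)), ?_⟩, hbK.trans_le ?_, ?_⟩
  · exact (le_abs_self _).trans ((norm_le_pi_norm x i).trans
      ((hy x (interior_subset (hwD (hsupp x hx)))).trans (le_max_left _ _)))
  · rw [← Measure.real, ← integral_indicator_one hK.measurableSet]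
    refine integral_mono ((integrable_indicator_iff hK.measurableSet).2
      (integrableOn_const hK.measure_lt_top.ne)) hwi fun x => ?_
    by_cases hx : x ∈ K
    · simp [hx, hwK hx]
    · simpa [hx] using (hw01 x).1
  · rw [← Measure.real, ← integral_indicator_one isOpen_interior.measurableSet]
    refine integral_mono hwi ((integrable_indicator_iff isOpen_interior.measurableSet).2
      (integrableOn_const hfinD)) fun x => ?_
    by_cases hx : x ∈ interior D
    · simpa [hx] using (hw01 x).2
    · have : w x = 0 := by
        by_contra h
        exact hx (hwD (hsupp x h))
      simp [this, hx]

lemma exists_continuous_lt_integral {X : Type*} [TopologicalSpace X] [MeasurableSpace X]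
    [BorelSpace X] (μ : Measure X) [IsProbabilityMeasure μ] {g : X → ℝ} (hg : Continuous g) {b : ℝ}
    (hb : b < (μ {x | 0 < g x}).toReal) :
    ∃ (f : X → ℝ) (δ : ℝ), Continuous f ∧ (∀ x, 0 ≤ f x) ∧ (∀ x, f x ≤ 1) ∧ 0 < δ ∧
      (∀ x, f x ≠ 0 → δ < g x) ∧ b < ∫ x, f x ∂μ ∧ ∫ x, f x ∂μ ≤ (μ {x | 0 < g x}).toReal := by
  have hopen : IsOpen {x | 0 < g x} := isOpen_lt continuous_const hg
  have hfc : ∀ k : ℕ, Continuous fun x => min 1 (max 0 (k * g x - 1)) := fun k => by fun_prop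
  have hf0 : ∀ (k : ℕ) x, 0 ≤ min 1 (max 0 (k * g x - 1)) := fun k x =>
    le_min zero_le_one (le_max_left _ _)
  have hnorm : ∀ (k : ℕ) x, ‖min 1 (max 0 (k * g x - 1))‖ ≤ 1 := fun k x => by
    rw [Real.norm_of_nonneg (hf0 k x)]; exact min_le_left _ _
  have hsupp : ∀ (k : ℕ) x, min 1 (max 0 (k * g x - 1)) ≠ 0 → 1 < k * g x := fun k x hx => by
    by_contra! h
    exact hx (by rw [max_eq_left (by linarith)]; exact min_eq_right zero_le_one)
  have hlim : Tendsto (fun k : ℕ => ∫ x, min 1 (max 0 (k * g x - 1)) ∂μ) atTop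
      (𝓝 (∫ x, {x | 0 < g x}.indicator 1 x ∂μ)) := by
    refine tendsto_integral_of_dominated_convergence (fun _ => (1 : ℝ))
      (fun k => (hfc k).aestronglyMeasurable) (integrable_const _)
      (fun k => Eventually.of_forall (hnorm k)) (Eventually.of_forall fun x => ?_)
    refine tendsto_const_nhds.congr' ?_
    by_cases hx : 0 < g x
    · obtain ⟨N, hN⟩ := exists_nat_ge (2 / g x)
      filter_upwards [eventually_ge_atTop N] with k hk
      have h1 : 2 ≤ k * g x := by
        rw [← div_le_iff₀ hx]
        exact hN.trans (by exact_mod_cast hk)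
      rw [max_eq_right (by linarith), min_eq_left (by linarith)]
      simp [hx]
    · refine Eventually.of_forall fun k : ℕ => ?_
      have h1 : (k : ℝ) * g x ≤ 0 := mul_nonpos_of_nonneg_of_nonpos k.cast_nonneg (not_lt.1 hx)
      beta_reduce
      rw [max_eq_left (by linarith), min_eq_right zero_le_one]
      simp [hx]
  rw [integral_indicator_one hopen.measurableSet, Measure.real] at hlim
  obtain ⟨k, hk, hk0⟩ := ((hlim.eventually_const_lt hb).and (eventually_gt_atTop 0)).exists
  have hk0' : (0 : ℝ) < k := by exact_mod_cast hk0
  refine ⟨_, 1 / k, hfc k, hf0 k, fun x => min_le_left _ _, by positivity, fun x hx => ?_, hk, ?_⟩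
  · rw [div_lt_iff₀' hk0']
    exact hsupp k x hx
  · rw [← Measure.real, ← integral_indicator_one hopen.measurableSet]
    refine integral_mono (Integrable.of_bound (hfc k).aestronglyMeasurable 1
      (Eventually.of_forall (hnorm k))) ((integrable_const 1).indicator hopen.measurableSet)
      fun x => ?_
    by_cases hx : 0 < g x
    · simp [hx]
    · have : min 1 (max 0 (k * g x - 1)) = 0 := by
        by_contra h
        exact hx (pos_of_mul_pos_right (zero_lt_one.trans (hsupp k x h)) hk0'.le)
      simp [this, hx]

lemma eventually_lt_ncard [NeZero e] (μ : Measure (XQuot e)) [IsProbabilityMeasure μ]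
    (hinv : ∀ g : SLR e, Measure.map (fun x => g • x) μ = μ)
    {D : Set (Fin (e + 1) → ℝ)} (hDpos : D ⊆ {x | ∀ i, 0 < x i})
    (hDbdd : Bornology.IsBounded D) (hD : volume (frontier D) = 0)
    {g : XQuot e → ℝ} (hg : Continuous g)
    {S : ℝ → Set (Fin (e + 1) → ℤ)} (hS : ∀ T, 0 < T → (S T).Finite)
    (h : ∀ η y δ : ℝ, 0 < η → 0 < δ → ∀ᶠ T in atTop, ∀ a : PosPrim (e + 1),
      (fun i => (a.1 i : ℝ) / T) ∈ D → (∀ i, η * T ≤ a.1 i ∧ (a.1 i : ℝ) ≤ y * T) →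
      δ < g (QuotientGroup.mk (latticePoint a.1)) → a.1 ∈ S T)
    {b : ℝ} (hb : b < (volume D).toReal / zetaVal (e + 1) * (μ {x | 0 < g x}).toReal) :
    ∀ᶠ T in atTop, b < (S T).ncard / T ^ (e + 1) := by
  have hopen : IsOpen {p : ℝ × ℝ | b < p.1 / zetaVal (e + 1) * p.2} :=
    isOpen_lt continuous_const (by fun_prop)
  obtain ⟨U, hU, V, hV, hUV⟩ := mem_nhds_prod_iff.1
    (hopen.mem_nhds (x := ((volume D).toReal, (μ {x | 0 < g x}).toReal)) hb)
  obtain ⟨v, hv, hvU⟩ := exists_Ioc_subset_of_mem_nhds hU (exists_lt _)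
  obtain ⟨m, hm, hmV⟩ := exists_Ioc_subset_of_mem_nhds hV (exists_lt _)
  obtain ⟨w, η, y, hwc, hw0, hw1, hη, hy, hwD, hw, hvw, hwv⟩ :=
    exists_weight_lt_integral hDpos hDbdd hD hv
  obtain ⟨f, δ, hf, hf0, hf1, hδ, hfg, hmf, hfm⟩ := exists_continuous_lt_integral μ hg hm
  refine eventually_lt_ncard_of_weights μ hinv hwc hw0 hw1 hη hy hw hf hf0 hf1 hS ?_
    (hUV (Set.mk_mem_prod (hvU ⟨hvw, hwv⟩) (hmV ⟨hmf, hfm⟩)))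
  filter_upwards [h η y δ hη hδ, eventually_gt_atTop 0] with T hT hT0 a ha hfa
  refine hT a (hwD _ ha) (fun i => ?_) (hfg _ hfa)
  have := hw _ ha i
  rwa [le_div_iff₀ hT0, div_le_iff₀ hT0] at this

lemma tendsto_ncard_posPrim [NeZero e] {D : Set (Fin (e + 1) → ℝ)}
    (hDpos : D ⊆ {x | ∀ i, 0 < x i}) (hDbdd : Bornology.IsBounded D)
    (hD : volume (frontier D) = 0) :
    Tendsto (fun T : ℝ => ({a : Fin (e + 1) → ℤ | Finset.univ.gcd a = 1 ∧
      (fun i => (a i : ℝ) / T) ∈ D}.ncard : ℝ) / T ^ (e + 1)) atTop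
      (𝓝 ((volume D).toReal / zetaVal (e + 1))) := by
  obtain ⟨y, hy⟩ := hDbdd.exists_norm_le
  have hw : ∀ x, D.indicator (1 : (Fin (e + 1) → ℝ) → ℝ) x ≠ 0 → ∀ i, 0 < x i ∧ x i ≤ max y 0 :=
    fun x hx i => by
      have hxD := Set.mem_of_indicator_ne_zero hx
      exact ⟨hDpos hxD i, (le_abs_self _).trans ((norm_le_pi_norm x i).trans
        ((hy x hxD).trans (le_max_left _ _)))⟩
  have he := NeZero.one_le (n := e)
  have h := tendsto_tsum_posPrim (n := e + 1) (by omega) (C := 1) (y := max y 0)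
    (w := D.indicator 1) (fun x => by
      by_cases hx : x ∈ D <;> simp [hx]) (le_max_right _ _) hw (by
      filter_upwards [measure_eq_zero_iff_ae_notMem.1 hD] with x hx
      exact continuousOn_const.continuousAt_indicator hx)
  rw [integral_indicator₀ (nullMeasurableSet_of_null_frontier hD)] at h
  simp only [Pi.one_apply, integral_const, smul_eq_mul, mul_one, Measure.real,
    Measure.restrict_apply_univ] at h
  refine h.congr' ?_
  filter_upwards [eventually_gt_atTop 0] with T hT
  have hfin := finite_posPrim_support hw hT
  have hts : (∑' a : PosPrim (e + 1), D.indicator (1 : (Fin (e + 1) → ℝ) → ℝ)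
      (fun i => (a.1 i : ℝ) / T)) = hfin.toFinset.card := by
    rw [tsum_eq_sum (s := hfin.toFinset) fun a ha => by
      by_contra hne
      exact ha (hfin.mem_toFinset.2 hne)]
    rw [Finset.sum_congr rfl (g := fun _ => (1 : ℝ)) fun a ha => ?_]
    · simp
    · have := Set.mem_of_indicator_ne_zero (hfin.mem_toFinset.1 ha)
      simp [this]
  rw [hts, ← Set.ncard_coe_finset, ← Set.ncard_image_of_injective
    (hfin.toFinset : Set (PosPrim (e + 1))) (f := fun a : PosPrim (e + 1) => a.1)
    Subtype.val_injective]
  congr 3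
  ext a
  constructor
  · rintro ⟨a, ha, rfl⟩
    exact ⟨a.2.1, Set.mem_of_indicator_ne_zero (hfin.mem_toFinset.1 (Finset.mem_coe.1 ha))⟩
  · rintro ⟨h1, h2⟩
    refine ⟨⟨a, h1, fun i => ?_⟩, Finset.mem_coe.2 (hfin.mem_toFinset.2 ?_), rfl⟩
    · have h3 : (0 : ℝ) < a i := (div_pos_iff_of_pos_right hT).1 (hDpos h2 i)
      exact_mod_cast h3
    · exact (Set.indicator_of_mem h2 _).trans_ne one_ne_zero

lemma finite_setOf_div_mem {n : ℕ} {D : Set (Fin n → ℝ)} (hD : Bornology.IsBounded D) {T : ℝ}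
    (hT : 0 < T) : {a : Fin n → ℤ | (fun i => (a i : ℝ) / T) ∈ D}.Finite := by
  obtain ⟨y, hy⟩ := hD.exists_norm_le
  refine (Finset.finite_toSet (Fintype.piFinset fun _ : Fin n =>
    Finset.Icc ⌈-(y * T)⌉ ⌊y * T⌋)).subset fun a ha => ?_
  refine Finset.mem_coe.2 (Fintype.mem_piFinset.2 fun i => Finset.mem_Icc.2 ?_)
  have h := (norm_le_pi_norm _ i).trans (hy _ ha)
  rw [Real.norm_eq_abs, abs_div, abs_of_pos hT, div_le_iff₀ hT, abs_le] at h
  exact ⟨Int.ceil_le.2 h.1, Int.le_floor.2 h.2⟩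

lemma eventually_two_le {η : ℝ} (hη : 0 < η) : ∀ᶠ T : ℝ in atTop, ∀ k : ℤ, η * T ≤ k → 2 ≤ k := by
  filter_upwards [eventually_gt_atTop (1 / η)] with T hT k hk
  rw [div_lt_iff₀' hη] at hT
  have : (1 : ℝ) < k := hT.trans_le hk
  have : 1 < k := by exact_mod_cast this
  omega

lemma eventually_sum_div_geomScale_le [NeZero e] {η δ : ℝ} (y : ℝ) (hη : 0 < η) (hδ : 0 < δ) :
    ∀ᶠ T : ℝ in atTop, ∀ a : Fin (e + 1) → ℤ, (∀ i, η * T ≤ a i ∧ (a i : ℝ) ≤ y * T) →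
      (∑ i, (a i : ℝ)) / geomScale a ≤ δ := by
  set c := (η ^ (e + 1)) ^ (1 / (e : ℝ))
  have hc : 0 < c := by positivity
  have he : (0 : ℝ) < 1 / e := by
    have := Nat.pos_of_ne_zero (NeZero.ne e)
    positivity
  filter_upwards [(tendsto_rpow_atTop he).eventually_ge_atTop ((e + 1) * y / (δ * c)),
    eventually_gt_atTop 0] with T hT hT0 a ha
  have h1 := geomScale_ge hη hT0 fun i => (ha i).1
  have hpos : 0 < geomScale a := (by positivity : 0 < c * (T * T ^ (1 / (e : ℝ)))).trans_le h1
  rw [div_le_iff₀ hpos]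
  rw [div_le_iff₀ (by positivity)] at hT
  calc ∑ i, (a i : ℝ) ≤ (e + 1) * (y * T) :=
        (Finset.sum_le_card_nsmul _ _ (y * T) fun i _ => (ha i).2).trans_eq (by simp)
    _ = (e + 1) * y * T := by ring
    _ ≤ T ^ (1 / (e : ℝ)) * (δ * c) * T := by gcongr
    _ = δ * (c * (T * T ^ (1 / (e : ℝ)))) := by ring
    _ ≤ δ * geomScale a := by gcongr

end LimitDistribution

/-- Marklof's limit distribution theorem for Frobenius numbers.
Here `e = d - 1 ≥ 2`, so the dimension is `d = e + 1 ≥ 3`. -/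
theorem marklof_limit_distribution (e : ℕ) (he : 2 ≤ e)
    (μ₀ : Measure (XQuot e)) (hprob : IsProbabilityMeasure μ₀)
    (hinv : ∀ g : SLR e, Measure.map (fun x => g • x) μ₀ = μ₀)
    (D : Set (Fin (e + 1) → ℝ)) (hDpos : D ⊆ {x | ∀ i, 0 < x i})
    (hDbdd : Bornology.IsBounded D)
    (hDfrontier : volume (frontier D) = 0) (R : ℝ) (hR : 0 ≤ R) :
    Filter.Tendsto
      (fun T : ℝ =>
        (Set.ncard {a : Fin (e + 1) → ℤ |
            Finset.univ.gcd a = 1 ∧ (∀ i, 2 ≤ a i) ∧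
            (fun i => (a i : ℝ) / T) ∈ D ∧
            (frobNum (e + 1) a : ℝ) ≤ R * (∏ i, (a i : ℝ)) ^ (1 / (e : ℝ))} : ℝ)
          / T ^ (e + 1))
      Filter.atTop
      (nhds ((volume D).toReal / zetaVal (e + 1) *
        (μ₀ (QuotientGroup.mk ''
          {g : SLR e | covRad e (simplexStd e) (latticeOf g) ≤ R})).toReal)) := by
  have : NeZero e := ⟨by omega⟩
  have hopen : MeasurableSet {x : XQuot e | covQuot x ≤ R} :=
    (isClosed_le continuous_covQuot continuous_const).measurableSet
  have hlt : {x : XQuot e | 0 < R - covQuot x} = {x | covQuot x ≤ R} \ {x | covQuot x = R} := by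
    ext x
    rw [Set.mem_ofPred_eq, sub_pos, lt_iff_le_and_ne]
    rfl
  have hgt : {x : XQuot e | 0 < covQuot x - R} = {x | covQuot x ≤ R}ᶜ := by
    ext x
    simp [sub_pos]
  have hμlt : μ₀ {x : XQuot e | 0 < R - covQuot x} = μ₀ {x | covQuot x ≤ R} := by
    rw [hlt]
    exact measure_sdiff_null (measure_covQuot_level he μ₀ hinv hR)
  have hμgt : (μ₀ {x : XQuot e | 0 < covQuot x - R}).toReal =
      1 - (μ₀ {x | covQuot x ≤ R}).toReal := by
    rw [hgt]
    exact probReal_compl_eq_one_sub hopen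
  have hfin : ∀ T : ℝ, 0 < T → ∀ P : (Fin (e + 1) → ℤ) → Prop,
      {a : Fin (e + 1) → ℤ | Finset.univ.gcd a = 1 ∧ (∀ i, 2 ≤ a i) ∧
        (fun i => (a i : ℝ) / T) ∈ D ∧ P a}.Finite := fun T hT P =>
    (finite_setOf_div_mem hDbdd hT).subset fun a ha => ha.2.2.1
  have hlow {b : ℝ} := eventually_lt_ncard μ₀ hinv hDpos hDbdd hDfrontier (b := b)
    (g := fun x => R - covQuot x) (by have := continuous_covQuot (e := e); fun_prop)
    (fun T hT => hfin T hT fun a => (frobNum (e + 1) a : ℝ) ≤ R * geomScale a)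
    fun η y δ hη hδ => by
      filter_upwards [eventually_two_le hη] with T hT a haD ha hδa
      refine ⟨a.2.1, fun i => hT _ (ha i).1, haD, frobNum_le_of_covSL_lt ?_⟩
      rw [covQuot_mk] at hδa
      linarith
  have hupp {b : ℝ} := eventually_lt_ncard μ₀ hinv hDpos hDbdd hDfrontier (b := b)
    (g := fun x => covQuot x - R) (by have := continuous_covQuot (e := e); fun_prop)
    (fun T hT => hfin T hT fun a => ¬ (frobNum (e + 1) a : ℝ) ≤ R * geomScale a)
    fun η y δ hη hδ => by
      filter_upwards [eventually_two_le hη, eventually_sum_div_geomScale_le (e := e) y hη hδ]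
        with T hT hsum a haD ha hδa
      refine ⟨a.2.1, fun i => hT _ (ha i).1, haD, fun hF => ?_⟩
      have h1 := covSL_le_of_frobNum_le hR hF
      have h2 := hsum a.1 ha
      rw [covQuot_mk] at hδa
      linarith
  have hall := tendsto_ncard_posPrim hDpos hDbdd hDfrontier
  rw [image_mk_covRad_le]
  rw [hμlt] at hlow
  rw [hμgt] at hupp
  simp only [geomScale] at hlow hupp
  set m := (μ₀ {x | covQuot x ≤ R}).toReal
  set V := (volume D).toReal / zetaVal (e + 1)
  refine tendsto_order.2 ⟨fun b hb => hlow hb, fun b hb => ?_⟩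
  have h1 := hall.eventually_lt_const (show V < V + (b - V * m) / 2 by linarith)
  have h2 := hupp (b := V * (1 - m) - (b - V * m) / 2) (by linarith)
  filter_upwards [h1, h2, Filter.eventually_gt_atTop 0] with T hT1 hT2 hT
  set A := {a : Fin (e + 1) → ℤ | Finset.univ.gcd a = 1 ∧ (∀ i, 2 ≤ a i) ∧
    (fun i => (a i : ℝ) / T) ∈ D ∧
    (frobNum (e + 1) a : ℝ) ≤ R * (∏ i, (a i : ℝ)) ^ (1 / (e : ℝ))} with hA
  set B := {a : Fin (e + 1) → ℤ | Finset.univ.gcd a = 1 ∧ (∀ i, 2 ≤ a i) ∧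
    (fun i => (a i : ℝ) / T) ∈ D ∧
    ¬ (frobNum (e + 1) a : ℝ) ≤ R * (∏ i, (a i : ℝ)) ^ (1 / (e : ℝ))} with hB
  have hAB : A.ncard + B.ncard ≤ {a : Fin (e + 1) → ℤ | Finset.univ.gcd a = 1 ∧
      (fun i => (a i : ℝ) / T) ∈ D}.ncard := by
    have hdisj : Disjoint A B := Set.disjoint_left.2 fun a ha hb => hb.2.2.2 ha.2.2.2
    rw [← Set.ncard_union_eq hdisj (hfin T hT _) (hfin T hT _)]
    refine Set.ncard_le_ncard ?_ ((finite_setOf_div_mem hDbdd hT).subset fun a ha => ha.2)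
    rintro a (ha | ha) <;> exact ⟨ha.1, ha.2.2.1⟩
  have hAB' : (A.ncard : ℝ) / T ^ (e + 1) + B.ncard / T ^ (e + 1) ≤
      ({a : Fin (e + 1) → ℤ | Finset.univ.gcd a = 1 ∧
        (fun i => (a i : ℝ) / T) ∈ D}.ncard : ℝ) / T ^ (e + 1) := by
    rw [← add_div]
    gcongr
    exact_mod_cast hAB
  linarith
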